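/- arXiv:math/0701553 — 3 statements merged into one kernel-verified Lean document; each statement's English description precedes it below -/
import Mathlib

section
/- For every positive integer n ≥ 4, the chromatic number of QI(n,2) equals ⌈(1/2)·C(n, ⌊n/2⌋)⌉. -/
/-- Two partitions of `{1,…,n}` are qualitatively independent if every class of
one meets every class of the other. -/
def QIPart {n : ℕ} (P Q : Finpartition (Finset.univ : Finset (Fin n))) : Prop :=
  ∀ A ∈ P.parts, ∀ B ∈ Q.parts, (A ∩ B).Nonempty

/-- Vertices of `QI(n,2)`: 2-partitions of an `n`-set with both classes of size
at least 2. -/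
def QIVertex (n k : ℕ) : Type :=
  {P : Finpartition (Finset.univ : Finset (Fin n)) //
    P.parts.card = k ∧ ∀ A ∈ P.parts, k ≤ A.card}

/-- The qualitative independence graph. -/
def QIGraph (n k : ℕ) : SimpleGraph (QIVertex n k) :=
  SimpleGraph.fromRel fun P Q => QIPart P.1 Q.1

structure IsMat {V : Type} (r : V → V → Prop) (f : V → V) : Prop where
  inv : ∀ v, f (f v) = v
  adj : ∀ v, f v = v ∨ r v (f v)

def fixs {V : Type} [Fintype V] [DecidableEq V] (f : V → V) : Finset V :=
  Finset.univ.filter fun v => f v = v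

def IsMaxMat {V : Type} [Fintype V] [DecidableEq V] (r : V → V → Prop) (f : V → V) : Prop :=
  IsMat r f ∧ ∀ g, IsMat r g → (fixs f).card ≤ (fixs g).card

def agree {V : Type} [Fintype V] [DecidableEq V] (f g : V → V) : Finset V :=
  Finset.univ.filter fun v => f v = g v ∧ f v ≠ v

section
variable {V : Type} [Fintype V] [DecidableEq V] {r : V → V → Prop}

lemma exists_max : ∃ f : V → V, IsMaxMat r f := by
  classical
  have hne : (Finset.univ.filter fun f : V → V => IsMat r f).Nonempty :=
    ⟨id, by simp; exact ⟨fun _ => rfl, fun _ => Or.inl rfl⟩⟩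
  obtain ⟨f, hf, hmin⟩ := Finset.exists_min_image _ (fun f => (fixs f).card) hne
  refine ⟨f, by simpa using hf, fun g hg => hmin g (by simpa using hg)⟩

/-- the matching obtained by adding an edge between two missed vertices -/
lemma no_adj_missed (hs : ∀ a b, r a b → r b a) (hi : ∀ a, ¬ r a a) {f : V → V}
    (hf : IsMaxMat r f) {u v : V} (h : r u v)
    (hu : f u = u) (hv : f v = v) : False := by
  have huv : u ≠ v := fun e => hi u (by rw [← e] at h; exact h)
  let g : V → V := fun w => if w = u then v else if w = v then u else f w
  have hfi := hf.1.inv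
  have hg : IsMat r g := by
    refine ⟨fun w => ?_, fun w => ?_⟩
    · simp only [g]
      grind
    · have := hf.1.adj w
      simp only [g]
      grind
  have hlt : (fixs g).card < (fixs f).card := by
    apply Finset.card_lt_card
    rw [Finset.ssubset_iff_of_subset]
    · exact ⟨u, by simp [fixs, hu], by simp [fixs, g, huv.symm]⟩
    · intro w; simp only [fixs, g, Finset.mem_filter, Finset.mem_univ, true_and]; grind
  exact absurd (hf.2 g hg) (by omega)

lemma gallai_trans (hs : ∀ a b, r a b → r b a) (hi : ∀ a, ¬ r a a) (u v t : V) (huv : u ≠ v)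
    (hmiss : ∃ g : V → V, IsMaxMat r g ∧ g t = t)
    (hut : ∀ f, IsMaxMat r f → f u = u → f t = t → False)
    (hvt : ∀ f, IsMaxMat r f → f v = v → f t = t → False)
    (f : V → V) (hf : IsMaxMat r f) (hu : f u = u) (hv : f v = v) : False := by
  classical
  obtain ⟨g0, hg0, hg0t⟩ := hmiss
  have hne : (Finset.univ.filter fun g : V → V => IsMaxMat r g ∧ g t = t).Nonempty :=
    ⟨g0, by simp [hg0, hg0t]⟩
  obtain ⟨g, hg, hmax⟩ := Finset.exists_max_image _ (fun g => (agree f g).card) hne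
  simp only [Finset.mem_filter, Finset.mem_univ, true_and] at hg hmax
  obtain ⟨hg, hgt⟩ := hg
  have hft : f t ≠ t := fun h => hut f hf hu h
  have hgu : g u ≠ u := fun h => hut g hg h hgt
  have hgv : g v ≠ v := fun h => hvt g hg h hgt
  have hcard : (fixs f).card = (fixs g).card := le_antisymm (hf.2 g hg.1) (hg.2 f hf.1)
  have h1 : 1 < (fixs f \ fixs g).card := by
    rw [Finset.one_lt_card]
    exact ⟨u, by simp [fixs, hu, hgu], v, by simp [fixs, hv, hgv], huv⟩
  have h2 : (fixs f \ fixs g).card = (fixs g \ fixs f).card := by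
    have e1 := Finset.card_sdiff_add_card_inter (fixs f) (fixs g)
    have e2 := Finset.card_sdiff_add_card_inter (fixs g) (fixs f)
    rw [Finset.inter_comm] at e2
    omega
  rw [h2] at h1
  obtain ⟨x, hx, hxt⟩ := Finset.exists_mem_ne h1 t
  simp only [fixs, Finset.mem_sdiff, Finset.mem_filter, Finset.mem_univ, true_and] at hx
  obtain ⟨hgx, hfx⟩ := hx
  have hxy : r x (f x) := (hf.1.adj x).resolve_left hfx
  obtain ⟨y, hy⟩ : ∃ y, y = f x := ⟨_, rfl⟩
  rw [← hy] at hfx hxy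
  have hgy : g y ≠ y := fun h => no_adj_missed hs hi hg hxy hgx h
  obtain ⟨z, hz⟩ : ∃ z, z = g y := ⟨_, rfl⟩
  rw [← hz] at hgy
  have hgi := hg.1.inv
  have hfi := hf.1.inv
  have hgz : g z = y := by rw [hz, hgi]
  have hfy : f y = x := by rw [hy, hfi]
  have hzx : z ≠ x := by rintro rfl; exact hgy (by rw [← hgx, hgz])
  let g' : V → V := fun w => if w = x then y else if w = y then x else if w = z then z else g w
  have hg' : IsMat r g' := by
    refine ⟨fun w => ?_, fun w => ?_⟩
    · have := hgi w
      simp only [g']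
      grind
    · have := hg.1.adj w
      have := hs _ _ hxy
      simp only [g']
      grind
  have hfix : fixs g' = insert z ((fixs g).erase x) := by
    ext w
    simp only [fixs, g', Finset.mem_filter, Finset.mem_univ, true_and, Finset.mem_insert,
      Finset.mem_erase]
    grind
  have hfc : (fixs g').card ≤ (fixs g).card := by
    rw [hfix]
    have hxm : x ∈ fixs g := by simp [fixs, hgx]
    have := Finset.card_insert_le z ((fixs g).erase x)
    have := Finset.card_erase_add_one hxm
    omega
  have hg'm : IsMaxMat r g' := ⟨hg', fun k hk => hfc.trans (hg.2 k hk)⟩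
  have hty : t ≠ y := by rintro rfl; exact hgy (by rw [hz, hgt])
  have hg't : g' t = t := by
    simp only [g']; grind
  have hle := hmax g' ⟨hg'm, hg't⟩
  have hlt : (agree f g).card < (agree f g').card := by
    apply Finset.card_lt_card
    rw [Finset.ssubset_iff_of_subset]
    · refine ⟨x, ?_, ?_⟩
      · simp [agree, g', ← hy, hfx]
      · simp [agree, ← hy, hgx]
    · intro w
      simp only [agree, g', Finset.mem_filter, Finset.mem_univ, true_and]
      grind
  omega

lemma gallai (hs : ∀ a b, r a b → r b a) (hi : ∀ a, ¬ r a a)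
    (htr : ∀ u v : V, ∃ e : V ≃ V, e u = v ∧ ∀ a b, r a b → r (e a) (e b))
    (hconn : ∀ u v : V, Relation.ReflTransGen r u v) :
    ∃ f : V → V, IsMat r f ∧ ∀ u v, f u = u → f v = v → u = v := by
  obtain ⟨f, hf⟩ := exists_max (V := V) (r := r)
  refine ⟨f, hf.1, ?_⟩
  intro u v hu hv
  have hall : ∀ t, ∃ g : V → V, IsMaxMat r g ∧ g t = t := by
    intro t
    obtain ⟨e, he, hr⟩ := htr u t
    refine ⟨fun w => e (f (e.symm w)), ⟨⟨fun w => by simp [hf.1.inv], fun w => ?_⟩, ?_⟩, ?_⟩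
    · rcases hf.1.adj (e.symm w) with h | h
      · left; rw [h]; simp
      · right; simpa using hr _ _ h
    · intro g hg
      refine le_trans (le_of_eq ?_) (hf.2 g hg)
      symm
      apply Finset.card_bij (fun a _ => e a)
      · intro a ha; simpa [fixs] using ha
      · intro a _ b _ h; exact e.injective h
      · intro b hb
        refine ⟨e.symm b, ?_, by simp⟩
        simp only [fixs, Finset.mem_filter, Finset.mem_univ, true_and] at hb ⊢
        exact e.injective (by simpa using hb)
    · simp [← he, hu]
  have key : ∀ w, Relation.ReflTransGen r u w →
      u = w ∨ ∀ g, IsMaxMat r g → g u = u → g w = w → False := by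
    intro w hw
    induction hw with
    | refl => exact Or.inl rfl
    | @tail b c hb hbc ih =>
      by_cases huc : u = c
      · exact Or.inl huc
      right
      rcases ih with rfl | ih
      · intro g hg h1 h2
        exact no_adj_missed hs hi hg hbc h1 h2
      · intro g hg h1 h2
        exact gallai_trans hs hi u c b huc (hall b) ih
          (fun g hg h1 h2 => no_adj_missed hs hi hg hbc h2 h1) g hg h1 h2
  rcases key v (hconn u v) with h | h
  · exact h
  · exact (h f hf hu hv).elim
end

abbrev MSet (n m : ℕ) : Type := {A : Finset (Fin n) // A.card = m}

lemma exists_sigma (n m : ℕ) (hm : 1 ≤ m) (h : n = 2 * m ∨ n = 2 * m + 1) :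
    ∃ f : MSet n m → MSet n m, IsMat (fun A B => Disjoint A.1 B.1) f ∧
      ∀ u v, f u = u → f v = v → u = v := by
  have hi : ∀ a : MSet n m, ¬ Disjoint a.1 a.1 := by
    intro a ha
    rw [disjoint_self, Finset.bot_eq_empty] at ha
    have := a.2
    rw [ha] at this
    simp at this
    omega
  rcases h with h | h
  · have hc : ∀ A : MSet n m, (A.1ᶜ).card = m := by
      intro A; rw [Finset.card_compl, A.2, Fintype.card_fin]; omega
    refine ⟨fun A => ⟨A.1ᶜ, hc A⟩, ⟨fun v => by simp, fun v => Or.inr disjoint_compl_right⟩, ?_⟩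
    intro u v hu
    exfalso
    apply hi u
    have := congrArg Subtype.val hu
    simp only at this
    nth_rewrite 2 [← this]
    exact disjoint_compl_right
  · apply gallai (fun a b hab => hab.symm) hi
    · intro u v
      obtain ⟨p, hp⟩ := Equiv.Perm.exists_map_finset_eq u.1 v.1 (u.2.trans v.2.symm)
      refine ⟨⟨fun A => ⟨A.1.map p.toEmbedding, by simp [A.2]⟩,
        fun A => ⟨A.1.map p.symm.toEmbedding, by simp [A.2]⟩, ?_, ?_⟩, ?_, ?_⟩
      · intro A; ext; simp
      · intro A; ext; simp
      · exact Subtype.ext hp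
      · intro a b hab
        simpa using hab
    · intro u v
      obtain ⟨k, hk⟩ : ∃ k, (u.1 \ v.1).card = k := ⟨_, rfl⟩
      induction k generalizing u with
      | zero =>
        have h1 : u.1 ⊆ v.1 := by simpa using hk
        have : u = v := Subtype.ext (Finset.eq_of_subset_of_card_le h1 (by rw [u.2, v.2]))
        rw [this]
      | succ k ih =>
        have hk2 : (v.1 \ u.1).card = k + 1 := by
          have e1 := Finset.card_sdiff_add_card_inter u.1 v.1
          have e2 := Finset.card_sdiff_add_card_inter v.1 u.1
          rw [Finset.inter_comm] at e2
          have := u.2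
          have := v.2
          omega
        obtain ⟨a, ha⟩ := Finset.card_pos.1 (show 0 < (u.1 \ v.1).card by omega)
        obtain ⟨b, hb⟩ := Finset.card_pos.1 (show 0 < (v.1 \ u.1).card by omega)
        rw [Finset.mem_sdiff] at ha hb
        have hu := u.2
        let c : MSet n m := ⟨(insert b u.1)ᶜ, by
          rw [Finset.card_compl, Finset.card_insert_of_notMem hb.2, Fintype.card_fin]; omega⟩
        let w : MSet n m := ⟨insert b (u.1.erase a), by
          rw [Finset.card_insert_of_notMem (by simp [hb.2]), Finset.card_erase_of_mem ha.1]
          omega⟩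
        have huc : Disjoint u.1 c.1 :=
          Finset.disjoint_left.2 fun x hx hx' => by simp [c] at hx'; exact hx'.2 hx
        have hcw : Disjoint c.1 w.1 := by
          refine Finset.disjoint_left.2 fun x hx hx' => ?_
          simp [c] at hx
          simp [w] at hx'
          tauto
        refine Relation.ReflTransGen.head huc (Relation.ReflTransGen.head hcw (ih w ?_))
        have : w.1 \ v.1 = (u.1 \ v.1).erase a := by
          ext x
          simp only [w, Finset.mem_sdiff, Finset.mem_insert, Finset.mem_erase]
          grind
        rw [this, Finset.card_erase_of_mem (by simp [ha])]
        omega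

lemma exists_up_level (n k : ℕ) (h : 2 * k + 1 ≤ n) :
    ∃ f : MSet n k → Finset (Fin n), Function.Injective f ∧
      ∀ A, A.1 ⊆ f A ∧ (f A).card = k + 1 := by
  classical
  let t : MSet n k → Finset (Finset (Fin n)) := fun A => (A.1ᶜ).image fun x => insert x A.1
  have ht : ∀ A B, B ∈ t A → A.1 ⊆ B ∧ B.card = k + 1 := by
    intro A B hB
    simp only [t, Finset.mem_image, Finset.mem_compl] at hB
    obtain ⟨x, hx, rfl⟩ := hB
    exact ⟨Finset.subset_insert _ _, by rw [Finset.card_insert_of_notMem hx, A.2]⟩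
  have htc : ∀ A, (t A).card = n - k := by
    intro A
    rw [Finset.card_image_of_injOn, Finset.card_compl, A.2, Fintype.card_fin]
    intro x hx y hy hxy
    simp only [Finset.coe_compl, Set.mem_compl_iff, Finset.mem_coe] at hx hy
    have : x ∈ insert y A.1 := by
      rw [← show insert x A.1 = insert y A.1 from hxy]; simp
    rw [Finset.mem_insert] at this
    exact this.resolve_right hx
  have hall : ∀ s : Finset (MSet n k), s.card ≤ (s.biUnion t).card := by
    intro s
    have key := Finset.card_mul_le_card_mul (s := s) (t := s.biUnion t) (m := n - k) (n := k + 1)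
      (fun A B => A.1 ⊆ B) ?_ ?_
    · have h1 : s.card * (k + 1) ≤ s.card * (n - k) := Nat.mul_le_mul_left _ (by omega)
      exact Nat.le_of_mul_le_mul_right (h1.trans key) (by omega)
    · intro A hA
      rw [← htc A]
      apply Finset.card_le_card
      intro B hB
      rw [Finset.mem_bipartiteAbove]
      exact ⟨Finset.mem_biUnion.2 ⟨A, hA, hB⟩, (ht A B hB).1⟩
    · intro B hB
      obtain ⟨A, hA, hB⟩ := Finset.mem_biUnion.1 hB
      have hBc := (ht A B hB).2
      calc _ ≤ (B.powersetCard k).card := by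
            apply Finset.card_le_card_of_injOn (fun A => A.1)
            · intro C hC
              have hC := (Finset.mem_bipartiteBelow _).1 (Finset.mem_coe.1 hC)
              exact Finset.mem_coe.2 (Finset.mem_powersetCard.2 ⟨hC.2, C.2⟩)
            · exact Subtype.val_injective.injOn
        _ = k + 1 := by
            rw [Finset.card_powersetCard, hBc, Nat.choose_succ_self_right]
  obtain ⟨f, hf, hft⟩ := (Finset.all_card_le_biUnion_card_iff_exists_injective t).1 hall
  exact ⟨f, hf, fun A => ht A _ (hft A)⟩

lemma exists_phi (n m : ℕ) (h : 2 * m ≤ n) :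
    ∃ φ : Finset (Fin n) → Finset (Fin n), ∀ A, A.card ≤ m → A ⊆ φ A ∧ (φ A).card = m ∧
      ∀ B, B.card ≤ m → φ A = φ B → A ⊆ B ∨ B ⊆ A := by
  induction m with
  | zero =>
    refine ⟨id, fun A hA => ⟨subset_rfl, by simpa using hA, fun B _ h => Or.inl h.subset⟩⟩
  | succ m ih =>
    obtain ⟨φ, hφ⟩ := ih (by omega)
    obtain ⟨f, hf, hfu⟩ := exists_up_level n m (by omega)
    let ψ : Finset (Fin n) → Finset (Fin n) := fun A =>
      if h : A.card ≤ m then f ⟨φ A, (hφ A h).2.1⟩ else A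
    have hψ : ∀ A, A ⊆ ψ A := by
      intro A
      by_cases h : A.card ≤ m
      · simp only [ψ, h, dif_pos]
        exact (hφ A h).1.trans (hfu ⟨φ A, (hφ A h).2.1⟩).1
      · simp [ψ, h]
    refine ⟨ψ, fun A hA => ⟨hψ A, ?_, ?_⟩⟩
    · by_cases h : A.card ≤ m
      · simp only [ψ, h, dif_pos]
        exact (hfu _).2
      · simp only [ψ, h, dif_neg, not_false_eq_true]
        omega
    · intro B hB hAB
      by_cases h : A.card ≤ m
      · by_cases h' : B.card ≤ m
        · simp only [ψ, h, h', dif_pos] at hAB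
          exact (hφ A h).2.2 B h' (congrArg Subtype.val (hf hAB))
        · left
          have := hψ A
          rw [hAB] at this
          simpa [ψ, h'] using this
      · right
        have := hψ B
        rw [← hAB] at this
        simpa [ψ, h] using this

lemma card_orbits {V : Type} [Fintype V] [DecidableEq V] (f : V → V)
    (hinv : ∀ v, f (f v) = v) (hfix : ∀ u v, f u = u → f v = v → u = v) :
    (Finset.univ.image fun v => ({v, f v} : Finset V)).card ≤ (Fintype.card V + 1) / 2 := by
  have hF : (fixs f).card ≤ 1 := by
    rw [Finset.card_le_one]
    intro a ha b hb
    simp only [fixs, Finset.mem_filter, Finset.mem_univ, true_and] at ha hb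
    exact hfix a b ha hb
  have h1 : 2 * ((fixs f)ᶜ.image fun v => ({v, f v} : Finset V)).card ≤ ((fixs f)ᶜ).card := by
    apply Finset.mul_card_image_le_card
    intro b hb
    obtain ⟨v, hv, rfl⟩ := Finset.mem_image.1 hb
    simp only [fixs, Finset.mem_compl, Finset.mem_filter, Finset.mem_univ, true_and] at hv
    rw [Nat.succ_le_iff, Finset.one_lt_card]
    refine ⟨v, by simp [fixs, hv], f v, ?_, fun e => hv e.symm⟩
    simp only [fixs, Finset.mem_compl, Finset.mem_filter, Finset.mem_univ, true_and, hinv]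
    exact ⟨fun e => hv e.symm, Finset.pair_comm _ _⟩
  have h2 : (Finset.univ.image fun v => ({v, f v} : Finset V)).card ≤
      ((fixs f).image fun v => ({v, f v} : Finset V)).card +
      ((fixs f)ᶜ.image fun v => ({v, f v} : Finset V)).card := by
    rw [← Finset.union_compl (fixs f), Finset.image_union]
    exact Finset.card_union_le _ _
  have h3 : ((fixs f).image fun v => ({v, f v} : Finset V)).card ≤ (fixs f).card :=
    Finset.card_image_le
  have h4 := Finset.card_add_card_compl (fixs f)
  omega

lemma parts_eq {n : ℕ} (P : QIVertex n 2) : ∃ A : Finset (Fin n), P.1.parts = {A, Aᶜ} ∧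
    A.card ≤ n / 2 := by
  obtain ⟨A, B, hne, hAB⟩ := Finset.card_eq_two.1 P.2.1
  have hd : Disjoint A B := P.1.disjoint (by simp [hAB]) (by simp [hAB]) hne
  have hu : A ∪ B = Finset.univ := by
    have := P.1.sup_parts
    rw [hAB] at this
    simpa using this
  have hB : B = Aᶜ := by
    symm
    rw [compl_eq_iff_isCompl]
    exact ⟨hd, codisjoint_iff.2 hu⟩
  by_cases h : A.card ≤ n / 2
  · exact ⟨A, by rw [hAB, hB], h⟩
  · refine ⟨B, by rw [hAB, hB, compl_compl, Finset.pair_comm], ?_⟩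
    rw [hB, Finset.card_compl, Fintype.card_fin]
    omega

lemma QIPart_iff {n : ℕ} {P Q : Finpartition (Finset.univ : Finset (Fin n))}
    {A B : Finset (Fin n)} (hP : P.parts = {A, Aᶜ}) (hQ : Q.parts = {B, Bᶜ}) :
    QIPart P Q ↔ ((A ∩ B).Nonempty ∧ (A ∩ Bᶜ).Nonempty) ∧
      (Aᶜ ∩ B).Nonempty ∧ (Aᶜ ∩ Bᶜ).Nonempty := by
  simp [QIPart, hP, hQ]

lemma QIPart_symm {n : ℕ} {P Q : Finpartition (Finset.univ : Finset (Fin n))}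
    (h : QIPart P Q) : QIPart Q P := by
  intro A hA B hB
  rw [Finset.inter_comm]
  exact h B hB A hA

lemma QI_adj {n : ℕ} {P Q : QIVertex n 2} : (QIGraph n 2).Adj P Q ↔ P ≠ Q ∧ QIPart P.1 Q.1 := by
  rw [QIGraph, SimpleGraph.fromRel_adj]
  constructor
  · rintro ⟨h, h' | h'⟩
    · exact ⟨h, h'⟩
    · exact ⟨h, QIPart_symm h'⟩
  · rintro ⟨h, h'⟩
    exact ⟨h, Or.inl h'⟩

lemma exists_vertex {n : ℕ} (A : Finset (Fin n)) (h1 : 2 ≤ A.card) (h2 : 2 ≤ (Aᶜ).card) :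
    ∃ P : QIVertex n 2, P.1.parts = {A, Aᶜ} := by
  have hA : A ≠ ∅ := by rintro rfl; simp at h1
  have hA' : Aᶜ ≠ ∅ := by intro h; rw [h] at h2; simp at h2
  have hne : A ≠ Aᶜ := by
    intro h
    have : Disjoint A A := by nth_rewrite 2 [h]; exact disjoint_compl_right
    exact hA (by simpa using this)
  let P : Finpartition (Finset.univ : Finset (Fin n)) :=
    { parts := {A, Aᶜ}
      supIndep := by
        rw [Finset.supIndep_pair hne]
        exact disjoint_compl_right
      sup_parts := by simp
      bot_notMem := by
        simp only [Finset.bot_eq_empty, Finset.mem_insert, Finset.mem_singleton, not_or]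
        exact ⟨hA.symm, hA'.symm⟩ }
  refine ⟨⟨P, Finset.card_pair hne, ?_⟩, rfl⟩
  intro B hB
  simp only [P, Finset.mem_insert, Finset.mem_singleton] at hB
  rcases hB with rfl | rfl <;> assumption

lemma QI_upper (n : ℕ) (hn : 4 ≤ n) : (QIGraph n 2).Colorable ((n.choose (n / 2) + 1) / 2) := by
  classical
  obtain ⟨f, hf, hfix⟩ := exists_sigma n (n / 2) (by omega) (by omega)
  obtain ⟨φ, hφ⟩ := exists_phi n (n / 2) (by omega)
  choose R hR hRc using parts_eq (n := n)
  let M : QIVertex n 2 → MSet n (n / 2) := fun P => ⟨φ (R P), (hφ _ (hRc P)).2.1⟩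
  let T := (Finset.univ.image fun v : MSet n (n / 2) => ({v, f v} : Finset _))
  let c : QIVertex n 2 → T := fun P => ⟨{M P, f (M P)}, Finset.mem_image.2 ⟨M P, by simp, rfl⟩⟩
  have hc : ∀ {P Q}, (QIGraph n 2).Adj P Q → c P ≠ c Q := by
    intro P Q hPQ he
    rw [QI_adj] at hPQ
    have hq := hPQ.2
    rw [QIPart_iff (hR P) (hR Q)] at hq
    have he' : ({M P, f (M P)} : Finset _) = {M Q, f (M Q)} := congrArg Subtype.val he
    have hmem : M P ∈ ({M Q, f (M Q)} : Finset _) := by rw [← he']; simp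
    have hsame : M P = M Q → False := by
      intro h
      rcases (hφ _ (hRc P)).2.2 _ (hRc Q) (congrArg Subtype.val h) with h | h
      · obtain ⟨x, hx⟩ := hq.1.2
        simp only [Finset.mem_inter, Finset.mem_compl] at hx
        exact hx.2 (h hx.1)
      · obtain ⟨x, hx⟩ := hq.2.1
        simp only [Finset.mem_inter, Finset.mem_compl] at hx
        exact hx.1 (h hx.2)
    rw [Finset.mem_insert, Finset.mem_singleton] at hmem
    rcases hmem with h | h
    · exact hsame h
    · rcases hf.adj (M Q) with h' | h'
      · exact hsame (h.trans h')
      · rw [← h] at h'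
        obtain ⟨x, hx⟩ := hq.1.1
        rw [Finset.mem_inter] at hx
        exact Finset.disjoint_left.1 h' ((hφ _ (hRc Q)).1 hx.2) ((hφ _ (hRc P)).1 hx.1)
  have hcol := (SimpleGraph.Coloring.mk c hc).colorable
  refine hcol.mono ?_
  rw [Fintype.card_coe]
  have := card_orbits f hf.inv hfix
  rwa [show Fintype.card (MSet n (n / 2)) = n.choose (n / 2) by
    rw [Fintype.card_finset_len, Fintype.card_fin]] at this

lemma QI_lower (n : ℕ) (hn : 4 ≤ n) (k : ℕ) (h : (QIGraph n 2).Colorable k) :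
    (n.choose (n / 2) + 1) / 2 ≤ k := by
  classical
  obtain ⟨c⟩ := h
  have hcc : ∀ A : MSet n (n / 2), (A.1ᶜ).card = n - n / 2 := by
    intro A; rw [Finset.card_compl, A.2, Fintype.card_fin]
  have hv : ∀ A : MSet n (n / 2), ∃ P : QIVertex n 2, P.1.parts = {A.1, A.1ᶜ} := by
    intro A
    exact exists_vertex A.1 (by rw [A.2]; omega) (by rw [hcc]; omega)
  choose v hv using hv
  have hdis : ∀ A B : MSet n (n / 2), A ≠ B → c (v A) = c (v B) → Disjoint A.1 B.1 := by
    intro A B hAB hc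
    have hsub : ∀ A B : MSet n (n / 2), A.1 ⊆ B.1 → A = B := fun A B h =>
      Subtype.ext (Finset.eq_of_subset_of_card_le h (by rw [A.2, B.2]))
    by_cases hvv : v A = v B
    · have : A.1 ∈ ({B.1, B.1ᶜ} : Finset _) := by rw [← hv B, ← hvv, hv A]; simp
      rw [Finset.mem_insert, Finset.mem_singleton] at this
      rcases this with h | h
      · exact absurd (Subtype.ext h) hAB
      · rw [h]; exact disjoint_compl_left
    · have hna : ¬ QIPart (v A).1 (v B).1 := fun hq => c.valid (QI_adj.2 ⟨hvv, hq⟩) hc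
      rw [QIPart_iff (hv A) (hv B)] at hna
      by_contra hnd
      apply hna
      refine ⟨⟨Finset.not_disjoint_iff_nonempty_inter.1 hnd, ?_⟩, ?_, ?_⟩
      · rw [← Finset.not_disjoint_iff_nonempty_inter]
        intro hd
        exact hAB (hsub A B (disjoint_compl_right_iff.1 hd))
      · rw [← Finset.not_disjoint_iff_nonempty_inter]
        intro hd
        exact hAB (hsub B A (disjoint_compl_left_iff.1 hd)).symm
      · rw [← Finset.compl_union, Finset.nonempty_iff_ne_empty]
        intro he
        rw [Finset.compl_eq_empty_iff] at he
        have h1 := Finset.card_union_add_card_inter A.1 B.1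
        rw [he, Finset.card_univ, Fintype.card_fin, A.2, B.2] at h1
        have h2 : (A.1 ∩ B.1).card = 0 := by omega
        exact hnd (Finset.disjoint_iff_inter_eq_empty.2 (Finset.card_eq_zero.1 h2))
  have h1 : (Finset.univ : Finset (MSet n (n / 2))).card ≤ 2 * (Finset.univ : Finset (Fin k)).card := by
    apply Finset.card_le_mul_card_image_of_maps_to (f := fun A => c (v A))
    · simp
    · intro b _
      by_contra hlt
      rw [not_le, Finset.two_lt_card] at hlt
      obtain ⟨A, hA, B, hB, C, hC, hAB, hAC, hBC⟩ := hlt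
      simp only [Finset.mem_filter, Finset.mem_univ, true_and] at hA hB hC
      have d1 := hdis A B hAB (hA.trans hB.symm)
      have d2 := hdis A C hAC (hA.trans hC.symm)
      have d3 := hdis B C hBC (hB.trans hC.symm)
      have e : ((A.1 ∪ B.1) ∪ C.1).card ≤ n := by
        simpa using Finset.card_le_univ ((A.1 ∪ B.1) ∪ C.1)
      rw [Finset.card_union_of_disjoint (Finset.disjoint_union_left.2 ⟨d2, d3⟩),
        Finset.card_union_of_disjoint d1, A.2, B.2, C.2] at e
      omega
  rw [Finset.card_univ, Fintype.card_finset_len, Finset.card_univ, Fintype.card_fin,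
    Fintype.card_fin] at h1
  omega

/-- For `n ≥ 4`, the chromatic number of `QI(n,2)` equals `⌈(1/2)·C(n, ⌊n/2⌋)⌉`. -/
theorem chromaticNumber_QIGraph_two (n : ℕ) (hn : 4 ≤ n) :
    (QIGraph n 2).chromaticNumber = ((n.choose (n / 2) + 1) / 2 : ℕ) := by
  apply le_antisymm
  · exact (QI_upper n hn).chromaticNumber_le
  · rw [SimpleGraph.le_chromaticNumber_iff_colorable]
    exact fun k hk => QI_lower n hn k hk
end

section
/- For all positive integers k ≥ 2 and any two distinct elements a, b of {1,…,k²}, the set S_{a,b} of uniform k-partitions of {1,…,k²} having a and b in the same class is an independent set in QI(k²,k), and the maximum independent set in QI(k²,k) has size exactly C(k²−2, k−2)·U(k²−k, k−1), attained by S_{a,b}. -/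
/-- Vertices of `QI(k²,k)`: uniform `k`-partitions of a `k²`-set (all classes of
size exactly `k`). -/
def UQIVertex (k : ℕ) : Type :=
  {P : Finpartition (Finset.univ : Finset (Fin (k ^ 2))) //
    ∀ A ∈ P.parts, A.card = k}

/-- The graph `QI(k²,k)`: uniform `k`-partitions adjacent iff qualitatively
independent. -/
def UQIGraph (k : ℕ) : SimpleGraph (UQIVertex k) :=
  SimpleGraph.fromRel fun P Q =>
    ∀ A ∈ P.1.parts, ∀ B ∈ Q.1.parts, (A ∩ B).Nonempty

/-- `U(m,c)`: the number of uniform partitions of an `m`-set into classes of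
size `c`. -/
noncomputable def uniformCount (m c : ℕ) : ℕ :=
  Nat.card {P : Finpartition (Finset.univ : Finset (Fin m)) //
    ∀ A ∈ P.parts, A.card = c}

/-- `S_{a,b}`: the uniform `k`-partitions of the `k²`-set having `a` and `b` in
the same class. -/
def Sab (k : ℕ) (a b : Fin (k ^ 2)) : Set (UQIVertex k) :=
  {P | ∃ A ∈ P.1.parts, a ∈ A ∧ b ∈ A}



open Polynomial in
noncomputable def evP (k N j : ℕ) : Polynomial ℝ :=
  ∑ s ∈ Finset.range (j+1),
    C (((j.choose s : ℝ) * ((k - j + s).descFactorial s : ℝ) / (N.descFactorial s : ℝ))) * X ^ s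

theorem evP_coeff (k N j s : ℕ) : (evP k N j).coeff s =
    (j.choose s : ℝ) * ((k - j + s).descFactorial s : ℝ) / (N.descFactorial s : ℝ) := by
  unfold evP
  rw [Polynomial.finsetSum_coeff]
  simp only [Polynomial.coeff_C_mul_X_pow]
  rw [Finset.sum_ite_eq]
  split_ifs with h
  · rfl
  · rw [Nat.choose_eq_zero_of_lt (by simpa using h)]; simp

theorem choose_real_succ (J s : ℕ) : ((J.choose (s+1) : ℕ) : ℝ) * (s+1) = J.choose s * ((J:ℝ) - s) := by
  rcases le_or_gt s J with h | h
  · have := Nat.choose_succ_right_eq J s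
    have h2 : ((J - s : ℕ) : ℝ) = (J:ℝ) - s := by push_cast [h]; ring
    rw [← h2]; exact_mod_cast this
  · rw [Nat.choose_eq_zero_of_lt h, Nat.choose_eq_zero_of_lt (by omega)]; simp

theorem choose_real_succ_succ (J s : ℕ) : (((J+1).choose (s+1) : ℕ) : ℝ) * (s+1) = ((J:ℝ)+1) * J.choose s := by
  have := Nat.add_one_mul_choose_eq J s
  exact_mod_cast this.symm

theorem desc_real_succ (N s : ℕ) : ((N.descFactorial (s+1) : ℕ) : ℝ) = ((N:ℝ) - s) * N.descFactorial s := by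
  rw [Nat.descFactorial_succ]
  rcases le_or_gt s N with h | h
  · push_cast [h]; ring
  · rw [Nat.descFactorial_eq_zero_iff_lt.2 h]; simp

theorem desc_real_top (a s : ℕ) : (((a+1).descFactorial (s+1) : ℕ) : ℝ) = ((a:ℝ)+1) * a.descFactorial s := by
  rw [Nat.succ_descFactorial_succ]; push_cast; ring

open Polynomial in
theorem evP_rec (t N J : ℕ) (hN : J + 2 + t ≤ N) (k j n : ℝ) (hk : k = J + 2 + t)
    (hj : j = J + 1) (hn : n = N + k) :
    C (2*(n+1-j)*(n+2-2*j)*(N-j)) * evP (J+2+t) N (J+2) =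
    C (n+1-2*j) * (C ((n-2*j)*(n+2-2*j)) * (1 + X) + C ((N-k)*(n+2)) * (1 - X)) * evP (J+2+t) N (J+1)
    + C (2*j*(k+1-j)*(n-2*j)) * (1 - X)^2 * evP (J+2+t) N J := by
  have e1 : C (n+1-2*j) * (C ((n-2*j)*(n+2-2*j)) * (1 + X) + C ((N-k)*(n+2)) * (1 - X)) * evP (J+2+t) N (J+1)
    + C (2*j*(k+1-j)*(n-2*j)) * (1 - X)^2 * evP (J+2+t) N J = 
    C ((n+1-2*j)*((n-2*j)*(n+2-2*j)+(N-k)*(n+2))) * evP (J+2+t) N (J+1)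
    + C ((n+1-2*j)*((n-2*j)*(n+2-2*j)-(N-k)*(n+2))) * (X * evP (J+2+t) N (J+1))
    + C (2*j*(k+1-j)*(n-2*j)) * evP (J+2+t) N J
    - C (2*(2*j*(k+1-j)*(n-2*j))) * (X * evP (J+2+t) N J)
    + C (2*j*(k+1-j)*(n-2*j)) * (X * (X * evP (J+2+t) N J)) := by
    have hC2 : (C (2:ℝ) : Polynomial ℝ) = 2 := rfl
    simp only [C_mul, C_add, C_sub, C_1, hC2]
    ring
  rw [e1]
  ext s
  simp only [coeff_add, coeff_sub, coeff_C_mul]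
  have k0 : J + 2 + t - J = t + 2 := by omega
  have k1 : J + 2 + t - (J+1) = t + 1 := by omega
  have k2 : J + 2 + t - (J+2) = t := by omega
  have hNr : (J:ℝ) + 2 + t ≤ N := by exact_mod_cast hN
  have hJ0 : (0:ℝ) ≤ J := by positivity
  have ht0 : (0:ℝ) ≤ t := by positivity
  rcases s with _ | _ | s
  · simp only [mul_coeff_zero, coeff_X_zero, zero_mul, evP_coeff, k0, k1, k2]
    simp
    subst hn hk hj
    ring
  · simp only [coeff_X_mul, mul_coeff_zero, coeff_X_zero, zero_mul, evP_coeff, k0, k1, k2, zero_add]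
    simp
    have : (N:ℝ) ≠ 0 := by linarith
    field_simp
    subst hn hk hj
    ring
  · simp only [coeff_X_mul, evP_coeff, k0, k1, k2]
    rcases lt_or_ge J s with h | h
    · rw [Nat.choose_eq_zero_of_lt h, Nat.choose_eq_zero_of_lt (show J+1 < s+1+1 by omega),
        Nat.choose_eq_zero_of_lt (show J+1 < s+1 by omega), Nat.choose_eq_zero_of_lt (show J < s+1 by omega),
        Nat.choose_eq_zero_of_lt (show J < s+1+1 by omega), Nat.choose_eq_zero_of_lt (show J+2 < s+1+1 by omega)]
      simp
    · have hs0 : (0:ℝ) ≤ s := by positivity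
      have hsJ : (s:ℝ) ≤ J := by exact_mod_cast h
      have c1 : ((J.choose (s+1) : ℕ) : ℝ) = J.choose s * ((J:ℝ) - s) / (s+1) := by
        rw [← choose_real_succ]; field_simp
      have c2 : ((J.choose (s+1+1) : ℕ) : ℝ) = J.choose s * ((J:ℝ) - s) / (s+1) * ((J:ℝ) - s - 1)/(s+2) := by
        have := choose_real_succ J (s+1)
        rw [c1] at this
        push_cast at this
        field_simp at this ⊢
        linear_combination this
      have c3 : (((J+1).choose (s+1) : ℕ) : ℝ) = ((J:ℝ)+1) * J.choose s / (s+1) := by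
        rw [← choose_real_succ_succ]; field_simp
      have c4 : (((J+1).choose (s+1+1) : ℕ) : ℝ) = ((J:ℝ)+1) * J.choose s / (s+1) * ((J:ℝ)-s) / (s+2) := by
        have := choose_real_succ (J+1) (s+1)
        rw [c3] at this
        push_cast at this
        field_simp at this ⊢
        linear_combination this
      have c5 : (((J+2).choose (s+1+1) : ℕ) : ℝ) = ((J:ℝ)+1) * J.choose s / (s+1) * ((J:ℝ)+2) / (s+2) := by
        have := choose_real_succ_succ (J+1) (s+1)
        rw [c3] at this
        push_cast at this
        field_simp at this ⊢
        linear_combination this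
      have d1 : (((t + 2 + (s+1)).descFactorial (s+1) : ℕ) : ℝ) = ((t:ℝ)+2+s+1) * (t+2+s).descFactorial s := by
        have := desc_real_top (t+2+s) s
        push_cast at this; exact this
      have d2 : (((t + 2 + (s+1+1)).descFactorial (s+1+1) : ℕ) : ℝ) = ((t:ℝ)+2+s+2) * (((t:ℝ)+2+s+1) * (t+2+s).descFactorial s) := by
        have := desc_real_top (t+2+(s+1)) (s+1)
        rw [d1] at this
        push_cast at this; rw [← add_assoc (t+2), this]; ring
      have d3 : (((t + 1 + (s+1)).descFactorial (s+1) : ℕ) : ℝ) = ((t:ℝ)+2) * (t+2+s).descFactorial s := by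
        have := desc_real_succ (t+2+s) s
        rw [show t + 1 + (s+1) = t+2+s by ring, this]; push_cast; ring
      have d4 : (((t + 1 + (s+1+1)).descFactorial (s+1+1) : ℕ) : ℝ) = ((t:ℝ)+2+s+1) * (((t:ℝ)+2) * (t+2+s).descFactorial s) := by
        have := desc_real_top (t+1+(s+1)) (s+1)
        rw [d3] at this
        rw [← add_assoc (t+1), this]; push_cast; ring
      have d5 : (((t + (s+1+1)).descFactorial (s+1+1) : ℕ) : ℝ) = ((t:ℝ)+1)*(((t:ℝ)+2) * (t+2+s).descFactorial s) := by
        rw [show t + (s+1+1) = t+2+s by ring, desc_real_succ, desc_real_succ]; push_cast; ring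
      rw [c1, c2, c3, c4, c5, d1, d2, d3, d4, d5, desc_real_succ N (s+1), desc_real_succ N s]
      push_cast
      have n1 : (N:ℝ) - s ≠ 0 := by linarith
      have n2 : (N:ℝ) - (s + 1) ≠ 0 := by linarith
      have n3 : ((N.descFactorial s : ℕ) : ℝ) ≠ 0 := by
        have : N.descFactorial s ≠ 0 := by
          rw [Ne, Nat.descFactorial_eq_zero_iff_lt]; omega
        exact_mod_cast this
      have s1 : (s:ℝ) + 1 ≠ 0 := by positivity
      have s2 : (s:ℝ) + 2 ≠ 0 := by positivity
      generalize ((J.choose s : ℕ):ℝ) = A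
      generalize (((t+2+s).descFactorial s : ℕ):ℝ) = B
      generalize ((N.descFactorial s : ℕ):ℝ) = D at *
      field_simp
      subst hn hk hj
      ring


/-- eigenvalue -/
noncomputable def Qe (k m j : ℕ) : ℝ := (evP k (m*k) j).eval (-(m:ℝ)) / ((m:ℝ)+1)^j

theorem Qe_zero (k m : ℕ) : Qe k m 0 = 1 := by
  simp [Qe, evP]

theorem Qe_one (k m : ℕ) (hk : 1 ≤ k) (hm : 1 ≤ m) : Qe k m 1 = 0 := by
  have h1 : (k:ℝ) ≠ 0 := by positivity
  have h2 : (m:ℝ) ≠ 0 := by positivity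
  have h3 : k - 1 + 1 = k := by omega
  simp [Qe, evP, Finset.sum_range_succ, h3]
  left
  field_simp
  ring

theorem Qe_rec (k m J : ℕ) (hm : 1 ≤ m) (hJ : J + 2 ≤ k) (M N n j : ℝ) (hM : M = m + 1) (hN : N = m * k)
    (hn : n = M * k) (hj : j = J + 1) :
    M * (n+1-j)*(n+2-2*j)*(N-j) * Qe k m (J+2) =
      2*j*(n+1-2*j)*(n+1-j)*(m-1) * Qe k m (J+1) + M*j*(k+1-j)*(n-2*j) * Qe k m J := by
  obtain ⟨t, rfl⟩ := Nat.exists_eq_add_of_le hJ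
  have hN' : J + 2 + t ≤ m * (J+2+t) := Nat.le_mul_of_pos_left _ hm
  have h := evP_rec t (m * (J+2+t)) J hN' ((J+2+t : ℕ) : ℝ) j n (by push_cast; ring) hj (by
    rw [hn, hM]; push_cast; ring)
  have h2 := congrArg (Polynomial.eval (-(m:ℝ))) h
  simp only [Polynomial.eval_mul, Polynomial.eval_add, Polynomial.eval_sub, Polynomial.eval_C,
    Polynomial.eval_pow, Polynomial.eval_X, Polynomial.eval_one] at h2
  have hM0 : M ≠ 0 := by rw [hM]; positivity
  unfold Qe
  rw [← hM, pow_add, pow_add]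
  have hp : M ^ J ≠ 0 := pow_ne_zero _ hM0
  generalize Polynomial.eval (-(m:ℝ)) (evP (J+2+t) (m * (J+2+t)) J) = a at *
  generalize Polynomial.eval (-(m:ℝ)) (evP (J+2+t) (m * (J+2+t)) (J+1)) = b at *
  generalize Polynomial.eval (-(m:ℝ)) (evP (J+2+t) (m * (J+2+t)) (J+2)) = c at *
  field_simp
  have e1 : ((m * (J+2+t) : ℕ) : ℝ) = N := by rw [hN]; push_cast; ring
  rw [e1] at h2
  have e2 : (1 - -(m:ℝ)) = M := by rw [hM]; ring
  rw [e2] at h2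
  have e3 : (n + 1 - 2 * j) * ((n - 2 * j) * (n + 2 - 2 * j) * (1 + -(m:ℝ)) + (N - ((J + 2 + t : ℕ):ℝ)) * (n + 2) * M)
    = (n+1-2*j) * (4 * j * (n+1-j) * (m-1)) := by
    rw [hN, hn, hM]; push_cast; ring
  rw [e3] at h2
  linear_combination (1/2) * h2

theorem Qe_two (k m : ℕ) (hk : 2 ≤ k) (hm : 1 ≤ m) (M N n : ℝ) (hM : M = m + 1) (hN : N = m * k)
    (hn : n = M * k) : n * n * (N-1) * Qe k m 2 = k * (n - 2) := by
  have h := Qe_rec k m 0 hm hk M N n 1 hM hN hn (by simp)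
  rw [Qe_zero, zero_add, Qe_one k m (by omega) hm] at h
  have hM0 : M ≠ 0 := by rw [hM]; positivity
  have : M * (n * n * (N-1) * Qe k m 2) = M * (k * (n-2)) := by linear_combination h
  exact mul_left_cancel₀ hM0 this

theorem Qe_nonneg (k m : ℕ) (hk : 2 ≤ k) (hm : 1 ≤ m) : ∀ J, J + 1 ≤ k → 0 ≤ Qe k m J ∧ 0 ≤ Qe k m (J+1) := by
  intro J
  induction J with
  | zero => intro _; rw [Qe_zero, zero_add, Qe_one k m (by omega) hm]; simp
  | succ J ih =>
    intro hJ
    obtain ⟨h0, h1⟩ := ih (by omega)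
    refine ⟨h1, ?_⟩
    have h := Qe_rec k m J hm hJ _ _ _ _ rfl rfl rfl rfl
    obtain ⟨u, rfl⟩ := Nat.exists_eq_add_of_le hJ
    obtain ⟨v, rfl⟩ := Nat.exists_eq_add_of_le hm
    push_cast at h
    generalize Qe (J + 1 + 1 + u) (1+v) J = a at *
    generalize Qe (J + 1 + 1 + u) (1+v) (J+1) = b at *
    by_contra hneg
    push Not at hneg
    have p1 : (0:ℝ) < ((1 + (v:ℝ)) + 1) * (((1 + (v:ℝ)) + 1) * (J + 1 + 1 + u) + 1 - (J+1))*(((1 + (v:ℝ)) + 1) * (J + 1 + 1 + u)+2-2*(J+1))*((1+(v:ℝ)) * (J + 1 + 1 + u)-(J+1)) := by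
      have q1 : (0:ℝ) < (((1 + (v:ℝ)) + 1) * (J + 1 + 1 + u) + 1 - (J+1)) := by ring_nf; positivity
      have q2 : (0:ℝ) < (((1 + (v:ℝ)) + 1) * (J + 1 + 1 + u)+2-2*(J+1)) := by ring_nf; positivity
      have q3 : (0:ℝ) < ((1+(v:ℝ)) * (J + 1 + 1 + u)-(J+1)) := by ring_nf; positivity
      positivity
    have p2 : (0:ℝ) ≤ 2*((J:ℝ)+1)*(((1 + (v:ℝ)) + 1) * (J + 1 + 1 + u)+1-2*(J+1))*(((1 + (v:ℝ)) + 1) * (J + 1 + 1 + u)+1-(J+1))*((1+(v:ℝ))-1) := by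
      have q1 : (0:ℝ) ≤ (((1 + (v:ℝ)) + 1) * (J + 1 + 1 + u)+1-2*(J+1)) := by ring_nf; positivity
      have q2 : (0:ℝ) ≤ (((1 + (v:ℝ)) + 1) * (J + 1 + 1 + u)+1-(J+1)) := by ring_nf; positivity
      have q3 : (0:ℝ) ≤ ((1+(v:ℝ))-1) := by ring_nf; positivity
      positivity
    have p3 : (0:ℝ) ≤ ((1 + (v:ℝ)) + 1)*(J+1)*(((J:ℝ) + 1 + 1 + u)+1-(J+1))*(((1 + (v:ℝ)) + 1) * (J + 1 + 1 + u)-2*(J+1)) := by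
      have q1 : (0:ℝ) ≤ (((J:ℝ) + 1 + 1 + u)+1-(J+1)) := by ring_nf; positivity
      have q2 : (0:ℝ) ≤ (((1 + (v:ℝ)) + 1) * (J + 1 + 1 + u)-2*(J+1)) := by ring_nf; positivity
      positivity
    have r1 := mul_neg_of_pos_of_neg p1 hneg
    have r2 := mul_nonneg p2 h1
    have r3 := mul_nonneg p3 h0
    linarith

noncomputable def epsE (k m : ℕ) : ℝ := (k-1) / ((m+1)*k*m*(m*k-1))

theorem Qe_step (k m J : ℕ) (hk : 2 ≤ k) (hm : 1 ≤ m) (hJ : J + 2 ≤ k) (e : ℝ)  (he : 0 ≤ e)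
   (h0 : Qe k m J ≤ e) (h1 : Qe k m (J+1) ≤ e) : Qe k m (J+2) ≤ e := by
    have h := Qe_rec k m J hm hJ _ _ _ _ rfl rfl rfl rfl
    obtain ⟨u, rfl⟩ := Nat.exists_eq_add_of_le hJ
    obtain ⟨v, rfl⟩ := Nat.exists_eq_add_of_le hm
    push_cast at h
    generalize Qe (J + 2 + u) (1+v) J = a at *
    generalize Qe (J + 2 + u) (1+v) (J+1) = b at *
    have p1 : (0:ℝ) < ((1 + (v:ℝ)) + 1) * (((1 + (v:ℝ)) + 1) * (J + 2 + u) + 1 - (J+1))*(((1 + (v:ℝ)) + 1) * (J + 2 + u)+2-2*(J+1))*((1+(v:ℝ)) * (J + 2 + u)-(J+1)) := by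
      have q1 : (0:ℝ) < (((1 + (v:ℝ)) + 1) * (J + 2 + u) + 1 - (J+1)) := by ring_nf; positivity
      have q2 : (0:ℝ) < (((1 + (v:ℝ)) + 1) * (J + 2 + u)+2-2*(J+1)) := by ring_nf; positivity
      have q3 : (0:ℝ) < ((1+(v:ℝ)) * (J + 2 + u)-(J+1)) := by ring_nf; positivity
      positivity
    have p2 : (0:ℝ) ≤ 2*((J:ℝ)+1)*(((1 + (v:ℝ)) + 1) * (J + 2 + u)+1-2*(J+1))*(((1 + (v:ℝ)) + 1) * (J + 2 + u)+1-(J+1))*((1+(v:ℝ))-1) := by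
      have q1 : (0:ℝ) ≤ (((1 + (v:ℝ)) + 1) * (J + 2 + u)+1-2*(J+1)) := by ring_nf; positivity
      have q2 : (0:ℝ) ≤ (((1 + (v:ℝ)) + 1) * (J + 2 + u)+1-(J+1)) := by ring_nf; positivity
      have q3 : (0:ℝ) ≤ ((1+(v:ℝ))-1) := by ring_nf; positivity
      positivity
    have p3 : (0:ℝ) ≤ ((1 + (v:ℝ)) + 1)*(J+1)*(((J:ℝ) + 2 + u)+1-(J+1))*(((1 + (v:ℝ)) + 1) * (J + 2 + u)-2*(J+1)) := by
      have q1 : (0:ℝ) ≤ (((J:ℝ) + 2 + u)+1-(J+1)) := by ring_nf; positivity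
      have q2 : (0:ℝ) ≤ (((1 + (v:ℝ)) + 1) * (J + 2 + u)-2*(J+1)) := by ring_nf; positivity
      positivity
    have p4 : (0:ℝ) ≤ ((1 + (v:ℝ)) + 1) * (((1 + (v:ℝ)) + 1) * (J + 2 + u) + 1 - (J+1))*(((1 + (v:ℝ)) + 1) * (J + 2 + u)+2-2*(J+1))*((1+(v:ℝ)) * (J + 2 + u)-(J+1))
      - (2*((J:ℝ)+1)*(((1 + (v:ℝ)) + 1) * (J + 2 + u)+1-2*(J+1))*(((1 + (v:ℝ)) + 1) * (J + 2 + u)+1-(J+1))*((1+(v:ℝ))-1)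
       + ((1 + (v:ℝ)) + 1)*(J+1)*(((J:ℝ) + 2 + u)+1-(J+1))*(((1 + (v:ℝ)) + 1) * (J + 2 + u)-2*(J+1))) := by
      ring_nf; positivity
    have r1 := mul_le_mul_of_nonneg_left h1 p2
    have r2 := mul_le_mul_of_nonneg_left h0 p3
    have r3 := mul_nonneg p4 he
    refine le_of_mul_le_mul_left ?_ p1
    linarith

theorem Qe_three_le (k m : ℕ) (hk : 3 ≤ k) (hm : 1 ≤ m) (hmk : m + 1 ≤ k) : Qe k m 3 ≤ epsE k m := by
  have h2 := Qe_two k m (by omega) hm _ _ _ rfl rfl rfl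
  have h3 := Qe_rec k m 1 hm (by omega) _ _ _ _ rfl rfl rfl rfl
  rw [Qe_one k m (by omega) hm] at h3
  norm_num at h3
  rcases Nat.lt_or_ge m 2 with h | h
  · have : m = 1 := by omega
    subst this
    have hk' : (3:ℝ) ≤ k := by exact_mod_cast hk
    norm_num at h3
    have hz : Qe k 1 3 = 0 := by
      rcases h3 with h | h
      · rcases h with h | h
        · rcases h with h | h <;> linarith
        · linarith
      · exact h
    rw [hz]; unfold epsE
    have : (0:ℝ) ≤ (k:ℝ) - 1 := by linarith
    push_cast; rw [one_mul]; positivity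
  · obtain ⟨a, rfl⟩ := Nat.exists_eq_add_of_le h
    obtain ⟨w, hw⟩ : ∃ w, k = 3 + a + w := ⟨k - 3 - a, by omega⟩
    subst hw
    unfold epsE
    push_cast at h2 h3 ⊢
    generalize Qe (3 + a + w) (2+a) 2 = q2 at *
    generalize Qe (3 + a + w) (2+a) 3 = q3 at *
    have A0 : (0:ℝ) ≤ a := by positivity
    have W0 : (0:ℝ) ≤ w := by positivity
    generalize (a:ℝ) = a at *
    generalize (w:ℝ) = w at *
    set k : ℝ := 3 + a + w with hkd
    set n : ℝ := (2 + a + 1) * k with hnd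
    set N : ℝ := (2 + a) * k with hNd
    have n1 : 0 < N - 1 := by rw [hNd, hkd]; ring_nf; positivity
    have n2 : 0 < N - 2 := by rw [hNd, hkd]; ring_nf; positivity
    have n3 : 0 < n - 2 := by rw [hnd, hkd]; ring_nf; positivity
    have n4 : 0 < n - 1 := by rw [hnd, hkd]; ring_nf; positivity
    have n5 : 0 < n := by rw [hnd, hkd]; positivity
    have k1 : 0 < k := by rw [hkd]; positivity
    have e2 : q2 = k * (n-2) / (n*n*(N-1)) := by
      field_simp; linear_combination h2
    have e3 : q3 = 4*(n-3)*(1+a)/((2+a+1)*(n-2)*(N-2)) * q2 := by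
      field_simp
      apply mul_left_cancel₀ n4.ne'
      linear_combination h3
    rw [e3, e2, le_div_iff₀ (by positivity)]
    have e4 : 4 * (n - 3) * (1 + a) / ((2 + a + 1) * (n - 2) * (N - 2)) * (k * (n - 2) / (n * n * (N - 1))) *
      ((2 + a + 1) * k * (2 + a) * (N - 1)) = 4 * (n-3)*(1+a)*(2+a)/((2+a+1)^2*(N-2)) := by
      rw [hnd]; rw [hnd] at n3; field_simp
    rw [e4, div_le_iff₀ (by positivity)]
    rw [← sub_nonneg, hNd, hnd, hkd]
    ring_nf
    positivity

set_option maxHeartbeats 2000000 in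
theorem Qe_four_le (k m : ℕ) (hk : 4 ≤ k) (hm : 1 ≤ m) (hmk : m + 1 ≤ k) : Qe k m 4 ≤ epsE k m := by
  have h2 := Qe_two k m (by omega) hm _ _ _ rfl rfl rfl
  have h3 := Qe_rec k m 1 hm (by omega) _ _ _ _ rfl rfl rfl rfl
  have h4 := Qe_rec k m 2 hm (by omega) _ _ _ _ rfl rfl rfl rfl
  rw [Qe_one k m (by omega) hm] at h3
  norm_num at h3 h4
  unfold epsE
  generalize Qe k m 2 = q2 at *
  generalize Qe k m 3 = q3 at *
  generalize Qe k m 4 = q4 at *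
  have A0 : (1:ℝ) ≤ m := by exact_mod_cast hm
  have W0 : (4:ℝ) ≤ k := by exact_mod_cast hk
  have hc : ((k:ℝ)-1)*(m+1)^3*((m+1)*k-4)*(m*k-3)*(m*k-2) - m*(24*((m+1)*k-5)*(m-1)*((m+1)*k-3)*(m-1)+3*(m+1)^2*(k-2)*((m+1)*k-6)*(m*k-2)) ≥ 0 := by
    rcases Nat.lt_or_ge m 3 with h | h
    · obtain ⟨w, rfl⟩ := Nat.exists_eq_add_of_le hk
      interval_cases m
      · push_cast; ring_nf; positivity
      · push_cast; ring_nf; positivity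
    · obtain ⟨a, rfl⟩ := Nat.exists_eq_add_of_le h
      obtain ⟨w, hw⟩ : ∃ w, k = 4 + a + w := ⟨k - 4 - a, by omega⟩
      subst hw
      push_cast; ring_nf; positivity
  clear hmk hk hm
  generalize (m:ℝ) = m at *
  generalize (k:ℝ) = k at *
  set n : ℝ := (m+1) * k with hnd
  set N : ℝ := m * k with hNd
  have N4 : 4 ≤ N := by nlinarith
  have n8 : 8 ≤ n := by nlinarith
  have n1 : 0 < N - 1 := by linarith
  have n2 : 0 < N - 2 := by linarith
  have n3 : 0 < n - 2 := by linarith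
  have n4 : 0 < n - 1 := by linarith
  have n5 : 0 < n := by linarith
  have n6 : 0 < N - 3 := by linarith
  have n7 : 0 < n - 4 := by linarith
  have k1 : 0 < k := by linarith
  have m1 : 0 < m := by linarith
  have m2 : 0 < m + 1 := by linarith
  have e2 : q2 = k * (n-2) / (n*n*(N-1)) := by
    field_simp; linear_combination h2
  have e3 : q3 = 4*(n-3)*(m-1)/((m+1)*(n-2)*(N-2)) * q2 := by
    field_simp
    apply mul_left_cancel₀ n4.ne'
    linear_combination h3
  have e4 : q4 = (6*(n-5)*(n-2)*(m-1)*q3 + 3*(m+1)*(k-2)*(n-6)*q2) / ((m+1)*(n-2)*(n-4)*(N-3)) := by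
    field_simp
    linear_combination h4
  have e5 : q4 = (24*(n-5)*(m-1)*(n-3)*(m-1)+3*(m+1)^2*(k-2)*(n-6)*(N-2)) / ((m+1)^2*(n-2)*(n-4)*(N-3)*(N-2)) * q2 := by
    rw [e4, e3]; field_simp; ring
  rw [e5, e2, le_div_iff₀ (by positivity)]
  have e6 : (24*(n-5)*(m-1)*(n-3)*(m-1)+3*(m+1)^2*(k-2)*(n-6)*(N-2)) / ((m+1)^2*(n-2)*(n-4)*(N-3)*(N-2)) * (k * (n - 2) / (n * n * (N - 1))) *
      ((m + 1) * k * m * (N - 1)) = m*(24*(n-5)*(m-1)*(n-3)*(m-1)+3*(m+1)^2*(k-2)*(n-6)*(N-2)) / ((m+1)^3*(n-4)*(N-3)*(N-2)) := by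
    rw [show (m+1)*k*m*(N-1) = n * m * (N-1) by rw [hnd]]
    rw [show k * (n-2) / (n*n*(N-1)) = (n-2)/((m+1)*n*(N-1)) by rw [div_eq_div_iff (by positivity) (by positivity), hnd]; ring]
    field_simp
  rw [e6, div_le_iff₀ (by positivity)]
  linarith [hc]

theorem Qe_le (k m : ℕ) (hk : 2 ≤ k) (hm : 1 ≤ m) (hmk : m + 1 ≤ k) (j : ℕ) (h3 : 3 ≤ j) (hj : j ≤ k) :
    Qe k m j ≤ epsE k m := by
  have he : 0 ≤ epsE k m := by
    unfold epsE
    have A0 : (1:ℝ) ≤ m := by exact_mod_cast hm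
    have W0 : (2:ℝ) ≤ k := by exact_mod_cast hk
    have : 0 ≤ (m:ℝ)*k-1 := by nlinarith
    have : 0 ≤ (k:ℝ)-1 := by linarith
    positivity
  have key : ∀ J, J + 4 ≤ k → Qe k m (J+3) ≤ epsE k m ∧ Qe k m (J+4) ≤ epsE k m := by
    intro J
    induction J with
    | zero => intro h; exact ⟨Qe_three_le k m (by omega) hm hmk, Qe_four_le k m h hm hmk⟩
    | succ J ih =>
      intro h
      obtain ⟨h1, h2⟩ := ih (by omega)
      refine ⟨?_, ?_⟩
      · rw [show J + 1 + 3 = J + 4 by ring]; exact h2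
      · rw [show J + 1 + 4 = (J + 3) + 2 by ring]
        exact Qe_step k m (J+3) hk hm (by omega) _ he h1 h2
  rcases Nat.lt_or_ge j 4 with h | h
  · have : j = 3 := by omega
    subst this; exact Qe_three_le k m (by omega) hm hmk
  · obtain ⟨J, rfl⟩ := Nat.exists_eq_add_of_le h
    rw [show 4 + J = J + 4 by ring] at *
    exact (key J hj).2


set_option linter.all false
set_option linter.unusedSectionVars false
set_option linter.style.haveILetI false
open scoped BigOperators

section avg
variable {X : Type*} [Group X] [Fintype X]

noncomputable def eav {X H : Type*} [Group X] [Group H] [Fintype H] (φ : H →* X) (g : X → ℝ) : X → ℝ :=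
  fun x => 𝔼 h, g (x * φ h)

noncomputable def ip {X : Type*} [Fintype X] (f g : X → ℝ) : ℝ := 𝔼 x, f x * g x

def Inva {X H : Type*} [Group X] [Group H] (φ : H →* X) (g : X → ℝ) : Prop := ∀ x h, g (x * φ h) = g x

theorem ip_comm (f g : X → ℝ) : ip f g = ip g f := by
  unfold ip; simp only [mul_comm]

theorem ip_add_left (f g h : X → ℝ) : ip (f + g) h = ip f h + ip g h := by
  unfold ip; simp only [Pi.add_apply, add_mul]; exact Finset.expect_add_distrib _ _ _

theorem ip_sub_left (f g h : X → ℝ) : ip (f - g) h = ip f h - ip g h := by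
  unfold ip; simp only [Pi.sub_apply, sub_mul]; exact Finset.expect_sub_distrib _ _ _

theorem ip_smul_left (c : ℝ) (f h : X → ℝ) : ip (c • f) h = c * ip f h := by
  unfold ip; simp only [Pi.smul_apply, smul_eq_mul, mul_assoc]; exact (Finset.mul_expect _ _ _).symm

theorem ip_add_right (f g h : X → ℝ) : ip h (f + g) = ip h f + ip h g := by
  rw [ip_comm, ip_add_left, ip_comm f, ip_comm g]

theorem ip_sub_right (f g h : X → ℝ) : ip h (f - g) = ip h f - ip h g := by
  rw [ip_comm, ip_sub_left, ip_comm f, ip_comm g]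

theorem ip_smul_right (c : ℝ) (f h : X → ℝ) : ip h (c • f) = c * ip h f := by
  rw [ip_comm, ip_smul_left, ip_comm f]

theorem ip_self_nonneg (f : X → ℝ) : 0 ≤ ip f f := by
  unfold ip; exact Finset.expect_nonneg fun i _ => mul_self_nonneg _

theorem ip_self_eq_zero (f : X → ℝ) (h : ip f f = 0) : f = 0 := by
  unfold ip at h
  rw [Fintype.expect_eq_sum_div_card, div_eq_zero_iff] at h
  rcases h with h | h
  · rw [Finset.sum_eq_zero_iff_of_nonneg (fun i _ => mul_self_nonneg _)] at h
    funext x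
    simpa using h x (Finset.mem_univ x)
  · simp at h

theorem ip_cs (f g : X → ℝ) : ip f g ^ 2 ≤ ip f f * ip g g := by
  have h := fun t : ℝ => ip_self_nonneg (f + t • g)
  have h2 : ∀ t : ℝ, 0 ≤ ip g g * (t * t) + (2 * ip f g) * t + ip f f := by
    intro t
    have := h t
    rw [ip_add_left, ip_add_right, ip_add_right, ip_smul_left, ip_smul_left, ip_smul_right, ip_smul_right, ip_comm g f] at this
    linarith
  have := discrim_le_zero h2
  unfold discrim at this
  nlinarith

theorem expect_mul_right (f : X → ℝ) (a : X) : 𝔼 x, f (x * a) = 𝔼 x, f x :=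
  Fintype.expect_equiv (Equiv.mulRight a) _ _ (fun _ => rfl)

theorem expect_mul_left (f : X → ℝ) (a : X) : 𝔼 x, f (a * x) = 𝔼 x, f x :=
  Fintype.expect_equiv (Equiv.mulLeft a) _ _ (fun _ => rfl)

theorem expect_inv (f : X → ℝ) : 𝔼 x, f (x⁻¹) = 𝔼 x, f x :=
  Fintype.expect_equiv (Equiv.inv X) _ _ (fun _ => rfl)

variable {H : Type*} [Group H] [Fintype H] (φ : H →* X)

theorem eav_inv (g : X → ℝ) : Inva φ (eav φ g) := by
  intro x h
  unfold eav
  simp only [mul_assoc, ← map_mul]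
  exact expect_mul_left (fun h' => g (x * φ h')) h

theorem eav_of_inv {g : X → ℝ} (hg : Inva φ g) : eav φ g = g := by
  funext x
  unfold eav
  simp only [hg x]
  exact Fintype.expect_const _

theorem ip_eav (f g : X → ℝ) : ip (eav φ f) g = ip f (eav φ g) := by
  unfold ip eav
  simp only [Finset.expect_mul, Finset.mul_expect]
  rw [Finset.expect_comm]
  conv_rhs => rw [Finset.expect_comm]
  rw [← expect_inv]
  refine Finset.expect_congr rfl fun h _ => ?_
  rw [← expect_mul_right _ (φ h)]
  refine Finset.expect_congr rfl fun x _ => ?_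
  simp [mul_assoc]

theorem eav_add (f g : X → ℝ) : eav φ (f + g) = eav φ f + eav φ g := by
  funext x; exact Finset.expect_add_distrib _ _ _
theorem eav_sub (f g : X → ℝ) : eav φ (f - g) = eav φ f - eav φ g := by
  funext x; exact Finset.expect_sub_distrib _ _ _
theorem eav_smul (c : ℝ) (g : X → ℝ) : eav φ (c • g) = c • eav φ g := by
  funext x; exact (Finset.mul_expect _ _ _).symm
theorem eav_const (c : ℝ) : eav φ (fun _ => c) = fun _ => c := by
  funext x; exact Fintype.expect_const _

theorem ip_eav_eav (f g : X → ℝ) : ip (eav φ f) (eav φ g) = ip f (eav φ g) := by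
  rw [ip_eav, eav_of_inv φ (eav_inv φ g)]

theorem ip_inv_left {f : X → ℝ} (hf : Inva φ f) (g : X → ℝ) : ip f (eav φ g) = ip f g := by
  rw [← ip_eav, eav_of_inv φ hf]

theorem expect_eav (f : X → ℝ) : 𝔼 x, eav φ f x = 𝔼 x, f x := by
  have := ip_eav φ f (fun _ => 1)
  rw [eav_const] at this
  simpa [ip] using this

theorem eav_comm {H' : Type*} [Group H'] [Fintype H'] (ψ : H' →* X) (hc : ∀ h h', φ h * ψ h' = ψ h' * φ h)
    (g : X → ℝ) : eav φ (eav ψ g) = eav ψ (eav φ g) := by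
  funext x
  unfold eav
  rw [Finset.expect_comm]
  simp only [mul_assoc, hc]

theorem ip_pyth (f : X → ℝ) : ip f f - ip (eav φ f) (eav φ f) = ip (f - eav φ f) (f - eav φ f) := by
  have := ip_eav_eav φ f f
  rw [ip_sub_left, ip_sub_right, ip_sub_right, ip_comm (eav φ f) f, ← this]; ring

theorem ip_contr (f : X → ℝ) : ip (eav φ f) (eav φ f) ≤ ip f f := by
  have := ip_pyth φ f
  have := ip_self_nonneg (f - eav φ f)
  linarith

end avg

section rayleigh
variable {X : Type*} [Fintype X]

theorem ip_eq_inner (f g : X → ℝ) : ip f g = (Fintype.card X : ℝ)⁻¹ * inner ℝ (WithLp.toLp 2 f : EuclideanSpace ℝ X) (WithLp.toLp 2 g) := by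
  unfold ip
  rw [Fintype.expect_eq_sum_div_card, PiLp.inner_apply, div_eq_inv_mul]
  congr 1
  refine Finset.sum_congr rfl fun x _ => ?_
  simp [mul_comm]

theorem rayleigh_bound (M : (X → ℝ) →ₗ[ℝ] (X → ℝ)) (U : Submodule ℝ (X → ℝ)) (hU : ∀ f ∈ U, M f ∈ U)
    (hs : ∀ f ∈ U, ∀ g ∈ U, ip (M f) g = ip f (M g)) (l : ℝ)
    (hl : ∀ h ∈ U, h ≠ 0 → ∀ μ : ℝ, M h = μ • h → μ ≤ l) (f : X → ℝ) (hf : f ∈ U) :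
    ip f (M f) ≤ l * ip f f := by
  classical
  by_cases hf0 : f = 0
  · subst hf0; simp [ip]
  have hX : (Fintype.card X : ℝ) ≠ 0 := by
    intro h
    apply hf0
    have : IsEmpty X := by
      rw [← Fintype.card_eq_zero_iff]; exact_mod_cast h
    funext x; exact isEmptyElim x
  let L := WithLp.linearEquiv 2 ℝ (X → ℝ)
  let V : Submodule ℝ (EuclideanSpace ℝ X) := U.comap L.toLinearMap
  let T0 : EuclideanSpace ℝ X →ₗ[ℝ] EuclideanSpace ℝ X := L.symm.toLinearMap ∘ₗ M ∘ₗ L.toLinearMap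
  have hT0 : ∀ v ∈ V, T0 v ∈ V := by
    intro v hv
    exact hU _ hv
  let T : V →ₗ[ℝ] V := T0.restrict hT0
  have hT : T.IsSymmetric := by
    intro v w
    have := hs _ v.2 _ w.2
    rw [ip_eq_inner, ip_eq_inner] at this
    exact mul_left_cancel₀ (inv_ne_zero hX) this
  let f' : V := ⟨L.symm f, by simpa [V] using hf⟩
  have hf' : f' ≠ 0 := by
    intro h
    apply hf0
    have := congrArg (fun v : V => L v.1) h
    simpa [f'] using this
  haveI : Nontrivial V := ⟨f', 0, hf'⟩
  have hev := hT.hasEigenvalue_iSup_of_finiteDimensional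
  obtain ⟨v, hv⟩ := hev.exists_hasEigenvector
  have hle := hl (L v.1) v.2 (by
    intro h
    apply hv.2
    apply Subtype.ext
    apply L.injective
    simpa using h) _ (by
    have := hv.apply_eq_smul
    have := congrArg (fun v : V => L v.1) this
    simpa [T, T0] using this)
  have hbd : BddAbove (Set.range fun x : { x : V // x ≠ 0 } => RCLike.re (inner ℝ (T x) (x:V)) / ‖(x:V)‖ ^ 2) := by
    let T' : V →L[ℝ] V := LinearMap.toContinuousLinearMap T
    refine ⟨‖T'‖, ?_⟩
    rintro _ ⟨x, rfl⟩
    have hx : 0 < ‖(x:V)‖ := norm_pos_iff.2 x.2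
    show _ / _ ≤ _
    rw [div_le_iff₀ (by positivity)]
    have h1 := real_inner_le_norm (T x) (x:V)
    have h2 := T'.le_opNorm (x:V)
    have h3 : T' (x:V) = T x := rfl
    rw [h3] at h2
    calc _ ≤ ‖T x‖ * ‖(x:V)‖ := h1
      _ ≤ (‖T'‖ * ‖(x:V)‖) * ‖(x:V)‖ := by gcongr
      _ = _ := by ring
  have h1 := le_ciSup hbd ⟨f', hf'⟩
  have h2 := h1.trans hle
  have hx : 0 < ‖f'‖ := norm_pos_iff.2 hf'
  have h3 : RCLike.re (inner ℝ (T f') f') / ‖f'‖ ^ 2 ≤ l := h2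
  rw [div_le_iff₀ (by positivity), ← real_inner_self_eq_norm_sq] at h3
  rw [ip_eq_inner, ip_eq_inner]
  have h4 : inner ℝ (T f') f' = inner ℝ (WithLp.toLp 2 f : EuclideanSpace ℝ X) (WithLp.toLp 2 (M f)) := by
    rw [real_inner_comm]; rfl
  have h5 : inner ℝ f' f' = inner ℝ (WithLp.toLp 2 f : EuclideanSpace ℝ X) (WithLp.toLp 2 f) := rfl
  rw [h5] at h3
  have h3' : inner ℝ (T f') f' ≤ l * inner ℝ (WithLp.toLp 2 f : EuclideanSpace ℝ X) (WithLp.toLp 2 f) := h3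
  rw [h4] at h3'
  have : (0:ℝ) ≤ (Fintype.card X : ℝ)⁻¹ := by positivity
  have := mul_le_mul_of_nonneg_left h3' this
  linarith

theorem exists_proj {ι : Type*} (w : ι → X → ℝ) (g : X → ℝ) :
    ∃ p ∈ Submodule.span ℝ (Set.range w), ∀ i, ip (g - p) (w i) = 0 := by
  classical
  let L := WithLp.linearEquiv 2 ℝ (X → ℝ)
  let V : Submodule ℝ (EuclideanSpace ℝ X) := (Submodule.span ℝ (Set.range w)).comap L.toLinearMap
  obtain ⟨y, hy, z, hz, hyz⟩ := V.exists_add_mem_mem_orthogonal (L.symm g)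
  refine ⟨L y, hy, fun i => ?_⟩
  have : g - L y = L z := by
    have := congrArg L hyz
    simp only [LinearEquiv.apply_symm_apply, map_add] at this
    rw [this]; simp
  rw [this, ip_eq_inner, real_inner_comm]
  have h := (Submodule.mem_orthogonal V z).1 hz (L.symm (w i)) (by
    show L (L.symm (w i)) ∈ Submodule.span ℝ (Set.range w)
    simp only [LinearEquiv.apply_symm_apply]
    exact Submodule.subset_span ⟨i, rfl⟩)
  have h' : inner ℝ (WithLp.toLp 2 (w i) : EuclideanSpace ℝ X) (WithLp.toLp 2 (L z)) = 0 := h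
  rw [h', mul_zero]
end rayleigh

set_option linter.all false
set_option linter.unusedSectionVars false
open scoped BigOperators

section homs
variable {ρ κ : Type} [Fintype ρ] [DecidableEq ρ] [Fintype κ] [DecidableEq κ]

/-- permute inside each row -/
def fibH (ρ κ : Type) : (ρ → Equiv.Perm κ) →* Equiv.Perm (ρ × κ) where
  toFun τ := ⟨fun p => (p.1, τ p.1 p.2), fun p => (p.1, (τ p.1)⁻¹ p.2), fun p => by simp, fun p => by simp⟩
  map_one' := by ext p <;> simp
  map_mul' a b := by ext p <;> simp

/-- permute inside each column -/
def colH (ρ κ : Type) : (κ → Equiv.Perm ρ) →* Equiv.Perm (ρ × κ) where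
  toFun τ := ⟨fun p => (τ p.2 p.1, p.2), fun p => ((τ p.2)⁻¹ p.1, p.2), fun p => by simp, fun p => by simp⟩
  map_one' := by ext p <;> simp
  map_mul' a b := by ext p <;> simp

def constH (ρ G : Type) [Group G] : G →* (ρ → G) where
  toFun g := fun _ => g
  map_one' := rfl
  map_mul' _ _ := rfl

def diagH (ρ κ : Type) : Equiv.Perm κ →* Equiv.Perm (ρ × κ) := (fibH ρ κ).comp (constH ρ _)

def restrH {G : Type} [Group G] (s : Finset ρ) : (ρ → G) →* (ρ → G) where
  toFun τ := fun i => if i ∈ s then τ i else 1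
  map_one' := by funext i; simp
  map_mul' a b := by funext i; by_cases h : i ∈ s <;> simp [h]

def rowsH (s : Finset ρ) : (ρ → Equiv.Perm κ) →* Equiv.Perm (ρ × κ) := (fibH ρ κ).comp (restrH s)

def rowH (κ : Type) (i : ρ) : Equiv.Perm κ →* Equiv.Perm (ρ × κ) := (fibH ρ κ).comp (MonoidHom.mulSingle (fun _ => Equiv.Perm κ) i)

@[simp] theorem fibH_apply (τ : ρ → Equiv.Perm κ) (p : ρ × κ) : fibH ρ κ τ p = (p.1, τ p.1 p.2) := rfl
@[simp] theorem colH_apply (τ : κ → Equiv.Perm ρ) (p : ρ × κ) : colH ρ κ τ p = (τ p.2 p.1, p.2) := rfl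

theorem rowsH_insert (g : Equiv.Perm (ρ × κ) → ℝ) (i : ρ) (s : Finset ρ) (hi : i ∉ s) :
    eav (rowsH (insert i s)) g = eav (rowH κ i) (eav (rowsH s) g) := by
  have h1 : eav (rowH κ i) (eav (rowsH (insert i s)) g) = eav (rowsH (insert i s)) g := by
    apply eav_of_inv
    intro x τ
    have : rowH κ i τ = rowsH (insert i s) (Pi.mulSingle i τ) := by
      show fibH ρ κ _ = fibH ρ κ _
      congr 1
      funext j
      by_cases hj : j = i
      · subst hj; simp [restrH]
      · simp [restrH, hj]
    rw [this]
    exact eav_inv _ _ _ _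
  rw [← h1]
  funext x
  unfold eav
  rw [Finset.expect_comm]
  conv_rhs => rw [Finset.expect_comm]
  refine Finset.expect_congr rfl fun τ' _ => ?_
  rw [← expect_mul_right (fun τ => g (x * rowH κ i τ * rowsH s τ')) (τ' i)]
  refine Finset.expect_congr rfl fun τ _ => ?_
  congr 1
  rw [mul_assoc, mul_assoc]
  congr 1
  show fibH ρ κ _ * fibH ρ κ _ = fibH ρ κ _ * fibH ρ κ _
  rw [← map_mul, ← map_mul]
  congr 1
  funext j
  by_cases hj : j = i
  · subst hj; simp [restrH, hi]
  · simp [restrH, hj]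

theorem rowH_rowsH_comm (g : Equiv.Perm (ρ × κ) → ℝ) (i : ρ) (s : Finset ρ) (hi : i ∉ s) :
    eav (rowH κ i) (eav (rowsH s) g) = eav (rowsH s) (eav (rowH κ i) g) := by
  apply eav_comm
  intro h h'
  show fibH ρ κ _ * fibH ρ κ _ = fibH ρ κ _ * fibH ρ κ _
  rw [← map_mul, ← map_mul]
  congr 1
  funext j
  by_cases hj : j = i
  · subst hj; simp [restrH, hi]
  · simp [restrH, hj]

theorem rowsH_empty (g : Equiv.Perm (ρ × κ) → ℝ) : eav (rowsH ∅) g = g := by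
  apply eav_of_inv
  intro x h
  have : rowsH (κ := κ) (∅ : Finset ρ) h = 1 := by
    show fibH ρ κ _ = 1
    rw [← map_one (fibH ρ κ)]
    congr 1
  rw [this, mul_one]

theorem rowsH_univ : rowsH (κ := κ) (Finset.univ : Finset ρ) = fibH ρ κ := by
  ext1 τ
  show fibH ρ κ _ = fibH ρ κ _
  congr 1
  funext j
  simp [restrH]

theorem efron_stein (g : Equiv.Perm (ρ × κ) → ℝ) (s : Finset ρ) :
    ip g g - ip (eav (rowsH s) g) (eav (rowsH s) g) ≤
      ∑ i ∈ s, (ip g g - ip (eav (rowH κ i) g) (eav (rowH κ i) g)) := by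
  induction s using Finset.induction_on with
  | empty => simp [rowsH_empty]
  | insert i s hi ih =>
    rw [Finset.sum_insert hi, rowsH_insert g i s hi]
    have h1 := ip_pyth (rowH κ i) (eav (rowsH s) g)
    have h2 := ip_pyth (rowH κ i) g
    rw [rowH_rowsH_comm g i s hi] at h1 ⊢
    rw [← eav_sub] at h1
    have h3 := ip_contr (rowsH s) (g - eav (rowH κ i) g)
    linarith

theorem row_norm_eq (g : Equiv.Perm (ρ × κ) → ℝ) (hg : Inva (colH ρ κ) g) (i j : ρ) :
    ip (eav (rowH κ i) g) (eav (rowH κ i) g) = ip (eav (rowH κ j) g) (eav (rowH κ j) g) := by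
  let π : Equiv.Perm (ρ × κ) := colH ρ κ (fun _ => Equiv.swap j i)
  have h : ∀ x, eav (rowH κ i) g (x * π) = eav (rowH κ j) g x := by
    intro x
    unfold eav
    refine Finset.expect_congr rfl fun τ _ => ?_
    rw [← hg (x * rowH κ j τ) (fun _ => Equiv.swap j i)]
    congr 1
    rw [mul_assoc, mul_assoc]
    congr 1
    apply Equiv.ext
    rintro ⟨a, c⟩
    show colH ρ κ (fun _ => Equiv.swap j i) (fibH ρ κ (Pi.mulSingle i τ) (a, c)) = fibH ρ κ (Pi.mulSingle j τ) (colH ρ κ (fun _ => Equiv.swap j i) (a,c))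
    by_cases ha : a = i
    · subst ha; simp
    · have : Equiv.swap j i a ≠ j := by
        intro h; apply ha
        rw [Equiv.swap_apply_eq_iff] at h; simpa using h
      simp [ha, this]
  unfold ip
  rw [← expect_mul_right _ π]
  simp only [h]

end homs

section ext
variable {m : ℕ} {κ : Type}

def extFun (σ : Equiv.Perm (Fin m × κ)) (p : Fin (m+1) × κ) : Fin (m+1) × κ :=
  Fin.cases (motive := fun _ => Fin (m+1) × κ) (0, p.2) (fun i => ((σ (i, p.2)).1.succ, (σ (i, p.2)).2)) p.1

theorem extFun_zero (σ : Equiv.Perm (Fin m × κ)) (c : κ) : extFun σ (0, c) = (0, c) := rfl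
theorem extFun_succ (σ : Equiv.Perm (Fin m × κ)) (i : Fin m) (c : κ) :
    extFun σ (i.succ, c) = ((σ (i, c)).1.succ, (σ (i, c)).2) := rfl

theorem extFun_mul (σ τ : Equiv.Perm (Fin m × κ)) (p : Fin (m+1) × κ) :
    extFun (σ * τ) p = extFun σ (extFun τ p) := by
  obtain ⟨i, c⟩ := p
  refine Fin.cases ?_ (fun i => ?_) i
  · rfl
  · rw [extFun_succ, extFun_succ, extFun_succ]; rfl

theorem extFun_one (p : Fin (m+1) × κ) : extFun (1 : Equiv.Perm (Fin m × κ)) p = p := by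
  obtain ⟨i, c⟩ := p
  refine Fin.cases ?_ (fun i => ?_) i <;> rfl

def extH (m : ℕ) (κ : Type) : Equiv.Perm (Fin m × κ) →* Equiv.Perm (Fin (m+1) × κ) where
  toFun σ := ⟨extFun σ, extFun σ⁻¹, fun p => by rw [← extFun_mul, inv_mul_cancel, extFun_one],
    fun p => by rw [← extFun_mul, mul_inv_cancel, extFun_one]⟩
  map_one' := Equiv.ext fun p => extFun_one p
  map_mul' a b := Equiv.ext fun p => extFun_mul a b p

end ext

section garland
variable {m : ℕ} {κ : Type} [Fintype κ] [DecidableEq κ]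

theorem fib_eq_erase (g : Equiv.Perm (Fin (m+1) × κ) → ℝ) (hd : Inva (diagH (Fin (m+1)) κ) g) :
    eav (rowsH (Finset.univ.erase (0 : Fin (m+1)))) g = eav (fibH (Fin (m+1)) κ) g := by
  rw [← rowsH_univ, ← Finset.insert_erase (Finset.mem_univ (0 : Fin (m+1))), rowsH_insert _ _ _ (by simp)]
  rw [Finset.insert_erase (Finset.mem_univ (0 : Fin (m+1)))]
  symm
  apply eav_of_inv
  intro x τ
  unfold eav
  rw [← expect_mul_right (fun τ' => g (x * rowsH (Finset.univ.erase (0 : Fin (m+1))) τ')) (fun _ => τ⁻¹)]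
  refine Finset.expect_congr rfl fun τ' _ => ?_
  rw [← hd _ τ⁻¹]
  congr 1
  rw [mul_assoc, mul_assoc]
  congr 1
  show fibH _ κ _ * (fibH _ κ _ * fibH _ κ _) = fibH _ κ _
  rw [← map_mul, ← map_mul]
  congr 1
  funext j
  by_cases hj : j = 0
  · subst hj; simp [restrH, constH]
  · simp [restrH, hj, constH]

theorem extH_zero (σ : Equiv.Perm (Fin m × κ)) (c : κ) : extH m κ σ (0, c) = (0, c) := rfl
theorem extH_succ (σ : Equiv.Perm (Fin m × κ)) (i : Fin m) (c : κ) :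
    extH m κ σ (i.succ, c) = ((σ (i, c)).1.succ, (σ (i, c)).2) := rfl

theorem row0_zero (τ : Equiv.Perm κ) (c : κ) : rowH κ (0 : Fin (m+1)) τ (0, c) = (0, τ c) := by
  show fibH _ κ (Pi.mulSingle 0 τ) _ = _
  simp
theorem row0_succ (τ : Equiv.Perm κ) (i : Fin m) (c : κ) : rowH κ (0 : Fin (m+1)) τ (i.succ, c) = (i.succ, c) := by
  show fibH _ κ (Pi.mulSingle 0 τ) _ = _
  simp

theorem perm_ext_fin {f g : Equiv.Perm (Fin (m+1) × κ)} (h0 : ∀ c, f (0,c) = g (0,c))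
    (hs : ∀ i c, f (Fin.succ i, c) = g (Fin.succ i, c)) : f = g := by
  apply Equiv.ext
  rintro ⟨i, c⟩
  refine Fin.cases (h0 c) (fun i => hs i c) i

theorem ext_row0_comm (σ : Equiv.Perm (Fin m × κ)) (τ : Equiv.Perm κ) :
    extH m κ σ * rowH κ 0 τ = rowH κ 0 τ * extH m κ σ := by
  apply perm_ext_fin
  · intro c
    simp only [Equiv.Perm.mul_apply, row0_zero, extH_zero]
  · intro i c
    simp only [Equiv.Perm.mul_apply, row0_succ, extH_succ]

theorem fib_ext (g : Equiv.Perm (Fin (m+1) × κ) → ℝ) :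
    eav ((extH m κ).comp (fibH (Fin m) κ)) (eav (rowH κ 0) g) = eav (fibH (Fin (m+1)) κ) g := by
  funext x
  unfold eav
  rw [Finset.expect_comm]
  rw [← Finset.expect_product', Finset.univ_product_univ]
  refine Fintype.expect_equiv (Fin.consEquiv (fun _ : Fin (m+1) => Equiv.Perm κ)) _ _ ?_
  rintro ⟨τ0, τ⟩
  rw [mul_assoc]
  congr 2
  apply perm_ext_fin
  · intro c
    simp only [Equiv.Perm.mul_apply, row0_zero, MonoidHom.comp_apply, extH_zero]
    rfl
  · intro i c
    simp only [Equiv.Perm.mul_apply, row0_succ, MonoidHom.comp_apply, extH_succ]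
    rfl

theorem ext_col (h : κ → Equiv.Perm (Fin m)) : ∃ h' : κ → Equiv.Perm (Fin (m+1)),
    extH m κ (colH (Fin m) κ h) = colH (Fin (m+1)) κ h' := by
  refine ⟨fun c => Equiv.Perm.decomposeFin.symm (0, h c), ?_⟩
  apply perm_ext_fin
  · intro c
    rw [extH_zero]; simp
  · intro i c
    rw [extH_succ]; simp

theorem ext_diag (τ : Equiv.Perm κ) : rowH κ 0 τ * extH m κ (diagH (Fin m) κ τ) = diagH (Fin (m+1)) κ τ := by
  apply perm_ext_fin
  · intro c
    simp only [Equiv.Perm.mul_apply, row0_zero, extH_zero]; rfl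
  · intro i c
    simp only [Equiv.Perm.mul_apply, row0_succ, extH_succ]
    exact row0_succ τ i (τ c)

def ClaimA (m : ℕ) (κ : Type) [Fintype κ] [DecidableEq κ] : Prop :=
  ∀ g : Equiv.Perm (Fin m × κ) → ℝ, Inva (colH (Fin m) κ) g → Inva (diagH (Fin m) κ) g → 𝔼 x, g x = 0 →
    ((m : ℝ) * Fintype.card κ) * ip (eav (fibH (Fin m) κ) g) (eav (fibH (Fin m) κ) g) ≤ ip g g

theorem garland (hA : ClaimA m κ) (g : Equiv.Perm (Fin (m+1) × κ) → ℝ) (hc : Inva (colH (Fin (m+1)) κ) g)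
    (hd : Inva (diagH (Fin (m+1)) κ) g) (gt G Tg : Equiv.Perm (Fin (m+1) × κ) → ℝ)
    (hgt : gt = eav (rowH κ 0) g) (hG : G = eav (extH m κ) gt) (hT : Tg = eav (fibH (Fin (m+1)) κ) g) :
    ((m:ℝ) * Fintype.card κ) * (ip Tg Tg - ip G G) ≤ ip gt gt - ip G G := by
  have hGi : Inva (extH m κ) G := by rw [hG]; exact eav_inv _ _
  have hT2 : Tg = eav ((extH m κ).comp (fibH (Fin m) κ)) gt := by rw [hT, hgt, fib_ext]
  have hG2 : G = eav (extH m κ) Tg := by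
    rw [hT2, hG]
    funext x
    unfold eav
    rw [Finset.expect_comm]
    symm
    trans 𝔼 (i : Fin m → Equiv.Perm κ), 𝔼 h, gt (x * (extH m κ) h)
    · refine Finset.expect_congr rfl fun τ _ => ?_
      rw [← expect_mul_right (fun h => gt (x * (extH m κ) h)) (fibH (Fin m) κ τ)]
      refine Finset.expect_congr rfl fun σ _ => ?_
      simp [mul_assoc]
    · exact Fintype.expect_const _
  have p1 := ip_pyth (extH m κ) gt
  have p2 := ip_pyth (extH m κ) Tg
  rw [← hG] at p1
  rw [← hG2] at p2
  rw [p1, p2]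
  have key : ∀ x, ((m:ℝ) * Fintype.card κ) * 𝔼 σ, (Tg - G) (x * extH m κ σ) * (Tg - G) (x * extH m κ σ)
      ≤ 𝔼 σ, (gt - G) (x * extH m κ σ) * (gt - G) (x * extH m κ σ) := by
    intro x
    have := hA (fun σ => (gt - G) (x * extH m κ σ)) ?_ ?_ ?_
    · unfold ip at this
      convert this using 6
      · rename_i σ _
        show Tg _ - G _ = _
        unfold eav
        simp only [Pi.sub_apply]
        rw [Finset.expect_sub_distrib]
        rw [hT2]
        congr 1
        · unfold eav; simp [mul_assoc]
        · symm
          rw [hGi x]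
          trans 𝔼 h : Fin m → Equiv.Perm κ, G x
          · refine Finset.expect_congr rfl fun h _ => hGi x _
          · exact Fintype.expect_const _
      · rename_i σ _
        show Tg _ - G _ = _
        unfold eav
        simp only [Pi.sub_apply]
        rw [Finset.expect_sub_distrib]
        rw [hT2]
        congr 1
        · unfold eav; simp [mul_assoc]
        · symm
          rw [hGi x]
          trans 𝔼 h : Fin m → Equiv.Perm κ, G x
          · refine Finset.expect_congr rfl fun h _ => hGi x _
          · exact Fintype.expect_const _
    · intro σ h
      simp only [Pi.sub_apply]
      rw [hGi, hGi, map_mul, ← mul_assoc]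
      congr 1
      obtain ⟨h', hh⟩ := ext_col (m := m) h
      rw [hgt]
      unfold eav
      refine Finset.expect_congr rfl fun τ _ => ?_
      rw [mul_assoc, ext_row0_comm, ← mul_assoc, hh, hc]
    · intro σ τ
      simp only [Pi.sub_apply]
      rw [hGi, hGi, map_mul, ← mul_assoc]
      congr 1
      rw [hgt]
      have : extH m κ (diagH (Fin m) κ τ) = rowH κ 0 τ⁻¹ * diagH (Fin (m+1)) κ τ := by
        rw [← ext_diag, ← mul_assoc, ← map_mul]; simp
      unfold eav
      rw [← expect_mul_right (fun h => g (x * extH m κ σ * rowH κ 0 h)) τ⁻¹]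
      refine Finset.expect_congr rfl fun τ' _ => ?_
      rw [mul_assoc (x * _), ext_row0_comm, this, ← mul_assoc, ← mul_assoc, hd, map_mul, ← mul_assoc]
    · simp only [Pi.sub_apply]
      rw [Finset.expect_sub_distrib, hG]
      have : ∀ σ, eav (extH m κ) gt (x * extH m κ σ) = eav (extH m κ) gt x := fun σ => eav_inv _ _ _ _
      simp only [this, Fintype.expect_const]
      unfold eav
      ring
  have h2 := Finset.expect_le_expect (s := Finset.univ) fun x _ => key x
  rw [← Finset.mul_expect] at h2
  have e1 := expect_eav (extH m κ) (fun y => (Tg - G) y * (Tg - G) y)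
  have e2 := expect_eav (extH m κ) (fun y => (gt - G) y * (gt - G) y)
  unfold eav at e1 e2
  rw [e1, e2] at h2
  exact h2

theorem efron_step (g : Equiv.Perm (Fin (m+1) × κ) → ℝ) (hc : Inva (colH (Fin (m+1)) κ) g)
    (hd : Inva (diagH (Fin (m+1)) κ) g) (gt Tg : Equiv.Perm (Fin (m+1) × κ) → ℝ)
    (hgt : gt = eav (rowH κ 0) g) (hT : Tg = eav (fibH (Fin (m+1)) κ) g) :
    ip g g - ip Tg Tg ≤ m * (ip g g - ip gt gt) := by
  have h := efron_stein g (Finset.univ.erase (0 : Fin (m+1)))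
  rw [fib_eq_erase g hd, ← hT] at h
  refine h.trans (le_of_eq ?_)
  rw [Finset.sum_congr rfl (fun i _ => by rw [row_norm_eq g hc i 0, ← hgt])]
  simp
  ring
end garland

set_option linter.all false
set_option linter.unusedSectionVars false
open scoped BigOperators

section pairs
theorem expect_pair {ι β : Type} [Fintype ι] [DecidableEq ι] [Fintype β] [DecidableEq β] (i j : ι) (hij : i ≠ j) (u v : β) :
    𝔼 τ : ι → Equiv.Perm β, (if τ i u = τ j v then (1:ℝ) else 0) = 1 / Fintype.card β := by
  have h1 : ∀ w, 𝔼 τ : ι → Equiv.Perm β, (if τ i w = τ j v then (1:ℝ) else 0) =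
      𝔼 τ : ι → Equiv.Perm β, (if τ i u = τ j v then (1:ℝ) else 0) := by
    intro w
    rw [← expect_mul_right _ (Pi.mulSingle i (Equiv.swap u w))]
    refine Finset.expect_congr rfl fun τ _ => ?_
    simp [hij.symm]
  have h2 : ∑ w, 𝔼 τ : ι → Equiv.Perm β, (if τ i w = τ j v then (1:ℝ) else 0) = 1 := by
    rw [← Finset.expect_sum_comm]
    have : ∀ τ : ι → Equiv.Perm β, ∑ w, (if τ i w = τ j v then (1:ℝ) else 0) = 1 := by
      intro τ
      have : ∀ w, (τ i w = τ j v) ↔ w = (τ i)⁻¹ (τ j v) := fun w => by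
        rw [Equiv.Perm.eq_inv_iff_eq]
      simp only [this]; simp
    simp only [this]
    exact Fintype.expect_const _
  simp only [h1, Finset.sum_const, Finset.card_univ, nsmul_eq_mul] at h2
  have : (Fintype.card β : ℝ) ≠ 0 := by
    intro h; rw [h] at h2; simp at h2
  field_simp
  linarith

variable {ρ κ : Type} [Fintype ρ] [DecidableEq ρ] [Fintype κ] [DecidableEq κ]

noncomputable def fcol (a b : ρ × κ) : Equiv.Perm (ρ × κ) → ℝ := fun x => if (x⁻¹ a).2 = (x⁻¹ b).2 then 1 else 0
noncomputable def frow (a b : ρ × κ) : Equiv.Perm (ρ × κ) → ℝ := fun x => if (x⁻¹ a).1 = (x⁻¹ b).1 then 1 else 0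

theorem fib_fcol (a b : ρ × κ) (hab : a ≠ b) :
    eav (fibH ρ κ) (fcol a b) = fun x => (1 / (Fintype.card κ : ℝ)) * (1 - frow a b x) := by
  funext x
  unfold eav
  rw [← expect_inv]
  have : ∀ τ, fcol a b (x * fibH ρ κ τ⁻¹) = if τ (x⁻¹ a).1 (x⁻¹ a).2 = τ (x⁻¹ b).1 (x⁻¹ b).2 then 1 else 0 := by
    intro τ
    simp only [fcol, mul_inv_rev, map_inv, inv_inv, Equiv.Perm.mul_apply, fibH_apply]
  simp only [this]
  have hne : x⁻¹ a ≠ x⁻¹ b := fun h => hab (x⁻¹.injective h)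
  by_cases h : (x⁻¹ a).1 = (x⁻¹ b).1
  · have h2 : (x⁻¹ a).2 ≠ (x⁻¹ b).2 := fun h2 => hne (Prod.ext h h2)
    simp only [frow]
    generalize x⁻¹ a = p at *
    generalize x⁻¹ b = q at *
    simp [h, h2]
  · rw [expect_pair _ _ h]
    simp only [frow]
    rw [if_neg h]; ring

theorem col_frow (a b : ρ × κ) (hab : a ≠ b) :
    eav (colH ρ κ) (frow a b) = fun x => (1 / (Fintype.card ρ : ℝ)) * (1 - fcol a b x) := by
  funext x
  unfold eav
  rw [← expect_inv]
  have : ∀ τ, frow a b (x * colH ρ κ τ⁻¹) = if τ (x⁻¹ a).2 (x⁻¹ a).1 = τ (x⁻¹ b).2 (x⁻¹ b).1 then 1 else 0 := by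
    intro τ
    simp only [frow, mul_inv_rev, map_inv, inv_inv, Equiv.Perm.mul_apply, colH_apply]
  simp only [this]
  have hne : x⁻¹ a ≠ x⁻¹ b := fun h => hab (x⁻¹.injective h)
  by_cases h : (x⁻¹ a).2 = (x⁻¹ b).2
  · have h2 : (x⁻¹ a).1 ≠ (x⁻¹ b).1 := fun h2 => hne (Prod.ext h2 h)
    simp only [fcol]
    generalize x⁻¹ a = p at *
    generalize x⁻¹ b = q at *
    simp [h, h2]
  · rw [expect_pair _ _ h]
    simp only [fcol]
    rw [if_neg h]; ring

theorem fcol_col (a b : ρ × κ) : Inva (colH ρ κ) (fcol a b) := by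
  intro x τ
  have : ∀ a, ((x * colH ρ κ τ)⁻¹ a).2 = (x⁻¹ a).2 := by
    intro a
    rw [mul_inv_rev, ← map_inv, Equiv.Perm.mul_apply, colH_apply]
  simp only [fcol, this]

theorem fcol_diag (a b : ρ × κ) : Inva (diagH ρ κ) (fcol a b) := by
  intro x τ
  have : ∀ a, ((x * diagH ρ κ τ)⁻¹ a).2 = τ⁻¹ (x⁻¹ a).2 := by
    intro a
    rw [mul_inv_rev, ← map_inv, Equiv.Perm.mul_apply]
    rfl
  simp only [fcol, this]
  simp

noncomputable def wfun (ρ κ : Type) [Fintype ρ] [DecidableEq ρ] [Fintype κ] [DecidableEq κ] :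
    Option {p : (ρ × κ) × (ρ × κ) // p.1 ≠ p.2} → Equiv.Perm (ρ × κ) → ℝ
  | none => fun _ => 1
  | some p => fcol p.1.1 p.1.2

theorem wspan_prop (p : Equiv.Perm (ρ × κ) → ℝ) (hp : p ∈ Submodule.span ℝ (Set.range (wfun ρ κ))) :
    Inva (colH ρ κ) p ∧ Inva (diagH ρ κ) p ∧ ∃ c : ℝ, eav (colH ρ κ) (eav (fibH ρ κ) p) =
      (1 / ((Fintype.card ρ : ℝ) * Fintype.card κ)) • p + fun _ => c := by
  induction hp using Submodule.span_induction with
  | mem x h =>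
    obtain ⟨i, rfl⟩ := h
    match i with
    | none =>
      refine ⟨fun _ _ => rfl, fun _ _ => rfl, 1 - (1 / ((Fintype.card ρ : ℝ) * Fintype.card κ)), ?_⟩
      simp only [wfun]
      rw [eav_const, eav_const]
      funext x; simp
    | some q =>
      refine ⟨fcol_col _ _, fcol_diag _ _, 1 / (Fintype.card κ) - 1 / ((Fintype.card ρ : ℝ) * Fintype.card κ), ?_⟩
      simp only [wfun]
      rw [fib_fcol _ _ q.2]
      have : (fun x => (1 / (Fintype.card κ : ℝ)) * (1 - frow q.1.1 q.1.2 x)) = (1 / (Fintype.card κ : ℝ)) • ((fun _ => (1:ℝ)) - frow q.1.1 q.1.2) := by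
        funext x; simp
      rw [this, eav_smul, eav_sub, eav_const, col_frow _ _ q.2]
      funext x
      simp only [Pi.smul_apply, Pi.sub_apply, Pi.add_apply, smul_eq_mul]
      rw [one_div, one_div, one_div, mul_inv]
      ring
  | zero =>
    refine ⟨fun _ _ => rfl, fun _ _ => rfl, 0, ?_⟩
    have : (0 : Equiv.Perm (ρ × κ) → ℝ) = fun _ => 0 := rfl
    rw [this, eav_const, eav_const]; funext x; simp
  | add x y _ _ hx hy =>
    obtain ⟨a1, a2, c, hc⟩ := hx
    obtain ⟨b1, b2, d, hd⟩ := hy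
    refine ⟨fun x h => ?_, fun x h => ?_, c + d, ?_⟩
    · simp only [Pi.add_apply]; rw [a1, b1]
    · simp only [Pi.add_apply]; rw [a2, b2]
    · rw [eav_add, eav_add, hc, hd]; funext x; simp; ring
  | smul r x _ hx =>
    obtain ⟨a1, a2, c, hc⟩ := hx
    refine ⟨fun x h => ?_, fun x h => ?_, r * c, ?_⟩
    · simp only [Pi.smul_apply]; rw [a1]
    · simp only [Pi.smul_apply]; rw [a2]
    · rw [eav_smul, eav_smul, hc]; funext x; simp; ring

theorem ip_const (g : Equiv.Perm (ρ × κ) → ℝ) (c : ℝ) : ip g (fun _ => c) = c * 𝔼 x, g x := by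
  unfold ip; rw [Finset.mul_expect]; simp only [mul_comm]

theorem claim_reduce (m : ℕ) (hm : 1 ≤ m) (hk : 1 ≤ Fintype.card κ)
    (h : ∀ g : Equiv.Perm (Fin m × κ) → ℝ, Inva (colH (Fin m) κ) g → Inva (diagH (Fin m) κ) g → 𝔼 x, g x = 0 →
      (∀ a b, a ≠ b → ip g (fcol a b) = 0) →
      ((m : ℝ) * Fintype.card κ) * ip (eav (fibH (Fin m) κ) g) (eav (fibH (Fin m) κ) g) ≤ ip g g) :
    ClaimA m κ := by
  intro g hc hd h0
  obtain ⟨p, hp, hw⟩ := exists_proj (wfun (Fin m) κ) g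
  obtain ⟨p1, p2, c, hc'⟩ := wspan_prop p hp
  have horth : ip (g - p) p = 0 := by
    revert hw
    generalize g - p = q
    intro hw
    clear p1 p2 hc'
    induction hp using Submodule.span_induction with
    | mem x h => obtain ⟨i, rfl⟩ := h; exact hw i
    | zero => simp [ip]
    | add x y _ _ hx hy => rw [ip_add_right, hx, hy, add_zero]
    | smul r x _ hx => rw [ip_smul_right, hx, mul_zero]
  have hq0 : 𝔼 x, (g - p) x = 0 := by
    have := hw none
    simpa only [wfun, ip_const, one_mul] using this
  have hp0 : 𝔼 x, p x = 0 := by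
    simp only [Pi.sub_apply, Finset.expect_sub_distrib, h0] at hq0
    linarith
  have hqc : Inva (colH (Fin m) κ) (g - p) := fun x h => by simp only [Pi.sub_apply]; rw [hc, p1]
  have hqd : Inva (diagH (Fin m) κ) (g - p) := fun x h => by simp only [Pi.sub_apply]; rw [hd, p2]
  have hq := h (g - p) hqc hqd hq0 (fun a b hab => hw (some ⟨(a, b), hab⟩))
  have hcross : ip (g - p) (eav (fibH (Fin m) κ) p) = 0 := by
    rw [← ip_inv_left (colH (Fin m) κ) hqc, hc', ip_add_right, ip_smul_right, horth, ip_const, hq0]; simp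
  have hpp : ip p (eav (fibH (Fin m) κ) p) = (1 / ((m : ℝ) * Fintype.card κ)) * ip p p := by
    rw [← ip_inv_left (colH (Fin m) κ) p1, hc', ip_add_right, ip_smul_right, ip_const, hp0]; simp
  have hg : g = (g - p) + p := by simp
  generalize hqq : g - p = q at *
  rw [ip_eav_eav] at hq ⊢
  rw [hg, eav_add]
  simp only [ip_add_left, ip_add_right]
  rw [ip_comm p q, horth, hcross, hpp, ← ip_eav _ p q, ip_comm _ q, hcross]
  have hm' : (0:ℝ) < m := by exact_mod_cast hm
  have hk' : (0:ℝ) < Fintype.card κ := by exact_mod_cast hk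
  have : ((m : ℝ) * Fintype.card κ) * ((1 / ((m : ℝ) * Fintype.card κ)) * ip p p) = ip p p := by
    field_simp
  linarith
end pairs

set_option linter.all false
set_option linter.unusedSectionVars false
open scoped BigOperators

section probs

theorem expect_prod_ind {α ι β : Type} [DecidableEq α] [Fintype ι] [DecidableEq ι] [Fintype β] [DecidableEq β] (z : β)
    (S : Finset α) (c : α → ι) (r : α → β) (hc : Set.InjOn c S) :
    𝔼 τ : ι → Equiv.Perm β, (if ∀ a ∈ S, τ (c a) (r a) = z then (1:ℝ) else 0) = (1 / Fintype.card β) ^ S.card := by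
  have hβ : (Fintype.card β : ℝ) ≠ 0 := by
    haveI : Nonempty β := ⟨z⟩
    exact_mod_cast Fintype.card_ne_zero
  induction S using Finset.induction_on with
  | empty => simp
  | insert a S ha ih =>
    have hc' : Set.InjOn c S := hc.mono (by simp)
    have hne : ∀ b ∈ S, c b ≠ c a := by
      intro b hb h
      have := hc (by simp [hb]) (by simp) h
      subst this; exact ha hb
    have h1 : ∀ w, 𝔼 τ : ι → Equiv.Perm β, (if τ (c a) w = z ∧ ∀ b ∈ S, τ (c b) (r b) = z then (1:ℝ) else 0) =
      𝔼 τ : ι → Equiv.Perm β, (if τ (c a) (r a) = z ∧ ∀ b ∈ S, τ (c b) (r b) = z then (1:ℝ) else 0) := by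
      intro w
      rw [← expect_mul_right _ (Pi.mulSingle (c a) (Equiv.swap (r a) w))]
      refine Finset.expect_congr rfl fun τ _ => ?_
      have : ∀ b ∈ S, (τ * Pi.mulSingle (c a) (Equiv.swap (r a) w) : ι → Equiv.Perm β) (c b) = τ (c b) := by
        intro b hb
        simp [hne b hb]
      have e : (∀ b ∈ S, (τ * Pi.mulSingle (c a) (Equiv.swap (r a) w) : ι → Equiv.Perm β) (c b) (r b) = z) ↔ ∀ b ∈ S, τ (c b) (r b) = z :=
        forall₂_congr fun b hb => by rw [this b hb]
      simp only [e]
      simp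
    have h2 : ∑ w, 𝔼 τ : ι → Equiv.Perm β, (if τ (c a) w = z ∧ ∀ b ∈ S, τ (c b) (r b) = z then (1:ℝ) else 0) =
       (1 / Fintype.card β) ^ S.card := by
      rw [← ih hc', ← Finset.expect_sum_comm]
      refine Finset.expect_congr rfl fun τ _ => ?_
      have : ∀ w, (τ (c a) w = z) ↔ w = (τ (c a))⁻¹ z := fun w => by
        rw [Equiv.Perm.eq_inv_iff_eq]
      simp only [this, ite_and]; simp
    simp only [h1, Finset.sum_const, Finset.card_univ, nsmul_eq_mul] at h2
    simp only [Finset.forall_mem_insert]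
    rw [Finset.card_insert_of_notMem ha, pow_succ, ← h2]
    field_simp

theorem trans_prob {ρ κ : Type} [Fintype ρ] [DecidableEq ρ] [Fintype κ] [DecidableEq κ] (D : Finset κ) (J : Finset (ρ × κ)) :
    𝔼 σ : Equiv.Perm (ρ × κ), (if Set.InjOn (fun b => (σ b).2) (J : Set (ρ × κ)) ∧ ∀ b ∈ J, (σ b).2 ∉ D then (1:ℝ) else 0) =
    (Fintype.card ρ : ℝ) ^ J.card * ((Fintype.card κ - D.card).descFactorial J.card : ℝ) /
      ((Fintype.card ρ * Fintype.card κ).descFactorial J.card : ℝ) := by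
  induction J using Finset.induction_on with
  | empty => simp
  | insert b J hb ih =>
    set good : Equiv.Perm (ρ × κ) → Prop := fun σ => Set.InjOn (fun b => (σ b).2) (J : Set (ρ × κ)) ∧ ∀ b ∈ J, (σ b).2 ∉ D with hgood
    set N := Fintype.card ρ * Fintype.card κ with hN
    have hcard : J.card < N := by
      have : J ⊂ Finset.univ := ⟨by simp, fun h => hb (h (Finset.mem_univ b))⟩
      have := Finset.card_lt_card this
      simpa [Finset.card_univ, Fintype.card_prod] using this
    have e0 : ∀ (q) (hq : q ∉ J) (σ : Equiv.Perm (ρ × κ)), (Set.InjOn (fun b => (σ b).2) ((insert q J : Finset (ρ × κ)) : Set (ρ × κ)) ∧ ∀ b ∈ insert q J, (σ b).2 ∉ D) ↔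
        (good σ ∧ (σ q).2 ∉ D ∪ J.image (fun b => (σ b).2)) := by
      intro q hq σ
      rw [Finset.coe_insert, Set.injOn_insert (by simpa using hq), Finset.forall_mem_insert]
      simp only [hgood, Finset.mem_union, Finset.mem_image, not_or, Set.mem_image, Finset.mem_coe]
      tauto
    have h1 : ∀ q ∉ J, 𝔼 σ : Equiv.Perm (ρ × κ), (if good σ ∧ (σ q).2 ∉ D ∪ J.image (fun b => (σ b).2) then (1:ℝ) else 0) =
       𝔼 σ : Equiv.Perm (ρ × κ), (if good σ ∧ (σ b).2 ∉ D ∪ J.image (fun b => (σ b).2) then (1:ℝ) else 0) := by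
      intro q hq
      rw [← expect_mul_right _ (Equiv.swap b q)]
      refine Finset.expect_congr rfl fun σ _ => ?_
      have hs : ∀ u ∈ J, (σ * Equiv.swap b q) u = σ u := by
        intro u hu
        rw [Equiv.Perm.mul_apply, Equiv.swap_apply_of_ne_of_ne]
        · rintro rfl; exact hb hu
        · rintro rfl; exact hq hu
      have g1 : good (σ * Equiv.swap b q) ↔ good σ := by
        simp only [hgood]
        refine and_congr ?_ (forall₂_congr fun u hu => by rw [hs u hu])
        exact Set.EqOn.injOn_iff (fun u hu => by simp only [hs u hu])
      have g2 : J.image (fun u => ((σ * Equiv.swap b q) u).2) = J.image (fun u => (σ u).2) :=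
        Finset.image_congr (fun u hu => by simp only [hs u hu])
      rw [g2]
      simp only [g1, Equiv.Perm.mul_apply, Equiv.swap_apply_right]
    have h2 : ∑ q ∈ Finset.univ \ J, 𝔼 σ : Equiv.Perm (ρ × κ), (if good σ ∧ (σ q).2 ∉ D ∪ J.image (fun b => (σ b).2) then (1:ℝ) else 0)
       = (Fintype.card ρ * (Fintype.card κ - D.card - J.card : ℕ)) * 𝔼 σ, (if good σ then (1:ℝ) else 0) := by
      rw [← Finset.expect_sum_comm, Finset.mul_expect]
      refine Finset.expect_congr rfl fun σ _ => ?_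
      by_cases hg : good σ
      · simp only [hg, true_and, if_true, mul_one]
        rw [Finset.sum_boole]
        norm_cast
        have : (Finset.univ \ J).filter (fun q => (σ q).2 ∉ D ∪ J.image (fun b => (σ b).2)) =
            ((Finset.univ : Finset ρ) ×ˢ (D ∪ J.image (fun b => (σ b).2))ᶜ).map (σ⁻¹ : Equiv.Perm (ρ × κ)).toEmbedding := by
          ext q
          rw [Finset.mem_map_equiv]
          simp only [Finset.mem_filter, Finset.mem_sdiff, Finset.mem_univ, true_and, Finset.mem_product, Finset.mem_compl]
          have : (Equiv.symm σ⁻¹) q = σ q := rfl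
          rw [this]
          constructor
          · exact fun h => h.2
          · intro h
            refine ⟨fun hq => h ?_, h⟩
            exact Finset.mem_union_right _ (Finset.mem_image_of_mem (fun b => (σ b).2) hq)
        rw [this, Finset.card_map, Finset.card_product, Finset.card_univ, Finset.card_compl, Finset.card_union_of_disjoint, Finset.card_image_of_injOn hg.1, Nat.sub_sub]
        rw [Finset.disjoint_right]
        intro c hc
        obtain ⟨u, hu, rfl⟩ := Finset.mem_image.1 hc
        exact hg.2 u hu
      · simp [hg]
    rw [Finset.sum_congr rfl (fun q hq => h1 q (by simpa using hq))] at h2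
    simp only [Finset.sum_const, nsmul_eq_mul] at h2
    rw [Finset.card_sdiff_of_subset (Finset.subset_univ _), Finset.card_univ, Fintype.card_prod, ← hN] at h2
    rw [show (fun σ : Equiv.Perm (ρ × κ) => if good σ then (1:ℝ) else 0) = fun σ => if good σ then (1:ℝ) else 0 from rfl, ih] at h2
    simp only [e0 b hb]
    rw [Finset.card_insert_of_notMem hb, Nat.descFactorial_succ, Nat.descFactorial_succ, pow_succ]
    have hd1 : ((N - J.card : ℕ) : ℝ) ≠ 0 := by
      have : N - J.card ≠ 0 := by omega
      exact_mod_cast this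
    have hd2 : ((N.descFactorial J.card : ℕ) : ℝ) ≠ 0 := by
      have : N.descFactorial J.card ≠ 0 := by
        rw [Ne, Nat.descFactorial_eq_zero_iff_lt]; omega
      exact_mod_cast this
    apply mul_left_cancel₀ hd1
    rw [h2]
    push_cast
    field_simp
end probs

set_option linter.all false
set_option linter.unusedSectionVars false
open scoped BigOperators

section kernel
variable {m : ℕ} {κ : Type} [Fintype κ] [DecidableEq κ]

def hH (m : ℕ) (κ : Type) [Fintype κ] [DecidableEq κ] : Equiv.Perm κ × Equiv.Perm (Fin m × κ) →* Equiv.Perm (Fin (m+1) × κ) :=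
  MonoidHom.noncommCoprod (rowH κ 0) (extH m κ) (fun τ σ => (ext_row0_comm σ τ).symm)

theorem hH_apply (τ : Equiv.Perm κ) (σ : Equiv.Perm (Fin m × κ)) : hH m κ (τ, σ) = rowH κ 0 τ * extH m κ σ := rfl

theorem eav_hH (g : Equiv.Perm (Fin (m+1) × κ) → ℝ) : eav (hH m κ) g = eav (extH m κ) (eav (rowH κ 0) g) := by
  funext x
  unfold eav
  rw [Finset.expect_comm, ← Finset.expect_product', Finset.univ_product_univ]
  refine Finset.expect_congr rfl ?_
  rintro ⟨τ, σ⟩ _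
  rw [hH_apply, mul_assoc, ext_row0_comm]

theorem hH_zero (τ : Equiv.Perm κ) (σ : Equiv.Perm (Fin m × κ)) (c : κ) : hH m κ (τ, σ) (0, c) = (0, τ c) := by
  rw [hH_apply, Equiv.Perm.mul_apply, extH_zero, row0_zero]
theorem hH_succ (τ : Equiv.Perm κ) (σ : Equiv.Perm (Fin m × κ)) (i : Fin m) (c : κ) :
    hH m κ (τ, σ) (i.succ, c) = ((σ (i, c)).1.succ, (σ (i, c)).2) := by
  rw [hH_apply, Equiv.Perm.mul_apply, extH_succ, row0_succ]

theorem hH_fst (t : Equiv.Perm κ × Equiv.Perm (Fin m × κ)) (p : Fin (m+1) × κ) : (hH m κ t p).1 = 0 ↔ p.1 = 0 := by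
  obtain ⟨τ, σ⟩ := t
  obtain ⟨i, c⟩ := p
  refine Fin.cases ?_ (fun i => ?_) i
  · rw [hH_zero]
  · rw [hH_succ]; simp

noncomputable def wI (I : Finset (Fin (m+1) × κ)) : Equiv.Perm (Fin (m+1) × κ) → ℝ :=
  fun x => if ∀ a ∈ I, (x⁻¹ a).1 = 0 then 1 else 0
noncomputable def trI (I : Finset (Fin (m+1) × κ)) : Equiv.Perm (Fin (m+1) × κ) → ℝ :=
  open Classical in fun x => if Set.InjOn (fun a => (x⁻¹ a).2) (I : Set (Fin (m+1) × κ)) then 1 else 0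

theorem wI_inv (I : Finset (Fin (m+1) × κ)) : Inva (hH m κ) (wI I) := by
  intro x t
  unfold wI
  simp only [mul_inv_rev, ← map_inv, Equiv.Perm.mul_apply, hH_fst]

theorem col_wI (I : Finset (Fin (m+1) × κ)) : eav (colH (Fin (m+1)) κ) (wI I) = ((1 / ((m:ℝ)+1)) ^ I.card) • trI I := by
  classical
  funext x
  unfold eav
  rw [← expect_inv]
  have : ∀ τ, wI I (x * colH (Fin (m+1)) κ τ⁻¹) = if ∀ a ∈ I, τ (x⁻¹ a).2 (x⁻¹ a).1 = 0 then 1 else 0 := by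
    intro τ
    simp only [wI, mul_inv_rev, map_inv, inv_inv, Equiv.Perm.mul_apply, colH_apply]
  simp only [this, Pi.smul_apply, trI]
  by_cases h : Set.InjOn (fun a => (x⁻¹ a).2) (I : Set (Fin (m+1) × κ))
  · have hp := expect_prod_ind (0 : Fin (m+1)) I (fun a => (x⁻¹ a).2) (fun a => (x⁻¹ a).1) h
    rw [if_pos h, smul_eq_mul, mul_one]
    simp only [Fintype.card_fin, Nat.cast_add, Nat.cast_one] at hp
    rw [← hp]
    refine Finset.expect_congr rfl fun τ _ => ?_
    congr
  · rw [if_neg h]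
    simp only [smul_zero]
    refine Finset.expect_eq_zero fun τ _ => ?_
    rw [if_neg]
    intro h2
    apply h
    intro a ha b hb hab
    have ha' := h2 a ha
    have hb' := h2 b hb
    simp only at hab
    rw [hab, ← hb'] at ha'
    exact x⁻¹.injective (Prod.ext ((τ _).injective ha') hab)

/-- number of elements of I in row zero -/
def cnt (I : Finset (Fin (m+1) × κ)) (x : Equiv.Perm (Fin (m+1) × κ)) : ℕ := (I.filter (fun a => (x⁻¹ a).1 = 0)).card

noncomputable def phi (k m j i : ℕ) : ℝ := (m:ℝ) ^ (j - i) * ((k - i).descFactorial (j - i) : ℝ) / ((m * k).descFactorial (j - i) : ℝ)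

theorem P_trI (I : Finset (Fin (m+1) × κ)) (x : Equiv.Perm (Fin (m+1) × κ)) :
    eav (hH m κ) (trI I) x = phi (Fintype.card κ) m I.card (cnt I x) := by
  classical
  unfold eav
  rw [← expect_inv]
  have e1 : ∀ t, trI I (x * hH m κ t⁻¹) = if Set.InjOn (fun a => (hH m κ t (x⁻¹ a)).2) (I : Set (Fin (m+1) × κ)) then 1 else 0 := by
    intro t
    unfold trI
    simp only [mul_inv_rev, map_inv, inv_inv, Equiv.Perm.mul_apply]
  simp only [e1]
  rw [← Finset.univ_product_univ, Finset.expect_product]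
  let C : Finset κ := Finset.univ.filter (fun c => x (0, c) ∈ I)
  let J : Finset (Fin m × κ) := Finset.univ.filter (fun b => x (b.1.succ, b.2) ∈ I)
  have hC : C.card = cnt I x := by
    unfold cnt
    refine Finset.card_bij (fun c _ => x (0, c)) ?_ ?_ ?_
    · intro c hc
      simp only [C, Finset.mem_filter, Finset.mem_univ, true_and] at hc
      simp [hc]
    · intro a _ b _ h
      simpa using x.injective h
    · intro a ha
      simp only [Finset.mem_filter] at ha
      have : x (0, (x⁻¹ a).2) = a := by
        rw [← ha.2]; exact x.apply_symm_apply a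
      exact ⟨(x⁻¹ a).2, by simp only [C, Finset.mem_filter, Finset.mem_univ, true_and, this]; exact ha.1, this⟩
  have hJ : J.card = I.card - cnt I x := by
    have : J.card = (I.filter (fun a => ¬ (x⁻¹ a).1 = 0)).card := by
      refine Finset.card_bij (fun b _ => x (b.1.succ, b.2)) ?_ ?_ ?_
      · intro c hc
        simp only [J, Finset.mem_filter, Finset.mem_univ, true_and] at hc
        simp [hc]
      · intro a _ b _ h
        have := x.injective h
        simp only [Prod.mk.injEq, Fin.succ_inj] at this
        exact Prod.ext this.1 this.2
      · intro a ha
        simp only [Finset.mem_filter] at ha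
        obtain ⟨i, hi⟩ := Fin.exists_succ_eq.2 ha.2
        have : x (i.succ, (x⁻¹ a).2) = a := by
          rw [hi]; exact x.apply_symm_apply a
        exact ⟨(i, (x⁻¹ a).2), by simp only [J, Finset.mem_filter, Finset.mem_univ, true_and, this]; exact ha.1, this⟩
    rw [this]
    have := Finset.card_filter_add_card_filter_not (s := I) (fun a => (x⁻¹ a).1 = 0)
    unfold cnt
    omega
  have key : ∀ τ σ, Set.InjOn (fun a => (hH m κ (τ, σ) (x⁻¹ a)).2) (I : Set (Fin (m+1) × κ)) ↔
      (Set.InjOn (fun b => (σ b).2) (J : Set (Fin m × κ)) ∧ ∀ b ∈ J, (σ b).2 ∉ C.map τ.toEmbedding) := by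
    intro τ σ
    have hx : ∀ p, x⁻¹ (x p) = p := x.symm_apply_apply
    constructor
    · intro h
      refine ⟨?_, ?_⟩
      · intro b hb b' hb' hbb
        simp only [J, Finset.coe_filter, Finset.mem_univ, true_and, Set.mem_setOf_eq] at hb hb'
        have := h hb hb' (by simp only [hx, hH_succ]; exact hbb)
        have := x.injective this
        simp only [Prod.mk.injEq, Fin.succ_inj] at this
        exact Prod.ext this.1 this.2
      · intro b hb hbC
        rw [Finset.mem_map] at hbC
        obtain ⟨c, hc, hcb⟩ := hbC
        simp only [C, J, Finset.mem_filter, Finset.mem_univ, true_and] at hc hb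
        have := h hc hb (by simp only [hx, hH_succ, hH_zero]; exact hcb)
        have := x.injective this
        simp only [Prod.mk.injEq] at this
        exact (Fin.succ_ne_zero _ this.1.symm).elim
    · rintro ⟨h1, h2⟩
      have : ∀ p q : Fin (m+1) × κ, x p ∈ I → x q ∈ I → (hH m κ (τ, σ) p).2 = (hH m κ (τ, σ) q).2 → p = q := by
        rintro ⟨i, c⟩ ⟨j, d⟩
        refine Fin.cases ?_ (fun i => ?_) i <;> refine Fin.cases ?_ (fun j => ?_) j
        · intro _ _ h
          rw [hH_zero, hH_zero] at h
          rw [τ.injective h]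
        · intro hp hq h
          rw [hH_zero, hH_succ] at h
          exact (h2 (j, d) (by simpa [J] using hq) (Finset.mem_map.2 ⟨c, by simpa [C] using hp, h⟩)).elim
        · intro hp hq h
          rw [hH_zero, hH_succ] at h
          exact (h2 (i, c) (by simpa [J] using hp) (Finset.mem_map.2 ⟨d, by simpa [C] using hq, h.symm⟩)).elim
        · intro hp hq h
          rw [hH_succ, hH_succ] at h
          have := h1 (show (i, c) ∈ (J : Set _) by simpa [J] using hp) (show (j, d) ∈ (J : Set _) by simpa [J] using hq) h
          simp only [Prod.mk.injEq] at this
          rw [this.1, this.2]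
      intro a ha b hb hab
      have hx' : ∀ p, x (x⁻¹ p) = p := x.apply_symm_apply
      have := this (x⁻¹ a) (x⁻¹ b) (by rw [hx']; exact ha) (by rw [hx']; exact hb) hab
      exact x⁻¹.injective this
  simp only [key]
  have tp : ∀ τ : Equiv.Perm κ, _ := fun τ => trans_prob (C.map τ.toEmbedding) J
  simp only [Finset.card_map, hC, hJ, Fintype.card_fin] at tp
  rw [Finset.expect_congr rfl (fun τ _ => tp τ)]
  rw [Fintype.expect_const]
  rfl

theorem wI_filter (I : Finset (Fin (m+1) × κ)) (x : Equiv.Perm (Fin (m+1) × κ)) (t : ℕ) :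
    ∑ I' ∈ I.powersetCard t, wI I' x = ((cnt I x).choose t : ℝ) := by
  unfold wI cnt
  rw [Finset.sum_boole, ← Finset.card_powersetCard]
  congr 2
  ext S
  simp only [Finset.mem_filter, Finset.mem_powersetCard, Finset.subset_iff]
  constructor
  · rintro ⟨⟨h1, h2⟩, h3⟩
    exact ⟨fun a ha => ⟨h1 ha, h3 a ha⟩, h2⟩
  · rintro ⟨h1, h2⟩
    exact ⟨⟨fun a ha => (h1 ha).1, h2⟩, fun a ha => (h1 ha).2⟩

theorem P_trI_sum (I : Finset (Fin (m+1) × κ)) :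
    eav (hH m κ) (trI I) = ∑ t ∈ Finset.range (I.card + 1), ∑ I' ∈ I.powersetCard t,
      ((fwdDiff 1)^[t] (phi (Fintype.card κ) m I.card) 0) • wI I' := by
  funext x
  rw [P_trI]
  simp only [Finset.sum_apply, Pi.smul_apply, smul_eq_mul]
  simp only [← Finset.mul_sum, wI_filter]
  have := shift_eq_sum_fwdDiff_iter 1 (phi (Fintype.card κ) m I.card) (cnt I x) 0
  simp only [nsmul_eq_mul, Nat.cast_id, mul_one, zero_add] at this
  rw [this]
  have hle : cnt I x ≤ I.card := Finset.card_filter_le _ _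
  rw [Finset.sum_subset (s₁ := Finset.range (cnt I x + 1)) (s₂ := Finset.range (I.card + 1))]
  · exact Finset.sum_congr rfl fun t _ => mul_comm _ _
  · intro t ht; simp at ht ⊢; omega
  · intro t _ ht
    rw [Nat.choose_eq_zero_of_lt (by simp at ht; omega)]; simp

theorem Qe_eq (k m j : ℕ) (hj : j ≤ k) : (1 / ((m:ℝ)+1)) ^ j * (fwdDiff 1)^[j] (phi k m j) 0 = Qe k m j := by
  rw [fwdDiff_iter_eq_sum_shift]
  unfold Qe
  have hdeg : (evP k (m*k) j).natDegree < j + 1 := by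
    rw [Nat.lt_succ_iff, Polynomial.natDegree_le_iff_coeff_eq_zero]
    intro s hs
    rw [evP_coeff, Nat.choose_eq_zero_of_lt hs]; simp
  rw [Polynomial.eval_eq_sum_range' hdeg, div_pow, one_pow, one_div, inv_mul_eq_div]
  congr 1
  rw [← Finset.sum_range_reflect]
  refine Finset.sum_congr rfl fun s hs => ?_
  rw [Finset.mem_range] at hs
  have h1 : j + 1 - 1 - s = j - s := by omega
  rw [evP_coeff, h1]
  unfold phi
  have h2 : j - (j - s) = s := by omega
  have h3 : k - (j - s) = k - j + s := by omega
  simp only [zero_add, smul_eq_mul, mul_one, zsmul_eq_mul]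
  rw [h2, h3, neg_pow, Nat.choose_symm (by omega : s ≤ j)]
  push_cast
  ring

theorem W_kernel (h : Equiv.Perm (Fin (m+1) × κ) → ℝ) (hh : Inva (hH m κ) h) (I : Finset (Fin (m+1) × κ))
    (hI : I.card ≤ Fintype.card κ) (hz : ∀ I' : Finset (Fin (m+1) × κ), I'.card < I.card → ip h (wI I') = 0) :
    ip (eav (hH m κ) (eav (colH (Fin (m+1)) κ) h)) (wI I) = Qe (Fintype.card κ) m I.card * ip h (wI I) := by
  have sumr : ∀ (s : Finset ℕ) (T : ℕ → Finset (Finset (Fin (m+1) × κ))) (F : ℕ → Finset (Fin (m+1) × κ) → Equiv.Perm (Fin (m+1) × κ) → ℝ),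
      ip h (∑ t ∈ s, ∑ J ∈ T t, F t J) = ∑ t ∈ s, ∑ J ∈ T t, ip h (F t J) := by
    intro s T F
    unfold ip
    simp only [Finset.sum_apply, Finset.mul_sum]
    rw [Finset.expect_sum_comm]
    refine Finset.sum_congr rfl fun t _ => ?_
    rw [Finset.expect_sum_comm]
  rw [ip_eav, eav_of_inv _ (wI_inv I), ip_eav, col_wI, ip_smul_right, ← ip_inv_left (hH m κ) hh, P_trI_sum, sumr]
  rw [Finset.sum_range_succ, Finset.sum_eq_zero, zero_add]
  · rw [Finset.powersetCard_self, Finset.sum_singleton, ip_smul_right, ← mul_assoc, Qe_eq _ _ _ hI]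
  · intro t ht
    apply Finset.sum_eq_zero
    intro J hJ
    rw [Finset.mem_powersetCard] at hJ
    rw [ip_smul_right, hz J (by rw [hJ.2]; simpa using ht), mul_zero]

theorem hH_surj (y : Equiv.Perm (Fin (m+1) × κ)) (hy : ∀ c, (y (0, c)).1 = 0) : ∃ t, hH m κ t = y := by
  have hy0 : ∀ c, y (0, c) = (0, (y (0, c)).2) := fun c => Prod.ext (hy c) rfl
  have i1 : Function.Injective (fun c => (y (0, c)).2) := by
    intro c d h
    have : y (0, c) = y (0, d) := by rw [hy0 c, hy0 d]; simp only at h; rw [h]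
    simpa using y.injective this
  let τ : Equiv.Perm κ := Equiv.ofBijective _ (Finite.injective_iff_bijective.1 i1)
  have hne : ∀ (i : Fin m) c, (y (i.succ, c)).1 ≠ 0 := by
    intro i c h
    obtain ⟨d, hd⟩ := (Finite.injective_iff_surjective.1 i1) (y (i.succ, c)).2
    have : y (i.succ, c) = y (0, d) := by
      rw [hy0 d]; exact Prod.ext h hd.symm
    have := y.injective this
    simp at this
  let f : Fin m × κ → Fin m × κ := fun b => ((y (b.1.succ, b.2)).1.pred (hne b.1 b.2), (y (b.1.succ, b.2)).2)
  have i2 : Function.Injective f := by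
    rintro ⟨i, c⟩ ⟨j, d⟩ h
    simp only [f, Prod.mk.injEq, Fin.pred_inj] at h
    have := y.injective (Prod.ext h.1 h.2)
    simpa using this
  let σ : Equiv.Perm (Fin m × κ) := Equiv.ofBijective f (Finite.injective_iff_bijective.1 i2)
  refine ⟨(τ, σ), ?_⟩
  apply perm_ext_fin
  · intro c; rw [hH_zero, hy0 c]; rfl
  · intro i c
    rw [hH_succ]
    apply Prod.ext
    · show ((y (i.succ, c)).1.pred (hne i c)).succ = _
      rw [Fin.succ_pred]
    · rfl

theorem W_full (h : Equiv.Perm (Fin (m+1) × κ) → ℝ) (hh : Inva (hH m κ) h) (x : Equiv.Perm (Fin (m+1) × κ)) (hx : h x ≠ 0) :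
    ∃ I : Finset (Fin (m+1) × κ), I.card = Fintype.card κ ∧ ip h (wI I) ≠ 0 := by
  refine ⟨Finset.univ.map ⟨fun c => x (0, c), fun c d h => by simpa using x.injective h⟩, by simp, ?_⟩
  set I := (Finset.univ : Finset κ).map ⟨fun c => x (0, c), fun c d h => by simpa using x.injective h⟩ with hI
  have e : ip h (wI I) = ip (fun _ => h x) (wI I) := by
    unfold ip
    refine Finset.expect_congr rfl fun y _ => ?_
    unfold wI
    by_cases hy : ∀ a ∈ I, (y⁻¹ a).1 = 0
    · obtain ⟨t, ht⟩ := hH_surj (y⁻¹ * x) (fun c => by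
        rw [Equiv.Perm.mul_apply]
        exact hy _ (Finset.mem_map.2 ⟨c, Finset.mem_univ c, rfl⟩))
      have : x = y * hH m κ t := by rw [ht]; group
      rw [this, hh]
    · rw [if_neg hy]; simp
  rw [e]
  unfold ip
  rw [← Finset.mul_expect]
  refine mul_ne_zero hx (ne_of_gt ?_)
  refine Finset.expect_pos' (fun y _ => ?_) ⟨x, Finset.mem_univ x, ?_⟩
  · unfold wI; positivity
  · unfold wI
    rw [if_pos]
    · norm_num
    · intro a ha
      rw [Finset.mem_map] at ha
      obtain ⟨c, _, rfl⟩ := ha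
      show (x⁻¹ (x (0, c))).1 = 0
      have : x⁻¹ (x (0, c)) = (0, c) := x.symm_apply_apply _
      rw [this]
end kernel

set_option linter.all false
set_option linter.unusedSectionVars false
open scoped BigOperators

section bound
variable {m : ℕ} {κ : Type} [Fintype κ] [DecidableEq κ]

noncomputable def eavL {X H : Type*} [Group X] [Fintype X] [Group H] [Fintype H] (φ : H →* X) : (X → ℝ) →ₗ[ℝ] (X → ℝ) where
  toFun := eav φ
  map_add' := eav_add φ
  map_smul' := eav_smul φ

def Usub (m : ℕ) (κ : Type) [Fintype κ] [DecidableEq κ] : Submodule ℝ (Equiv.Perm (Fin (m+1) × κ) → ℝ) where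
  carrier := {h | Inva (hH m κ) h ∧ ∀ I : Finset (Fin (m+1) × κ), I.card ≤ 2 → ip h (wI I) = 0}
  add_mem' := by
    rintro a b ⟨a1, a2⟩ ⟨b1, b2⟩
    refine ⟨fun x t => ?_, fun I hI => ?_⟩
    · simp only [Pi.add_apply]; rw [a1, b1]
    · rw [ip_add_left, a2 I hI, b2 I hI, add_zero]
  zero_mem' := ⟨fun _ _ => rfl, fun I _ => by simp [ip]⟩
  smul_mem' := by
    rintro c a ⟨a1, a2⟩
    refine ⟨fun x t => ?_, fun I hI => ?_⟩
    · simp only [Pi.smul_apply]; rw [a1]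
    · rw [ip_smul_left, a2 I hI, mul_zero]

theorem kernel_bound (hm : 1 ≤ m) (hk : 2 ≤ Fintype.card κ) (hmk : m + 1 ≤ Fintype.card κ)
    (G : Equiv.Perm (Fin (m+1) × κ) → ℝ) (hG : G ∈ Usub m κ) :
    ip G (eav (colH (Fin (m+1)) κ) G) ≤ epsE (Fintype.card κ) m * ip G G := by
  have := rayleigh_bound ((eavL (hH m κ)).comp (eavL (colH (Fin (m+1)) κ))) (Usub m κ) ?_ ?_ (epsE (Fintype.card κ) m) ?_ G hG
  · rw [← ip_inv_left (hH m κ) hG.1]; exact this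
  · rintro f ⟨f1, f2⟩
    refine ⟨eav_inv _ _, fun I hI => ?_⟩
    have := W_kernel f f1 I (by omega) (fun I' hI' => f2 I' (by omega))
    rw [f2 I hI, mul_zero] at this
    exact this
  · rintro f ⟨f1, f2⟩ g ⟨g1, g2⟩
    show ip (eav (hH m κ) (eav (colH (Fin (m+1)) κ) f)) g = ip f (eav (hH m κ) (eav (colH (Fin (m+1)) κ) g))
    rw [ip_eav, eav_of_inv _ g1, ip_eav, ip_inv_left _ f1]
  · rintro h ⟨h1, h2⟩ hne μ hμ
    obtain ⟨x, hx⟩ := Function.ne_iff.1 hne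
    obtain ⟨I0, hI0, hW0⟩ := W_full h h1 x hx
    have hex : ∃ j, ∃ I : Finset (Fin (m+1) × κ), I.card = j ∧ ip h (wI I) ≠ 0 := ⟨_, I0, rfl, hW0⟩
    classical
    obtain ⟨I, hI, hW⟩ := Nat.find_spec hex
    have hmin := fun j (hj : j < Nat.find hex) => Nat.find_min hex hj
    have hle : Nat.find hex ≤ Fintype.card κ := Nat.find_min' hex ⟨I0, hI0, hW0⟩
    have h3 : 3 ≤ I.card := by
      by_contra hc
      exact hW (h2 I (by omega))
    have hk' := W_kernel h h1 I (by omega) (fun I' hI' => by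
      by_contra hc
      exact hmin I'.card (by omega) ⟨I', rfl, hc⟩)
    have hμ' : eav (hH m κ) (eav (colH (Fin (m+1)) κ) h) = μ • h := hμ
    rw [hμ', ip_smul_left] at hk'
    rw [mul_right_cancel₀ hW hk']
    exact Qe_le _ _ hk hm hmk _ h3 (by omega)

theorem G_mem (g : Equiv.Perm (Fin (m+1) × κ) → ℝ) (hc : Inva (colH (Fin (m+1)) κ) g) (h0 : 𝔼 x, g x = 0)
    (hf : ∀ a b, a ≠ b → ip g (fcol a b) = 0) : eav (hH m κ) g ∈ Usub m κ := by
  refine ⟨eav_inv _ _, fun I hI => ?_⟩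
  rw [ip_eav, eav_of_inv _ (wI_inv I), ← ip_inv_left _ hc, col_wI, ip_smul_right]
  have h1 : ip g (fun _ => 1) = 0 := by rw [ip_const, h0, mul_zero]
  have : ip g (trI I) = 0 := by
    have hcases : I.card = 0 ∨ I.card = 1 ∨ I.card = 2 := by omega
    rcases hcases with h | h | h
    · rw [Finset.card_eq_zero] at h
      subst h
      convert h1 using 2
      funext x; simp [trI]
    · rw [Finset.card_eq_one] at h
      obtain ⟨a, rfl⟩ := h
      convert h1 using 2
      funext x; simp [trI]
    · rw [Finset.card_eq_two] at h
      obtain ⟨a, b, hab, rfl⟩ := h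
      have : trI {a, b} = (fun _ => (1:ℝ)) - fcol a b := by
        funext x
        simp only [trI, fcol, Pi.sub_apply]
        by_cases he : (x⁻¹ a).2 = (x⁻¹ b).2
        · rw [if_neg, if_pos he]; · norm_num
          intro hi
          exact hab (hi (by simp) (by simp) he)
        · rw [if_pos, if_neg he]; · norm_num
          intro u hu v hv huv
          simp only [Finset.coe_insert, Finset.coe_singleton, Set.mem_insert_iff, Set.mem_singleton_iff] at hu hv
          rcases hu with rfl | rfl <;> rcases hv with rfl | rfl
          · rfl
          · exact (he huv).elim
          · exact (he huv.symm).elim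
          · rfl
      rw [this, ip_sub_right, h1, hf a b hab, sub_zero]
  rw [this, mul_zero]

theorem epsE_nonneg (k m : ℕ) (hm : 1 ≤ m) (hk : 2 ≤ k) : 0 ≤ epsE k m := by
  unfold epsE
  have hm' : (1:ℝ) ≤ m := by exact_mod_cast hm
  have hk' : (2:ℝ) ≤ k := by exact_mod_cast hk
  have : (0:ℝ) ≤ m * k - 1 := by nlinarith
  have : (0:ℝ) ≤ k - 1 := by linarith
  positivity

theorem G_bound (hm : 1 ≤ m) (hk : 2 ≤ Fintype.card κ) (hmk : m + 1 ≤ Fintype.card κ)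
    (g : Equiv.Perm (Fin (m+1) × κ) → ℝ) (hc : Inva (colH (Fin (m+1)) κ) g) (h0 : 𝔼 x, g x = 0)
    (hf : ∀ a b, a ≠ b → ip g (fcol a b) = 0) (G) (hG : G = eav (hH m κ) g) :
    ip G G ≤ epsE (Fintype.card κ) m * ip g g := by
  have hU : G ∈ Usub m κ := hG ▸ G_mem g hc h0 hf
  have kb := kernel_bound hm hk hmk G hU
  have e1 : ip G G = ip g (eav (colH (Fin (m+1)) κ) G) := by
    rw [ip_inv_left _ hc]
    conv_lhs => rw [hG]
    rw [ip_eav_eav, ← hG]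
  have cs := ip_cs g (eav (colH (Fin (m+1)) κ) G)
  rw [← e1, ip_eav_eav] at cs
  have hg := ip_self_nonneg g
  have he := epsE_nonneg (Fintype.card κ) m hm hk
  rcases (ip_self_nonneg G).eq_or_lt with h | h
  · rw [← h]; positivity
  · have : ip G G ^ 2 ≤ (epsE (Fintype.card κ) m * ip g g) * ip G G := by
      calc _ ≤ _ := cs
        _ ≤ ip g g * (epsE (Fintype.card κ) m * ip G G) := by gcongr
        _ = _ := by ring
    rw [sq] at this
    exact le_of_mul_le_mul_right this h

theorem claim_one : ClaimA 1 κ := by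
  intro g hc hd h0
  have hg : ∀ x, g x = g 1 := by
    intro x
    have i1 : Function.Injective (fun c => (x (0, c)).2) := by
      intro c d h
      have : x (0, c) = x (0, d) := Prod.ext (Subsingleton.elim _ _) h
      simpa using x.injective this
    let τ : Equiv.Perm κ := Equiv.ofBijective _ (Finite.injective_iff_bijective.1 i1)
    rw [← hd 1 τ, one_mul]
    congr 1
    apply Equiv.ext
    rintro ⟨i, c⟩
    have : i = 0 := Subsingleton.elim _ _
    subst this
    exact Prod.ext (Subsingleton.elim _ _) rfl
  have : g = fun _ => 0 := by
    funext x
    rw [hg x]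
    rw [Finset.expect_congr rfl (fun x _ => hg x), Fintype.expect_const] at h0
    exact h0
  rw [this, eav_const]
  simp [ip]

theorem claim_step (hm : 1 ≤ m) (hk : 2 ≤ Fintype.card κ) (hmk : m + 1 ≤ Fintype.card κ) (hA : ClaimA m κ) : ClaimA (m+1) κ := by
  apply claim_reduce (m+1) (by omega) (by omega)
  intro g hc hd h0 hf
  have h1 := garland hA g hc hd _ _ _ rfl rfl rfl
  have h2 := efron_step g hc hd _ _ rfl rfl
  have h3 := G_bound hm hk hmk g hc h0 hf _ rfl
  rw [eav_hH] at h3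
  generalize ip (eav (extH m κ) (eav (rowH κ 0) g)) (eav (extH m κ) (eav (rowH κ 0) g)) = γ at *
  generalize ip (eav (fibH (Fin (m+1)) κ) g) (eav (fibH (Fin (m+1)) κ) g) = t at *
  generalize ip (eav (rowH κ 0) g) (eav (rowH κ 0) g) = b at *
  have ha := ip_self_nonneg g
  generalize ip g g = a at *
  have hm' : (1:ℝ) ≤ m := by exact_mod_cast hm
  have hk' : (2:ℝ) ≤ (Fintype.card κ : ℝ) := by exact_mod_cast hk
  push_cast
  unfold epsE at h3
  generalize (Fintype.card κ : ℝ) = k at *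
  generalize (m : ℝ) = M at *
  have hMk : 0 < M * k - 1 := by nlinarith
  have h4 : (M + 1) * k * M * ((M * k - 1) * γ) ≤ (k - 1) * a := by
    have : γ * ((M+1) * k * M * (M * k - 1)) ≤ (k - 1) * a := by
      have hpos : 0 < (M+1) * k * M * (M * k - 1) := by positivity
      calc _ ≤ ((k - 1) / ((M+1) * k * M * (M * k - 1)) * a) * ((M+1) * k * M * (M * k - 1)) := by gcongr
        _ = _ := by rw [div_mul_eq_mul_div, div_mul_cancel₀ _ hpos.ne']
    linarith
  have h5 : M * (M * k * t) ≤ M * a - a + t + M * ((M * k - 1) * γ) := by nlinarith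
  have h6 : ((M + 1) * k) * (t * (M ^ 2 * k - 1)) ≤ a * (M^2 * k - 1) := by
    have : (M+1)*k * (M * (M * k * t)) ≤ (M+1)*k * (M * a - a + t + M * ((M * k - 1) * γ)) := by gcongr
    nlinarith
  have h7 : 0 < M^2 * k - 1 := by nlinarith
  have : ((M + 1) * k * t) * (M ^ 2 * k - 1) ≤ a * (M^2 * k - 1) := by linarith
  exact le_of_mul_le_mul_right this h7

theorem claim_all (hk : 2 ≤ Fintype.card κ) (m : ℕ) (hm : 1 ≤ m) (hmk : m ≤ Fintype.card κ) : ClaimA m κ := by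
  induction m, hm using Nat.le_induction with
  | base => exact claim_one
  | succ m hm ih => exact claim_step hm hk hmk (ih (by omega))
end bound

set_option linter.all false
set_option linter.unusedSectionVars false
open scoped BigOperators

section fam

def Fam {γ : Type} [DecidableEq γ] (s : Finset γ) (k : ℕ) : Set (Finset (Finset γ)) :=
  {F | (∀ A ∈ F, ∀ B ∈ F, ∀ x, x ∈ A → x ∈ B → A = B) ∧ (∀ x, x ∈ s ↔ ∃ A ∈ F, x ∈ A) ∧ ∀ A ∈ F, A.card = k}

theorem parts_mem_Fam {γ : Type} [DecidableEq γ] {s : Finset γ} {k : ℕ} (P : Finpartition s) (hP : ∀ A ∈ P.parts, A.card = k) :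
    P.parts ∈ Fam s k := by
  refine ⟨fun A hA B hB x hx hx' => P.eq_of_mem_parts hA hB hx hx', fun x => ?_, hP⟩
  constructor
  · intro hx; exact P.exists_mem hx
  · rintro ⟨A, hA, hx⟩; exact P.le hA hx

theorem Fam_exists {γ : Type} [DecidableEq γ] {s : Finset γ} {k : ℕ} (hk : 1 ≤ k) (F : Finset (Finset γ)) (hF : F ∈ Fam s k) :
    ∃ P : Finpartition s, P.parts = F := by
  obtain ⟨h1, h2, h3⟩ := hF
  refine ⟨⟨F, ?_, ?_, ?_⟩, rfl⟩
  · rw [Finset.supIndep_iff_pairwiseDisjoint]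
    intro A hA B hB hAB
    show Disjoint A B
    rw [Finset.disjoint_left]
    intro x hx hx'
    exact hAB (h1 A hA B hB x hx hx')
  · ext x
    rw [Finset.mem_sup, h2]; rfl
  · intro h
    have := h3 _ h
    simp at this
    omega

theorem card_Fam {γ : Type} [DecidableEq γ] {s : Finset γ} {k : ℕ} (hk : 1 ≤ k) :
    Nat.card {P : Finpartition s // ∀ A ∈ P.parts, A.card = k} = (Fam s k).ncard := by
  rw [← Nat.card_coe_set_eq]
  refine Nat.card_congr (Equiv.ofBijective (fun P => ⟨P.1.parts, parts_mem_Fam P.1 P.2⟩) ⟨?_, ?_⟩)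
  · intro P Q h
    exact Subtype.ext (Finpartition.ext (congrArg Subtype.val h))
  · rintro ⟨F, hF⟩
    obtain ⟨P, hP⟩ := Fam_exists hk F hF
    exact ⟨⟨P, by rw [hP]; exact hF.2.2⟩, Subtype.ext hP⟩

theorem Fam_map {γ γ' : Type} [DecidableEq γ] [DecidableEq γ'] [Fintype γ'] (j : γ' ↪ γ) (k : ℕ) :
    (Fam (Finset.univ : Finset γ') k).ncard = (Fam (Finset.univ.map j) k).ncard := by
  refine Set.ncard_congr (fun F _ => F.map ⟨Finset.map j, Finset.map_injective j⟩) ?_ ?_ ?_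
  · rintro F ⟨h1, h2, h3⟩
    refine ⟨?_, ?_, ?_⟩
    · intro A hA B hB x hx hx'
      simp only [Finset.mem_map, Function.Embedding.coeFn_mk] at hA hB
      obtain ⟨A, hA, rfl⟩ := hA
      obtain ⟨B, hB, rfl⟩ := hB
      rw [Finset.mem_map] at hx hx'
      obtain ⟨y, hy, rfl⟩ := hx
      obtain ⟨z, hz, hzy⟩ := hx'
      have := j.injective hzy
      subst this
      rw [h1 A hA B hB z hy hz]
    · intro x
      simp only [Finset.mem_map, Function.Embedding.coeFn_mk, Finset.mem_univ, true_and]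
      constructor
      · rintro ⟨y, rfl⟩
        obtain ⟨A, hA, hy⟩ := (h2 y).1 (Finset.mem_univ y)
        exact ⟨_, ⟨A, hA, rfl⟩, Finset.mem_map_of_mem j hy⟩
      · rintro ⟨_, ⟨A, hA, rfl⟩, hx⟩
        obtain ⟨y, _, rfl⟩ := Finset.mem_map.1 hx
        exact ⟨y, rfl⟩
    · intro A hA
      simp only [Finset.mem_map, Function.Embedding.coeFn_mk] at hA
      obtain ⟨A, hA, rfl⟩ := hA
      rw [Finset.card_map, h3 A hA]
  · intro F F' _ _ h
    exact Finset.map_injective _ h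
  · rintro F ⟨h1, h2, h3⟩
    have hsub : ∀ A ∈ F, (A.preimage j j.injective.injOn).map j = A := by
      intro A hA
      ext x
      simp only [Finset.mem_map, Finset.mem_preimage]
      constructor
      · rintro ⟨y, hy, rfl⟩; exact hy
      · intro hx
        obtain ⟨y, _, rfl⟩ := Finset.mem_map.1 ((h2 x).2 ⟨A, hA, hx⟩)
        exact ⟨y, hx, rfl⟩
    refine ⟨F.image (fun A => A.preimage j j.injective.injOn), ⟨?_, ?_, ?_⟩, ?_⟩
    · intro A hA B hB x hx hx'
      simp only [Finset.mem_image] at hA hB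
      obtain ⟨A, hA, rfl⟩ := hA
      obtain ⟨B, hB, rfl⟩ := hB
      rw [Finset.mem_preimage] at hx hx'
      have := h1 A hA B hB _ hx hx'
      subst this; rfl
    · intro x
      simp only [Finset.mem_univ, true_iff, Finset.mem_image]
      obtain ⟨A, hA, hx⟩ := (h2 (j x)).1 (Finset.mem_map_of_mem j (Finset.mem_univ x))
      exact ⟨_, ⟨A, hA, rfl⟩, by rw [Finset.mem_preimage]; exact hx⟩
    · intro A hA
      simp only [Finset.mem_image] at hA
      obtain ⟨A, hA, rfl⟩ := hA
      rw [← Finset.card_map j, hsub A hA, h3 A hA]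
    · ext A
      simp only [Finset.mem_map, Finset.mem_image, Function.Embedding.coeFn_mk]
      constructor
      · rintro ⟨_, ⟨B, hB, rfl⟩, rfl⟩
        rw [hsub B hB]; exact hB
      · intro hA
        exact ⟨_, ⟨A, hA, rfl⟩, hsub A hA⟩

theorem Fam_erase {γ : Type} [DecidableEq γ] [Fintype γ] (A : Finset γ) (k : ℕ) (hA : A.card = k) (hk : 1 ≤ k) :
    {F | F ∈ Fam (Finset.univ : Finset γ) k ∧ A ∈ F}.ncard = (Fam Aᶜ k).ncard := by
  have hne : A.Nonempty := by rw [← Finset.card_pos]; omega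
  refine Set.ncard_congr (fun F _ => F.erase A) ?_ ?_ ?_
  · rintro F ⟨⟨h1, h2, h3⟩, hAF⟩
    refine ⟨?_, ?_, ?_⟩
    · intro B hB C hC
      exact h1 B (Finset.mem_of_mem_erase hB) C (Finset.mem_of_mem_erase hC)
    · intro x
      rw [Finset.mem_compl]
      constructor
      · intro hx
        obtain ⟨B, hB, hxB⟩ := (h2 x).1 (Finset.mem_univ x)
        refine ⟨B, Finset.mem_erase.2 ⟨?_, hB⟩, hxB⟩
        rintro rfl; exact hx hxB
      · rintro ⟨B, hB, hxB⟩ hxA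
        rw [Finset.mem_erase] at hB
        exact hB.1 (h1 B hB.2 A hAF x hxB hxA)
    · intro B hB
      exact h3 B (Finset.mem_of_mem_erase hB)
  · rintro F F' ⟨_, hF⟩ ⟨_, hF'⟩ h
    rw [← Finset.insert_erase hF, h, Finset.insert_erase hF']
  · rintro F ⟨h1, h2, h3⟩
    have hAF : A ∉ F := by
      intro h
      obtain ⟨x, hx⟩ := hne
      have := (h2 x).2 ⟨A, h, hx⟩
      rw [Finset.mem_compl] at this
      exact this hx
    have hdis : ∀ B ∈ F, ∀ x ∈ B, x ∉ A := fun B hB x hx => Finset.mem_compl.1 ((h2 x).2 ⟨B, hB, hx⟩)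
    refine ⟨insert A F, ⟨⟨?_, ?_, ?_⟩, Finset.mem_insert_self _ _⟩, Finset.erase_insert hAF⟩
    · intro B hB C hC x hx hx'
      rw [Finset.mem_insert] at hB hC
      rcases hB with rfl | hB <;> rcases hC with rfl | hC
      · rfl
      · exact (hdis C hC x hx' hx).elim
      · exact (hdis B hB x hx hx').elim
      · exact h1 B hB C hC x hx hx'
    · intro x
      simp only [Finset.mem_univ, true_iff]
      by_cases hx : x ∈ A
      · exact ⟨A, Finset.mem_insert_self _ _, hx⟩
      · obtain ⟨B, hB, hxB⟩ := (h2 x).1 (Finset.mem_compl.2 hx)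
        exact ⟨B, Finset.mem_insert_of_mem hB, hxB⟩
    · intro B hB
      rw [Finset.mem_insert] at hB
      rcases hB with rfl | hB
      · exact hA
      · exact h3 B hB

theorem Fam_compl {n : ℕ} (A : Finset (Fin n)) (k : ℕ) (hA : A.card = k) (hk : 1 ≤ k) :
    (Fam Aᶜ k).ncard = uniformCount (n - k) k := by
  have hc : Aᶜ.card = n - k := by rw [Finset.card_compl, hA, Fintype.card_fin]
  unfold uniformCount
  rw [card_Fam hk, Fam_map (Aᶜ.orderEmbOfFin hc).toEmbedding k]
  congr 2
  ext x
  rw [Finset.mem_map]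
  have := Finset.range_orderEmbOfFin Aᶜ hc
  have h2 : x ∈ Set.range (Aᶜ.orderEmbOfFin hc) ↔ x ∈ (Aᶜ : Finset (Fin n)) := by rw [this]; simp
  rw [← h2]
  exact ⟨fun ⟨y, hy⟩ => ⟨y, Finset.mem_univ y, hy⟩, fun ⟨y, _, hy⟩ => ⟨y, hy⟩⟩

theorem count_A {n k : ℕ} (hk : 2 ≤ k) (a b : Fin n) (hab : a ≠ b) :
    (((Finset.univ : Finset (Fin n)).powersetCard k).filter (fun A => a ∈ A ∧ b ∈ A)).card = (n - 2).choose (k - 2) := by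
  have hcard : (({a, b} : Finset (Fin n))ᶜ).card = n - 2 := by
    rw [Finset.card_compl, Finset.card_pair hab, Fintype.card_fin]
  rw [← hcard, ← Finset.card_powersetCard]
  refine Finset.card_nbij' (fun A => A \ {a, b}) (fun B => B ∪ {a, b}) ?_ ?_ ?_ ?_
  · intro A hA
    simp only [Finset.coe_filter, Finset.mem_powersetCard, Set.mem_setOf_eq] at hA
    simp only [Finset.mem_coe, Finset.mem_powersetCard]
    refine ⟨fun x hx => ?_, ?_⟩
    · rw [Finset.mem_compl]; exact (Finset.mem_sdiff.1 hx).2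
    · rw [Finset.card_sdiff_of_subset, hA.1.2, Finset.card_pair hab]
      intro x hx
      simp only [Finset.mem_insert, Finset.mem_singleton] at hx
      rcases hx with rfl | rfl
      · exact hA.2.1
      · exact hA.2.2
  · intro B hB
    simp only [Finset.mem_coe, Finset.mem_powersetCard] at hB
    simp only [Finset.coe_filter, Finset.mem_powersetCard, Set.mem_setOf_eq]
    refine ⟨⟨Finset.subset_univ _, ?_⟩, by simp, by simp⟩
    rw [Finset.card_union_of_disjoint, hB.2, Finset.card_pair hab]
    · omega
    · exact Finset.disjoint_left.2 fun x hx => Finset.mem_compl.1 (hB.1 hx)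
  · intro A hA
    simp only [Finset.coe_filter, Finset.mem_powersetCard, Set.mem_setOf_eq] at hA
    apply Finset.sdiff_union_of_subset
    intro x hx
    simp only [Finset.mem_insert, Finset.mem_singleton] at hx
    rcases hx with rfl | rfl
    · exact hA.2.1
    · exact hA.2.2
  · intro B hB
    simp only [Finset.mem_coe, Finset.mem_powersetCard] at hB
    apply Finset.union_sdiff_cancel_right
    exact Finset.disjoint_left.2 fun x hx => Finset.mem_compl.1 (hB.1 hx)

theorem card_Sab (k : ℕ) (hk : 2 ≤ k) (a b : Fin (k^2)) (hab : a ≠ b) :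
    Nat.card (Sab k a b) = (k ^ 2 - 2).choose (k - 2) * uniformCount (k ^ 2 - k) k := by
  classical
  have h1 : Nat.card (Sab k a b) = {F | F ∈ Fam (Finset.univ : Finset (Fin (k^2))) k ∧ ∃ A ∈ F, a ∈ A ∧ b ∈ A}.ncard := by
    rw [← Nat.card_coe_set_eq]
    refine Nat.card_congr (Equiv.ofBijective (fun P => ⟨P.1.1.parts, parts_mem_Fam P.1.1 P.1.2, P.2⟩) ⟨?_, ?_⟩)
    · intro P Q h
      exact Subtype.ext (Subtype.ext (Finpartition.ext (congrArg Subtype.val h)))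
    · rintro ⟨F, hF, hF2⟩
      obtain ⟨P, hP⟩ := Fam_exists (by omega) F hF
      refine ⟨⟨⟨P, by rw [hP]; exact hF.2.2⟩, ?_⟩, Subtype.ext hP⟩
      show ∃ A ∈ P.parts, a ∈ A ∧ b ∈ A
      rw [hP]; exact hF2
  let 𝒜 := ((Finset.univ : Finset (Fin (k^2))).powersetCard k).filter (fun A => a ∈ A ∧ b ∈ A)
  let S : Finset (Fin (k^2)) → Finset (Finset (Finset (Fin (k^2)))) := fun A => Finset.univ.filter (fun F => F ∈ Fam (Finset.univ : Finset (Fin (k^2))) k ∧ A ∈ F)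
  have h2 : {F | F ∈ Fam (Finset.univ : Finset (Fin (k^2))) k ∧ ∃ A ∈ F, a ∈ A ∧ b ∈ A} = ((𝒜.biUnion S : Finset _) : Set _) := by
    ext F
    simp only [Set.mem_setOf_eq, Finset.mem_coe, Finset.mem_biUnion, 𝒜, S, Finset.mem_filter, Finset.mem_univ, true_and, Finset.mem_powersetCard, Finset.subset_univ]
    constructor
    · rintro ⟨hF, A, hA, h⟩
      exact ⟨A, ⟨hF.2.2 A hA, h⟩, hF, hA⟩
    · rintro ⟨A, ⟨_, h⟩, hF, hA⟩
      exact ⟨hF, A, hA, h⟩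
  rw [h1, h2, Set.ncard_coe_finset, Finset.card_biUnion]
  · rw [← count_A hk a b hab, ← smul_eq_mul, ← Finset.sum_const]
    refine Finset.sum_congr rfl fun A hA => ?_
    simp only [Finset.mem_filter, Finset.mem_powersetCard] at hA
    rw [← Fam_compl A k hA.1.2 (by omega), ← Fam_erase A k hA.1.2 (by omega), ← Set.ncard_coe_finset]
    congr 1
    simp [S]
  · intro A hA B hB hAB
    refine Finset.disjoint_left.2 ?_
    intro F hF hF'
    simp only [S, 𝒜, Finset.mem_filter, Finset.mem_coe, Finset.mem_univ, true_and] at hF hF' hA hB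
    exact hAB (hF.1.1 A hF.2 B hF'.2 a hA.2.1 hB.2.1)
end fam

set_option linter.all false
set_option linter.unusedSectionVars false
open scoped BigOperators

section final
variable {k : ℕ}

noncomputable instance UQIVertex.fin (k : ℕ) : Fintype (UQIVertex k) := by
  classical
  exact Fintype.ofFinite {P : Finpartition (Finset.univ : Finset (Fin (k ^ 2))) // ∀ A ∈ P.parts, A.card = k}

theorem vertex_ext (P Q : UQIVertex k) (h : ∀ a b, P ∈ Sab k a b ↔ Q ∈ Sab k a b) : P = Q := by
  have key : ∀ P Q : UQIVertex k, (∀ a b, P ∈ Sab k a b ↔ Q ∈ Sab k a b) → P.1.parts ⊆ Q.1.parts := by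
    intro P Q h A hA
    obtain ⟨a, ha⟩ := P.1.nonempty_of_mem_parts hA
    obtain ⟨B, hB, haB⟩ := Q.1.exists_mem (Finset.mem_univ a)
    have : A = B := by
      ext x
      constructor
      · intro hx
        obtain ⟨C, hC, h1, h2⟩ := (h a x).1 ⟨A, hA, ha, hx⟩
        rw [Q.1.eq_of_mem_parts hB hC haB h1]; exact h2
      · intro hx
        obtain ⟨C, hC, h1, h2⟩ := (h a x).2 ⟨B, hB, haB, hx⟩
        rw [P.1.eq_of_mem_parts hA hC ha h1]; exact h2
    rw [this]; exact hB
  exact Subtype.ext (Finpartition.ext (Finset.Subset.antisymm (key P Q h) (key Q P fun a b => (h a b).symm)))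

def eK (k : ℕ) : Fin (k^2) ≃ Fin k × Fin k := (finCongr (sq k)).trans finProdFinEquiv.symm

theorem colpart_exists (k : ℕ) (hk : 1 ≤ k) (x : Equiv.Perm (Fin k × Fin k)) :
    ∃ P : UQIVertex k, ∀ a b, P ∈ Sab k a b ↔ (x⁻¹ (eK k a)).2 = (x⁻¹ (eK k b)).2 := by
  let f : Fin (k^2) → Fin k := fun a => (x⁻¹ (eK k a)).2
  let fib : Fin k → Finset (Fin (k^2)) := fun c => Finset.univ.filter (fun a => f a = c)
  have hfam : Finset.univ.image fib ∈ Fam (Finset.univ : Finset (Fin (k^2))) k := by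
    refine ⟨?_, ?_, ?_⟩
    · intro A hA B hB a ha hb
      simp only [Finset.mem_image, Finset.mem_univ, true_and] at hA hB
      obtain ⟨c, rfl⟩ := hA
      obtain ⟨d, rfl⟩ := hB
      simp only [fib, Finset.mem_filter, Finset.mem_univ, true_and] at ha hb
      rw [← ha, ← hb]
    · intro a
      simp only [Finset.mem_univ, true_iff]
      exact ⟨fib (f a), Finset.mem_image_of_mem _ (Finset.mem_univ _), by simp [fib]⟩
    · intro A hA
      simp only [Finset.mem_image, Finset.mem_univ, true_and] at hA
      obtain ⟨c, rfl⟩ := hA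
      have hinj : Function.Injective (fun r : Fin k => (eK k).symm (x (r, c))) := by
        intro r s h
        have h1 : x (r, c) = x (s, c) := (eK k).symm.injective h
        exact congrArg Prod.fst (x.injective h1)
      have : fib c = (Finset.univ : Finset (Fin k)).image (fun r : Fin k => (eK k).symm (x (r, c))) := by
        ext a
        simp only [fib, f, Finset.mem_filter, Finset.mem_univ, true_and, Finset.mem_image]
        constructor
        · intro h
          refine ⟨(x⁻¹ (eK k a)).1, ?_⟩
          rw [← h]
          have : x (x⁻¹ (eK k a)) = eK k a := x.apply_symm_apply _
          rw [Prod.mk.eta, this, Equiv.symm_apply_apply]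
        · rintro ⟨r, rfl⟩
          rw [Equiv.apply_symm_apply]
          have : x⁻¹ (x (r, c)) = (r, c) := x.symm_apply_apply _
          rw [this]
      rw [this, Finset.card_image_of_injective _ hinj, Finset.card_univ, Fintype.card_fin]
  obtain ⟨P, hP⟩ := Fam_exists hk _ hfam
  refine ⟨⟨P, by rw [hP]; exact hfam.2.2⟩, fun a b => ?_⟩
  show (∃ A ∈ P.parts, a ∈ A ∧ b ∈ A) ↔ f a = f b
  rw [hP]
  constructor
  · rintro ⟨A, hA, ha, hb⟩
    simp only [Finset.mem_image, Finset.mem_univ, true_and] at hA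
    obtain ⟨c, rfl⟩ := hA
    simp only [fib, Finset.mem_filter, Finset.mem_univ, true_and] at ha hb
    rw [ha, hb]
  · intro h
    exact ⟨fib (f b), Finset.mem_image_of_mem _ (Finset.mem_univ _), by simp [fib, h], by simp [fib]⟩

theorem parts_card (hk : 1 ≤ k) (P : UQIVertex k) : P.1.parts.card = k := by
  have h := P.1.sum_card_parts
  rw [Finset.sum_congr rfl P.2] at h
  simp only [Finset.sum_const, smul_eq_mul, Finset.card_univ, Fintype.card_fin, sq] at h
  exact Nat.eq_of_mul_eq_mul_right (by omega) h

theorem colpart_surj (hk : 1 ≤ k) (P : UQIVertex k) : ∃ x : Equiv.Perm (Fin k × Fin k),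
    ∀ a b, P ∈ Sab k a b ↔ (x⁻¹ (eK k a)).2 = (x⁻¹ (eK k b)).2 := by
  let E := P.1.parts.equivFinOfCardEq (parts_card hk P)
  have hmem : ∀ a, a ∈ P.1.part a := fun a => P.1.mem_part (Finset.mem_univ a)
  have hpart : ∀ a, P.1.part a ∈ P.1.parts := fun a => P.1.part_mem.2 (Finset.mem_univ a)
  let e2 : (A : P.1.parts) → (A.1 ≃ Fin k) := fun A => A.1.equivFinOfCardEq (P.2 A.1 A.2)
  let pa : Fin (k^2) → P.1.parts := fun a => ⟨P.1.part a, hpart a⟩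
  let y : Fin (k^2) → Fin k × Fin k := fun a => (e2 (pa a) ⟨a, hmem a⟩, E (pa a))
  have hy : Function.Injective y := by
    intro a b h
    simp only [y, Prod.mk.injEq] at h
    have h2 := E.injective h.2
    have aux : ∀ A B : P.1.parts, A = B → ∀ (a) (ha : a ∈ A.1) (b) (hb : b ∈ B.1), e2 A ⟨a, ha⟩ = e2 B ⟨b, hb⟩ → a = b := by
      rintro A _ rfl a ha b hb h
      simpa using (e2 A).injective h
    exact aux _ _ h2 _ _ _ _ h.1
  have hb : Function.Bijective y := (Fintype.bijective_iff_injective_and_card y).2 ⟨hy, by simp [sq]⟩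
  let Y := Equiv.ofBijective y hb
  refine ⟨((eK k).symm.trans Y)⁻¹, fun a b => ?_⟩
  rw [inv_inv]
  show _ ↔ (y ((eK k).symm (eK k a))).2 = (y ((eK k).symm (eK k b))).2
  rw [Equiv.symm_apply_apply, Equiv.symm_apply_apply]
  show _ ↔ E (pa a) = E (pa b)
  rw [E.injective.eq_iff, Subtype.mk.injEq]
  constructor
  · rintro ⟨A, hA, ha, hb⟩
    rw [P.1.part_eq_of_mem hA ha, P.1.part_eq_of_mem hA hb]
  · intro h
    exact ⟨P.1.part b, hpart b, h ▸ hmem a, hmem b⟩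

theorem expect_push {X V : Type} [Group X] [Fintype X] [Fintype V] (π : X → V) (hs : Function.Surjective π)
    (hc : ∀ z x y, π x = π y → π (z * x) = π (z * y)) (F : V → ℝ) : 𝔼 x, F (π x) = 𝔼 v, F v := by
  classical
  have hfib : ∀ u v, (Finset.univ.filter (fun x => π x = u)).card ≤ (Finset.univ.filter (fun x => π x = v)).card := by
    intro u v
    obtain ⟨x, hx⟩ := hs u
    obtain ⟨y, hy⟩ := hs v
    refine Finset.card_le_card_of_injOn (fun z => y * x⁻¹ * z) ?_ ?_
    · intro z hz
      simp only [Finset.coe_filter, Finset.mem_univ, true_and, Set.mem_setOf_eq] at hz ⊢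
      rw [hc (y * x⁻¹) z x (hz.trans hx.symm)]
      simpa using hy
    · intro z _ z' _ h
      simpa using h
  set n := (Finset.univ.filter (fun x => π x = π 1)).card with hn
  have hfib2 : ∀ u, (Finset.univ.filter (fun x => π x = u)).card = n := fun u => le_antisymm (hfib _ _) (hfib _ _)
  have hsum : ∀ F : V → ℝ, ∑ x, F (π x) = n * ∑ v, F v := by
    intro F
    rw [← Finset.sum_fiberwise_of_maps_to (s := Finset.univ) (t := Finset.univ) (g := π) (fun _ _ => Finset.mem_univ _), Finset.mul_sum]
    refine Finset.sum_congr rfl fun v _ => ?_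
    rw [Finset.sum_congr rfl (fun x hx => by rw [(Finset.mem_filter.1 hx).2])]
    rw [Finset.sum_const, hfib2, nsmul_eq_mul]
  have hcard := hsum (fun _ => 1)
  simp only [Finset.sum_const, Finset.card_univ, nsmul_eq_mul, mul_one] at hcard
  rw [Fintype.expect_eq_sum_div_card, Fintype.expect_eq_sum_div_card, hsum, hcard]
  have hX : (Fintype.card X : ℝ) ≠ 0 := by exact_mod_cast Fintype.card_ne_zero
  rw [hcard] at hX
  have h1 : (n : ℝ) ≠ 0 := left_ne_zero_of_mul hX
  rw [mul_div_mul_left _ _ h1]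

theorem mean_fcol (k : ℕ) (hk : 2 ≤ k) (a b : Fin k × Fin k) (hab : a ≠ b) : 𝔼 x, fcol a b x = 1 / ((k:ℝ) + 1) := by
  have h1 := expect_eav (fibH (Fin k) (Fin k)) (fcol a b)
  have h2 := expect_eav (colH (Fin k) (Fin k)) (frow a b)
  rw [fib_fcol a b hab, ← Finset.mul_expect, Finset.expect_sub_distrib, Fintype.expect_const] at h1
  rw [col_frow a b hab, ← Finset.mul_expect, Finset.expect_sub_distrib, Fintype.expect_const] at h2
  generalize 𝔼 x, fcol a b x = μ at *
  generalize 𝔼 x, frow a b x = ν at *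
  rw [Fintype.card_fin] at h1 h2
  have hk' : (2:ℝ) ≤ k := by exact_mod_cast hk
  have hk0 : (k:ℝ) ≠ 0 := by positivity
  have h1' : 1 - ν = k * μ := by rw [← h1]; field_simp
  have h2' : 1 - μ = k * ν := by rw [← h2]; field_simp
  rw [eq_div_iff (by positivity)]
  have : ((k:ℝ) - 1) * (μ * (k + 1)) = (k - 1) * 1 := by nlinarith
  exact mul_left_cancel₀ (by linarith) this

theorem same_part (P : UQIVertex k) {A : Finset (Fin (k^2))} (hA : A ∈ P.1.parts) {a d : Fin (k^2)} (ha : a ∈ A)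
    (h : P ∈ Sab k a d) : d ∈ A := by
  obtain ⟨B, hB, h1, h2⟩ := h
  rw [P.1.eq_of_mem_parts hA hB ha h1]; exact h2

theorem ratio_bound (k : ℕ) (hk : 2 ≤ k) (f : Equiv.Perm (Fin k × Fin k) → ℝ) (hc : Inva (colH (Fin k) (Fin k)) f)
    (hd : Inva (diagH (Fin k) (Fin k)) f) (s : Equiv.Perm (Fin k × Fin k)) (hs : Inva (fibH (Fin k) (Fin k)) (fun x => f (x * s)))
    (h01 : ∀ x, f x * f x = f x) (h0 : ∀ x, f x * f (x * s) = 0) : 𝔼 x, f x ≤ 1 / ((k:ℝ) + 1) := by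
  set δ := 𝔼 x, f x with hδ
  let fr : Equiv.Perm (Fin k × Fin k) → ℝ := fun x => f (x * s)
  have hfr : 𝔼 x, fr x = δ := expect_mul_right f s
  let g := f - fun _ => δ
  let q := fr - fun _ => δ
  have hg0 : 𝔼 x, g x = 0 := by
    simp only [g, Pi.sub_apply]; rw [Finset.expect_sub_distrib, Fintype.expect_const]; simp [hδ]
  have hq0 : 𝔼 x, q x = 0 := by
    simp only [q, Pi.sub_apply]; rw [Finset.expect_sub_distrib, Fintype.expect_const, hfr]; simp
  have hff : ip f f = δ := by unfold ip; simp only [h01]; rfl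
  have hfrfr : ip fr fr = δ := by unfold ip; simp only [fr, h01]; exact hfr
  have hffr : ip f fr = 0 := by unfold ip; simp only [fr, h0]; simp
  have hfc : ip f (fun _ => δ) = δ * δ := by rw [ip_const]
  have hfrc : ip fr (fun _ => δ) = δ * δ := by rw [ip_const, hfr]
  have hcc : ip (fun _ : Equiv.Perm (Fin k × Fin k) => δ) (fun _ => δ) = δ * δ := by rw [ip_const, Fintype.expect_const]
  have hgg : ip g g = δ - δ * δ := by
    simp only [g, ip_sub_left, ip_sub_right]; rw [hff, hfc, ip_comm _ f, hfc, hcc]; ring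
  have hqq : ip q q = δ - δ * δ := by
    simp only [q, ip_sub_left, ip_sub_right]; rw [hfrfr, hfrc, ip_comm _ fr, hfrc, hcc]; ring
  have hgq : ip g q = - (δ * δ) := by
    simp only [g, q, ip_sub_left, ip_sub_right]; rw [hffr, hfc, ip_comm _ fr, hfrc, hcc]; ring
  have hqi : Inva (fibH (Fin k) (Fin k)) q := fun x h => by
    simp only [q, Pi.sub_apply]
    have := hs x h
    simp only [fr]; simp only at this; rw [this]
  have hT : ip (eav (fibH (Fin k) (Fin k)) g) q = - (δ * δ) := by
    rw [ip_eav, eav_of_inv _ hqi, hgq]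
  have hcl := claim_all (κ := Fin k) (by simpa using hk) k (by omega) (by simp) g
    (fun x h => by simp only [g, Pi.sub_apply]; rw [hc]) (fun x h => by simp only [g, Pi.sub_apply]; rw [hd]) hg0
  have cs := ip_cs (eav (fibH (Fin k) (Fin k)) g) q
  rw [hT, hqq] at cs
  rw [hgg, Fintype.card_fin] at hcl
  have hk' : (2:ℝ) ≤ k := by exact_mod_cast hk
  have hδ0 : 0 ≤ δ := hff ▸ ip_self_nonneg f
  have hv : 0 ≤ δ - δ * δ := hgg ▸ ip_self_nonneg g
  have h2 : (k * (δ * δ)) ^ 2 ≤ (δ - δ * δ) ^ 2 := by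
    calc (k * (δ * δ)) ^ 2 = (k * k) * (-(δ * δ)) ^ 2 := by ring
      _ ≤ (k * k) * (ip (eav (fibH (Fin k) (Fin k)) g) (eav (fibH (Fin k) (Fin k)) g) * (δ - δ * δ)) := by gcongr
      _ = (k * k * ip (eav (fibH (Fin k) (Fin k)) g) (eav (fibH (Fin k) (Fin k)) g)) * (δ - δ * δ) := by ring
      _ ≤ (δ - δ * δ) * (δ - δ * δ) := by gcongr
      _ = _ := by ring
  have h3 : k * (δ * δ) ≤ δ - δ * δ := by
    have := abs_le_of_sq_le_sq h2 hv
    exact (le_abs_self _).trans this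
  rw [le_div_iff₀ (by positivity)]
  rcases hδ0.eq_or_lt with h | h
  · rw [← h]; norm_num
  · have : (δ * (k + 1)) * δ ≤ 1 * δ := by linarith
    exact le_of_mul_le_mul_right this h

theorem card_bound (k : ℕ) (hk : 2 ≤ k) (a b : Fin (k ^ 2)) (hab : a ≠ b) (T : Set (UQIVertex k))
    (hT : ∀ P ∈ T, ∀ Q ∈ T, ¬ (UQIGraph k).Adj P Q) : Nat.card T ≤ Nat.card (Sab k a b) := by
  classical
  choose π hπ using colpart_exists k (by omega)
  have hsurj : Function.Surjective π := by
    intro P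
    obtain ⟨x, hx⟩ := colpart_surj (by omega) P
    exact ⟨x, vertex_ext _ _ fun a b => by rw [hπ, hx]⟩
  have hcong : ∀ z x y, π x = π y → π (z * x) = π (z * y) := by
    intro z x y h
    apply vertex_ext
    intro a b
    have h2 : ∀ a b, (x⁻¹ (eK k a)).2 = (x⁻¹ (eK k b)).2 ↔ (y⁻¹ (eK k a)).2 = (y⁻¹ (eK k b)).2 := by
      intro a b
      rw [← hπ, ← hπ, h]
    have := h2 ((eK k).symm (z⁻¹ (eK k a))) ((eK k).symm (z⁻¹ (eK k b)))
    simp only [Equiv.apply_symm_apply] at this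
    rw [hπ, hπ]
    simpa only [mul_inv_rev, Equiv.Perm.mul_apply] using this
  let s : Equiv.Perm (Fin k × Fin k) := Equiv.prodComm _ _
  have hs : ∀ (x : Equiv.Perm (Fin k × Fin k)) p, ((x * s)⁻¹ p).2 = (x⁻¹ p).1 := fun x p => rfl
  have hadj : ∀ x, (UQIGraph k).Adj (π x) (π (x * s)) := by
    intro x
    unfold UQIGraph
    rw [SimpleGraph.fromRel_adj]
    have hxx : ∀ p, x⁻¹ (x p) = p := x.symm_apply_apply
    refine ⟨fun h => ?_, Or.inl ?_⟩
    · let r0 : Fin k := ⟨0, by omega⟩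
      let r1 : Fin k := ⟨1, by omega⟩
      have h1 : π x ∈ Sab k ((eK k).symm (x (r0, r0))) ((eK k).symm (x (r1, r0))) := by
        rw [hπ]; simp only [Equiv.apply_symm_apply, hxx]
      rw [h, hπ] at h1
      simp only [Equiv.apply_symm_apply, hs, hxx] at h1
      simp [r0, r1] at h1
    · intro A hA B hB
      obtain ⟨a, ha⟩ := (π x).1.nonempty_of_mem_parts hA
      obtain ⟨b, hb⟩ := (π (x * s)).1.nonempty_of_mem_parts hB
      refine ⟨(eK k).symm (x ((x⁻¹ (eK k b)).1, (x⁻¹ (eK k a)).2)), Finset.mem_inter.2 ⟨?_, ?_⟩⟩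
      · apply same_part _ hA ha
        rw [hπ]; simp only [Equiv.apply_symm_apply, hxx]
      · apply same_part _ hB hb
        rw [hπ]; simp only [Equiv.apply_symm_apply, hs, hxx]
  let F : Set (UQIVertex k) → UQIVertex k → ℝ := fun S P => if P ∈ S then 1 else 0
  have hF : ∀ S, 𝔼 P, F S P = (Nat.card S : ℝ) / Fintype.card (UQIVertex k) := by
    intro S
    rw [Fintype.expect_eq_sum_div_card]
    congr 1
    simp only [F]
    rw [Finset.sum_boole, Nat.card_eq_fintype_card, Fintype.card_subtype]
  have hcol : ∀ x h, π (x * colH (Fin k) (Fin k) h) = π x := by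
    intro x h
    apply vertex_ext
    intro a b
    rw [hπ, hπ, mul_inv_rev, ← map_inv]; rfl
  have hdiag : ∀ x h, π (x * diagH (Fin k) (Fin k) h) = π x := by
    intro x h
    apply vertex_ext
    intro a b
    rw [hπ, hπ, mul_inv_rev, ← map_inv]
    show h⁻¹ _ = h⁻¹ _ ↔ _
    exact h⁻¹.injective.eq_iff
  have hfib : ∀ x h, π (x * fibH (Fin k) (Fin k) h * s) = π (x * s) := by
    intro x h
    apply vertex_ext
    intro a b
    rw [hπ, hπ]
    simp only [hs]
    rw [mul_inv_rev, ← map_inv]; rfl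
  have hb := ratio_bound k hk (fun x => F T (π x)) (fun x h => by simp only [hcol]) (fun x h => by simp only [hdiag]) s
    (fun x h => by simp only [hfib]) (fun x => by simp only [F]; split_ifs <;> simp)
    (fun x => by
      simp only [F]
      by_cases h1 : π x ∈ T
      · by_cases h2 : π (x * s) ∈ T
        · exact (hT _ h1 _ h2 (hadj x)).elim
        · simp [h2]
      · simp [h1])
  rw [expect_push π hsurj hcong (F T), hF] at hb
  have hm := mean_fcol k hk (eK k a) (eK k b) (fun h => hab ((eK k).injective h))
  have e : ∀ x, fcol (eK k a) (eK k b) x = F (Sab k a b) (π x) := by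
    intro x
    simp only [fcol, F, hπ]
  rw [Finset.expect_congr rfl (fun x _ => e x), expect_push π hsurj hcong (F (Sab k a b)), hF] at hm
  rw [← hm] at hb
  have hpos : (0:ℝ) < Fintype.card (UQIVertex k) := by
    haveI : Nonempty (UQIVertex k) := ⟨π 1⟩
    exact_mod_cast Fintype.card_pos
  have := (div_le_div_iff_of_pos_right hpos).1 hb
  exact_mod_cast this

theorem Sab_indep (k : ℕ) (hk : 2 ≤ k) (a b : Fin (k ^ 2)) (hab : a ≠ b) :
    ∀ P ∈ Sab k a b, ∀ Q ∈ Sab k a b, ¬ (UQIGraph k).Adj P Q := by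
  have key : ∀ P ∈ Sab k a b, ∀ Q ∈ Sab k a b, ¬ (∀ A ∈ P.1.parts, ∀ B ∈ Q.1.parts, (A ∩ B).Nonempty) := by
    rintro P ⟨A, hA, haA, hbA⟩ Q ⟨B, hB, haB, hbB⟩ h
    have hQc := parts_card (by omega) Q
    have hsub : Q.1.parts ⊆ (A.erase b).image (fun x => Q.1.part x) := by
      intro C hC
      rw [Finset.mem_image]
      by_cases hCB : C = B
      · subst hCB
        exact ⟨a, Finset.mem_erase.2 ⟨hab, haA⟩, Q.1.part_eq_of_mem hC haB⟩
      · obtain ⟨x, hx⟩ := h A hA C hC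
        rw [Finset.mem_inter] at hx
        refine ⟨x, Finset.mem_erase.2 ⟨?_, hx.1⟩, Q.1.part_eq_of_mem hC hx.2⟩
        rintro rfl
        exact hCB (Q.1.eq_of_mem_parts hC hB hx.2 hbB)
    have h1 := Finset.card_le_card hsub
    have h2 := Finset.card_image_le (s := A.erase b) (f := fun x => Q.1.part x)
    rw [Finset.card_erase_of_mem hbA, P.2 A hA] at h2
    omega
  intro P hP Q hQ hadj
  unfold UQIGraph at hadj
  rw [SimpleGraph.fromRel_adj] at hadj
  rcases hadj.2 with h | h
  · exact key P hP Q hQ h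
  · exact key Q hQ P hP h
end final

/-- For `k ≥ 2` and distinct `a, b`, the set `S_{a,b}` is an independent set in
`QI(k²,k)`, and the maximum independent set of `QI(k²,k)` has size exactly
`C(k²−2, k−2)·U(k²−k, k−1)`, attained by `S_{a,b}`. -/
theorem indep_QIGraph (k : ℕ) (hk : 2 ≤ k) (a b : Fin (k ^ 2)) (hab : a ≠ b) :
    (∀ P ∈ Sab k a b, ∀ Q ∈ Sab k a b, ¬ (UQIGraph k).Adj P Q) ∧
    IsGreatest {m | ∃ T : Set (UQIVertex k),
        (∀ P ∈ T, ∀ Q ∈ T, ¬ (UQIGraph k).Adj P Q) ∧ Nat.card T = m}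
      ((k ^ 2 - 2).choose (k - 2) * uniformCount (k ^ 2 - k) k) ∧
    Nat.card (Sab k a b) =
      (k ^ 2 - 2).choose (k - 2) * uniformCount (k ^ 2 - k) k := by
  have hc := card_Sab k hk a b hab
  refine ⟨Sab_indep k hk a b hab, ⟨⟨Sab k a b, Sab_indep k hk a b hab, hc⟩, ?_⟩, hc⟩
  rintro m ⟨T, hT, rfl⟩
  rw [← hc]
  exact card_bound k hk a b hab T hT
end

section
/- Let n = ck with c = n/k ≥ 1, and let 𝒫 be a family of uniform k-partitions of an n-set (each class of size c) such that any two partitions in 𝒫 share at least one common class (1-intersecting). Then |𝒫| ≤ U(n−c, k−1), the number of uniform (k−1)-partitions of an (n−c)-set; equality holds iff 𝒫 is trivially 1-intersecting, i.e., all partitions in 𝒫 contain one fixed common c-class. -/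
structure IsUP {α : Type*} (c : ℕ) (s : Finset α) (P : Finset (Finset α)) : Prop where
  crd : ∀ A ∈ P, A.card = c
  sub : ∀ A ∈ P, A ⊆ s
  uniq : ∀ A ∈ P, ∀ B ∈ P, ∀ x, x ∈ A → x ∈ B → A = B
  cov : ∀ x ∈ s, ∃ A ∈ P, x ∈ A

def ucnt (c : ℕ) : ℕ → ℕ
  | 0 => 1
  | j + 1 => (c * (j + 1) - 1).choose (c - 1) * ucnt c j

open Classical in
noncomputable def upW {α : Type*} (c : ℕ) (s : Finset α) : Finset (Finset (Finset α)) :=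
  (Finset.powersetCard c s).powerset.filter (fun P => IsUP c s P)

section basic
variable {α : Type*} [DecidableEq α] {c : ℕ} {s : Finset α} {P : Finset (Finset α)}

theorem mem_upW : P ∈ upW c s ↔ IsUP c s P := by
  classical
  unfold upW
  rw [Finset.mem_filter, Finset.mem_powerset]
  constructor
  · rintro ⟨_, h⟩
    convert h
  · intro h
    refine ⟨fun A hA => Finset.mem_powersetCard.2 ⟨h.sub A hA, h.crd A hA⟩, ?_⟩
    convert h

/-- card of a union of pairwise disjoint sets of size c -/
theorem card_bU (S : Finset (Finset α)) (hc : ∀ A ∈ S, A.card = c)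
    (hu : ∀ A ∈ S, ∀ B ∈ S, ∀ x, x ∈ A → x ∈ B → A = B) :
    (S.biUnion id).card = c * S.card := by
  rw [Finset.card_biUnion]
  · have h : ∑ A ∈ S, (id A).card = ∑ _A ∈ S, c := Finset.sum_congr rfl (fun A hA => hc A hA)
    rw [h]
    simp [mul_comm]
  · intro A hA B hB hAB
    rw [Function.onFun, Finset.disjoint_left]
    intro x hx hx'
    exact hAB (hu A hA B hB x hx hx')

theorem IsUP.card_eq (h : IsUP c s P) : s.card = c * P.card := by
  rw [← card_bU P h.crd h.uniq]
  congr 1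
  ext x
  simp only [Finset.mem_biUnion, id]
  exact ⟨h.cov x, fun ⟨A, hA, hx⟩ => h.sub A hA hx⟩

/-- removing a subfamily -/
theorem IsUP.sdiff (h : IsUP c s P) {S : Finset (Finset α)} (hS : S ⊆ P) :
    IsUP c (s \ S.biUnion id) (P \ S) := by
  refine ⟨fun A hA => h.crd A (Finset.mem_sdiff.1 hA).1, fun A hA x hx => ?_,
    fun A hA B hB => h.uniq A (Finset.mem_sdiff.1 hA).1 B (Finset.mem_sdiff.1 hB).1, fun x hx => ?_⟩
  · rw [Finset.mem_sdiff] at hA ⊢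
    refine ⟨h.sub A hA.1 hx, fun hx' => ?_⟩
    obtain ⟨B, hB, hxB⟩ := Finset.mem_biUnion.1 hx'
    have := h.uniq A hA.1 B (hS hB) x hx hxB
    exact hA.2 (this ▸ hB)
  · rw [Finset.mem_sdiff] at hx
    obtain ⟨A, hA, hxA⟩ := h.cov x hx.1
    refine ⟨A, Finset.mem_sdiff.2 ⟨hA, fun hAS => hx.2 ?_⟩, hxA⟩
    exact Finset.mem_biUnion.2 ⟨A, hAS, hxA⟩

theorem IsUP.insertUP {A : Finset α} (hA : A.card = c) (hAs : A ⊆ s) (h : IsUP c (s \ A) P) :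
    IsUP c s (insert A P) := by
  have key : ∀ B ∈ P, ∀ x, x ∈ B → x ∉ A := fun B hB x hx =>
    (Finset.mem_sdiff.1 (h.sub B hB hx)).2
  refine ⟨?_, ?_, ?_, ?_⟩
  · intro B hB
    rcases Finset.mem_insert.1 hB with rfl | hB
    · exact hA
    · exact h.crd B hB
  · intro B hB
    rcases Finset.mem_insert.1 hB with rfl | hB
    · exact hAs
    · exact (h.sub B hB).trans Finset.sdiff_subset
  · intro B hB D hD x hxB hxD
    rcases Finset.mem_insert.1 hB with h1 | hB <;> rcases Finset.mem_insert.1 hD with h2 | hD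
    · rw [h1, h2]
    · exact absurd (h1 ▸ hxB) (key D hD x hxD)
    · exact absurd (h2 ▸ hxD) (key B hB x hxB)
    · exact h.uniq B hB D hD x hxB hxD
  · intro x hx
    by_cases hxA : x ∈ A
    · exact ⟨A, Finset.mem_insert_self _ _, hxA⟩
    · obtain ⟨B, hB, hxB⟩ := h.cov x (Finset.mem_sdiff.2 ⟨hx, hxA⟩)
      exact ⟨B, Finset.mem_insert_of_mem hB, hxB⟩

theorem card_filter_mem (hc : 0 < c) {A : Finset α} (hA : A.card = c) (hAs : A ⊆ s) :
    ((upW c s).filter (fun P => A ∈ P)).card = (upW c (s \ A)).card := by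
  symm
  refine Finset.card_bij (fun P _ => insert A P) ?_ ?_ ?_
  · intro P hP
    rw [mem_upW] at hP
    exact Finset.mem_filter.2 ⟨mem_upW.2 (hP.insertUP hA hAs), Finset.mem_insert_self _ _⟩
  · intro P hP Q hQ hPQ
    rw [mem_upW] at hP hQ
    have key : ∀ R, IsUP c (s \ A) R → A ∉ R := by
      intro R hR hAR
      obtain ⟨x, hx⟩ := Finset.card_pos.1 (hA ▸ hc)
      exact (Finset.mem_sdiff.1 (hR.sub A hAR hx)).2 hx
    rw [← Finset.erase_insert (key P hP), ← Finset.erase_insert (key Q hQ), hPQ]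
  · intro P hP
    rw [Finset.mem_filter, mem_upW] at hP
    refine ⟨P \ {A}, ?_, ?_⟩
    · rw [mem_upW]
      have := hP.1.sdiff (S := {A}) (by simpa using hP.2)
      simpa using this
    · rw [Finset.sdiff_singleton_eq_erase, Finset.insert_erase hP.2]

theorem card_upW (hc : 0 < c) (j : ℕ) : ∀ s : Finset α, s.card = c * j →
    (upW c s).card = ucnt c j := by
  induction j with
  | zero =>
    intro s hs
    have hs : s = ∅ := by simpa using hs
    subst hs
    rw [ucnt, Finset.card_eq_one]
    refine ⟨∅, ?_⟩
    ext P
    rw [mem_upW, Finset.mem_singleton]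
    constructor
    · intro h
      have := h.card_eq
      simpa [hc.ne'] using this
    · rintro rfl
      exact ⟨by simp, by simp, by simp, by simp⟩
  | succ j ih =>
    intro s hs
    have hpos : 0 < s.card := by rw [hs]; positivity
    obtain ⟨x, hx⟩ := Finset.card_pos.1 hpos
    have hW : upW c s = ((s.powersetCard c).filter (fun A => x ∈ A)).biUnion
        (fun A => (upW c s).filter (fun P => A ∈ P)) := by
      ext P
      simp only [Finset.mem_biUnion, Finset.mem_filter, Finset.mem_powersetCard]
      constructor
      · intro hP
        have h := mem_upW.1 hP
        obtain ⟨A, hA, hxA⟩ := h.cov x hx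
        exact ⟨A, ⟨⟨h.sub A hA, h.crd A hA⟩, hxA⟩, hP, hA⟩
      · rintro ⟨A, -, hP, -⟩
        exact hP
    rw [hW, Finset.card_biUnion]
    · rw [Finset.sum_congr rfl (g := fun _ => ucnt c j)]
      · rw [Finset.sum_const, smul_eq_mul, ucnt]
        congr 1
        have : (s.powersetCard c).filter (fun A => x ∈ A)
            = ((s.erase x).powersetCard (c - 1)).image (insert x) := by
          ext A
          simp only [Finset.mem_filter, Finset.mem_powersetCard, Finset.mem_image]
          constructor
          · rintro ⟨⟨h1, h2⟩, h3⟩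
            refine ⟨A.erase x, ⟨Finset.erase_subset_erase _ h1, ?_⟩, Finset.insert_erase h3⟩
            rw [Finset.card_erase_of_mem h3, h2]
          · rintro ⟨B, ⟨h1, h2⟩, rfl⟩
            have hxB : x ∉ B := fun h => by simpa using h1 h
            refine ⟨⟨?_, ?_⟩, Finset.mem_insert_self _ _⟩
            · exact Finset.insert_subset hx (h1.trans (Finset.erase_subset _ _))
            · rw [Finset.card_insert_of_notMem hxB]; omega
        rw [this, Finset.card_image_of_injOn, Finset.card_powersetCard, Finset.card_erase_of_mem hx, hs]
        intro A hA B hB hAB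
        have h1 : ∀ B ∈ ((s.erase x).powersetCard (c - 1)), x ∉ B := by
          intro B hB h
          simpa using (Finset.mem_powersetCard.1 hB).1 h
        rw [← Finset.erase_insert (h1 A hA), ← Finset.erase_insert (h1 B hB)]
        exact congrArg (fun t => Finset.erase t x) hAB
      · intro A hA
        simp only [Finset.mem_filter, Finset.mem_powersetCard] at hA
        rw [card_filter_mem hc hA.1.2 hA.1.1]
        apply ih
        rw [Finset.card_sdiff_of_subset hA.1.1, hs, hA.1.2, mul_add]
        simp
    · intro A hA B hB hAB
      rw [Function.onFun, Finset.disjoint_left]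
      intro P hP hP'
      simp only [Finset.coe_filter, Set.mem_setOf_eq, Finset.mem_filter, mem_upW] at hA hB hP hP'
      exact hAB (hP.1.uniq A hP.2 B hP'.2 x hA.2 hB.2)

end basic

theorem choose_ge (N r : ℕ) (h1 : 1 ≤ r) (h2 : r + 1 ≤ N) : N ≤ N.choose r := by
  induction N generalizing r with
  | zero => omega
  | succ N ih =>
    obtain ⟨r, rfl⟩ : ∃ q, r = q + 1 := ⟨r - 1, by omega⟩
    rw [Nat.choose_succ_succ]
    rcases Nat.lt_or_ge (r + 1) N with h | h
    · have := ih (r + 1) (by omega) (by omega)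
      have : 0 < N.choose r := Nat.choose_pos (by omega)
      simp only [Nat.succ_eq_add_one]
      omega
    · have : N = r + 1 := by omega
      subst this
      simp

theorem ucnt_pos {c : ℕ} (hc : 0 < c) (j : ℕ) : 0 < ucnt c j := by
  induction j with
  | zero => simp [ucnt]
  | succ j ih =>
    rw [ucnt]
    refine Nat.mul_pos (Nat.choose_pos ?_) ih
    have : c ≤ c * (j + 1) := Nat.le_mul_of_pos_right _ (by omega)
    omega

theorem ucnt_succ {c : ℕ} (hc : 2 ≤ c) (j : ℕ) : (2 * j + 1) * ucnt c j ≤ ucnt c (j + 1) := by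
  rw [ucnt]
  refine Nat.mul_le_mul_right _ ?_
  rcases Nat.eq_zero_or_pos j with rfl | hj
  · simp
  · have h1 : 2 * (j + 1) ≤ c * (j + 1) := Nat.mul_le_mul_right _ hc
    have h2 : c * 2 ≤ c * (j + 1) := Nat.mul_le_mul_left _ (by omega)
    refine le_trans ?_ (choose_ge _ _ (by omega) (by omega))
    omega

section main
variable {α : Type*} [DecidableEq α] {c k : ℕ} {s : Finset α} {F : Finset (Finset (Finset α))}

/-- members containing `S` -/
def gF (F : Finset (Finset (Finset α))) (S : Finset (Finset α)) : Finset (Finset (Finset α)) :=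
  F.filter (fun P => S ⊆ P)

theorem mem_gF {S P} : P ∈ gF F S ↔ P ∈ F ∧ S ⊆ P := Finset.mem_filter

theorem gF_le (hc : 0 < c) (hs : s.card = c * k) (hF : ∀ P ∈ F, IsUP c s P)
    (S : Finset (Finset α)) : (gF F S).card ≤ ucnt c (k - S.card) := by
  rcases (gF F S).eq_empty_or_nonempty with h | ⟨P, hP⟩
  · simp [h]
  rw [mem_gF] at hP
  have hP' := hF P hP.1
  rw [← card_upW hc (k - S.card) (s \ S.biUnion id)]
  · refine Finset.card_le_card_of_injOn (fun P => P \ S) ?_ ?_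
    · intro Q hQ
      have hQ := mem_gF.1 hQ
      exact mem_upW.2 ((hF Q hQ.1).sdiff hQ.2)
    · intro Q hQ R hR h
      have hQ := mem_gF.1 hQ
      have hR := mem_gF.1 hR
      have h : Q \ S = R \ S := h
      rw [← Finset.sdiff_union_of_subset hQ.2, h, Finset.sdiff_union_of_subset hR.2]
  · rw [(hP'.sdiff hP.2).card_eq, Finset.card_sdiff_of_subset hP.2]
    have := hP'.card_eq
    rw [hs] at this
    rw [Nat.eq_of_mul_eq_mul_left hc this]

theorem gF_branch (hint : ∀ P ∈ F, ∀ Q ∈ F, ∃ A, A ∈ P ∧ A ∈ Q) (hF : ∀ P ∈ F, IsUP c s P)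
    {S Q : Finset (Finset α)} (hQ : Q ∈ F) (hd : Disjoint S Q) {M : ℕ} 
    (hM : ∀ B ∈ Q, B ∉ S → (gF F (insert B S)).card ≤ M) :
    (gF F S).card ≤ (Q.filter (fun B => Disjoint (S.biUnion id) B)).card * M := by
  have : gF F S ⊆ (Q.filter (fun B => Disjoint (S.biUnion id) B)).biUnion
      (fun B => gF F (insert B S)) := by
    intro P hP
    rw [mem_gF] at hP
    obtain ⟨B, hB, hBQ⟩ := hint P hP.1 Q hQ
    have hBS : B ∉ S := fun h => Finset.disjoint_left.1 hd h hBQ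
    simp only [Finset.mem_biUnion, Finset.mem_filter]
    refine ⟨B, ⟨hBQ, ?_⟩, mem_gF.2 ⟨hP.1, Finset.insert_subset hB hP.2⟩⟩
    rw [Finset.disjoint_left]
    intro x hx hxB
    obtain ⟨A, hA, hxA⟩ := Finset.mem_biUnion.1 hx
    exact hBS ((hF P hP.1).uniq A (hP.2 hA) B hB x hxA hxB ▸ hA)
  refine (Finset.card_le_card this).trans (Finset.card_biUnion_le_card_mul _ _ _ ?_)
  intro B hB
  have hB := (Finset.mem_filter.1 hB).1
  exact hM B hB (fun h => Finset.disjoint_left.1 hd h hB)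

theorem gF_step (hc : 0 < c) (hs : s.card = c * k) (hF : ∀ P ∈ F, IsUP c s P)
    (hint : ∀ P ∈ F, ∀ Q ∈ F, ∃ A, A ∈ P ∧ A ∈ Q)
    {S Q : Finset (Finset α)} (hQ : Q ∈ F) (hd : Disjoint S Q) {M : ℕ} 
    (hM : ∀ B, B ∉ S → (gF F (insert B S)).card ≤ M) :
    (gF F S).card ≤ (k - S.card) * M := by
  rcases (gF F S).eq_empty_or_nonempty with h | ⟨P, hP⟩
  · simp [h]
  rw [mem_gF] at hP
  have hP' := hF P hP.1
  have hQ' := hF Q hQ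
  refine (gF_branch hint hF hQ hd (fun B _ => hM B)).trans (Nat.mul_le_mul_right _ ?_)
  set D := Q.filter (fun B => Disjoint (S.biUnion id) B) with hD
  have h1 : (S.biUnion id).card = c * S.card := card_bU S (fun A hA => hP'.crd A (hP.2 hA))
    (fun A hA B hB => hP'.uniq A (hP.2 hA) B (hP.2 hB))
  have hDQ : D ⊆ Q := Finset.filter_subset _ _
  have h2 : (D.biUnion id).card = c * D.card := card_bU D (fun A hA => hQ'.crd A (hDQ hA))
    (fun A hA B hB => hQ'.uniq A (hDQ hA) B (hDQ hB))
  have h3 : Disjoint (S.biUnion id) (D.biUnion id) := by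
    rw [Finset.disjoint_biUnion_right]
    intro B hB
    exact (Finset.mem_filter.1 hB).2
  have h4 : (S.biUnion id ∪ D.biUnion id) ⊆ s := by
    apply Finset.union_subset
    · exact Finset.biUnion_subset.2 (fun A hA => hP'.sub A (hP.2 hA))
    · exact Finset.biUnion_subset.2 (fun A hA => hQ'.sub A (hDQ hA))
  have h5 := Finset.card_le_card h4
  rw [Finset.card_union_of_disjoint h3, h1, h2, hs, ← mul_add] at h5
  have := Nat.le_of_mul_le_mul_left h5 hc
  omega

theorem gF_step_one (hc : 0 < c) (hs : s.card = c * k) (hF : ∀ P ∈ F, IsUP c s P)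
    (hint : ∀ P ∈ F, ∀ Q ∈ F, ∃ A, A ∈ P ∧ A ∈ Q)
    {A : Finset α} {Q : Finset (Finset α)} (hQ : Q ∈ F) (hd : A ∉ Q) {M : ℕ} 
    (hM : ∀ B, B ≠ A → (gF F {B, A}).card ≤ M) :
    (gF F {A}).card ≤ (k - 2) * M := by
  rcases (gF F {A}).eq_empty_or_nonempty with h | ⟨P, hP⟩
  · simp [h]
  rw [mem_gF] at hP
  have hP' := hF P hP.1
  have hQ' := hF Q hQ
  have hAP : A ∈ P := hP.2 (Finset.mem_singleton_self _)
  refine (gF_branch hint hF hQ (by simpa using hd) 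
    (fun B _ hB => hM B (by simpa using hB))).trans (Nat.mul_le_mul_right _ ?_)
  simp only [Finset.singleton_biUnion, id]
  obtain ⟨x, hx⟩ := Finset.card_pos.1 ((hP'.crd A hAP).symm ▸ hc)
  obtain ⟨B, hB, hxB⟩ := hQ'.cov x (hP'.sub A hAP hx)
  have hnot : ¬ A ⊆ B := by
    intro h
    have := Finset.eq_of_subset_of_card_le h (by rw [hP'.crd A hAP, hQ'.crd B hB])
    exact hd (this ▸ hB)
  obtain ⟨y, hy, hyB⟩ := Finset.not_subset.1 hnot
  obtain ⟨B', hB', hyB'⟩ := hQ'.cov y (hP'.sub A hAP hy)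
  have hne : B' ≠ B := fun h => hyB (h ▸ hyB')
  have hsub : Q.filter (fun B => Disjoint A B) ⊆ (Q.erase B).erase B' := by
    intro E hE
    rw [Finset.mem_filter] at hE
    rw [Finset.mem_erase, Finset.mem_erase]
    refine ⟨?_, ?_, hE.1⟩
    · rintro rfl
      exact Finset.disjoint_left.1 hE.2 hy hyB'
    · rintro rfl
      exact Finset.disjoint_left.1 hE.2 hx hxB
  refine (Finset.card_le_card hsub).trans ?_
  rw [Finset.card_erase_of_mem (Finset.mem_erase.2 ⟨hne, hB'⟩), Finset.card_erase_of_mem hB]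
  have := hQ'.card_eq
  rw [hs] at this
  have := Nat.eq_of_mul_eq_mul_left hc this
  omega

theorem gF_end (hc : 0 < c) (hk : 2 ≤ k) (hs : s.card = c * k) (hF : ∀ P ∈ F, IsUP c s P)
    (hint : ∀ P ∈ F, ∀ Q ∈ F, ∃ A, A ∈ P ∧ A ∈ Q)
    {S Q : Finset (Finset α)} (hQ : Q ∈ F) (hd : Disjoint S Q) (hS : S.card = k - 2) :
    (gF F S).card ≤ 1 := by
  rw [Finset.card_le_one]
  intro P hP P' hP'
  rw [mem_gF] at hP hP'
  obtain ⟨B, hB, hBQ⟩ := hint P hP.1 Q hQ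
  obtain ⟨B', hB', hBQ'⟩ := hint P' hP'.1 Q hQ
  have hBS : B ∉ S := fun h => Finset.disjoint_left.1 hd h hBQ
  have hBS' : B' ∉ S := fun h => Finset.disjoint_left.1 hd h hBQ'
  have hUP := hF P hP.1
  have hUP' := hF P' hP'.1
  have hUQ := hF Q hQ
  have hB'P : B' ∈ P := by
    by_cases hne : B' = B
    · exact hne ▸ hB
    have hcard : (P \ insert B S).card = 1 := by
      rw [Finset.card_sdiff_of_subset (Finset.insert_subset hB hP.2), 
        Finset.card_insert_of_notMem hBS, hS]
      have := hUP.card_eq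
      rw [hs] at this
      have := Nat.eq_of_mul_eq_mul_left hc this
      omega
    obtain ⟨R, hR⟩ := Finset.card_eq_one.1 hcard
    have hRP : R ∈ P := by
      have : R ∈ P \ insert B S := by rw [hR]; simp
      exact (Finset.mem_sdiff.1 this).1
    have hsub : B' ⊆ R := by
      intro x hx
      obtain ⟨E, hE, hxE⟩ := hUP.cov x (hUQ.sub B' hBQ' hx)
      have : E ∈ P \ insert B S := by
        rw [Finset.mem_sdiff, Finset.mem_insert]
        refine ⟨hE, ?_⟩
        rintro (rfl | h)
        · exact hne (hUQ.uniq B' hBQ' E hBQ x hx hxE)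
        · exact hBS' (hUP'.uniq E (hP'.2 h) B' hB' x hxE hx ▸ h)
      rw [hR, Finset.mem_singleton] at this
      exact this ▸ hxE
    have := Finset.eq_of_subset_of_card_le hsub (by rw [hUP.crd R hRP, hUQ.crd B' hBQ'])
    exact this ▸ hRP
  have h1 := gF_le hc hs hF (insert B' S)
  rw [Finset.card_insert_of_notMem hBS', hS, show k - (k - 2 + 1) = 1 by omega] at h1
  have h2 : ucnt c 1 = 1 := by simp [ucnt]
  rw [h2, Finset.card_le_one] at h1
  exact h1 P (mem_gF.2 ⟨hP.1, Finset.insert_subset hB'P hP.2⟩) 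
    P' (mem_gF.2 ⟨hP'.1, Finset.insert_subset hB' hP'.2⟩)

/-- strict bound for non-trivial families -/
theorem nontrivial_lt (hc : 0 < c) (hk : 0 < k) (hs : s.card = c * k) (hF : ∀ P ∈ F, IsUP c s P)
    (hint : ∀ P ∈ F, ∀ Q ∈ F, ∃ A, A ∈ P ∧ A ∈ Q)
    (hnt : ∀ A, ∃ P ∈ F, A ∉ P) : F.card < ucnt c (k - 1) := by
  classical
  obtain ⟨P0, hP0, -⟩ := hnt ∅
  have hcardF : ∀ P ∈ F, P.card = k := by
    intro P hP
    have := (hF P hP).card_eq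
    rw [hs] at this
    exact (Nat.eq_of_mul_eq_mul_left hc this).symm
  -- c = 1 is trivial
  rcases Nat.lt_or_ge c 2 with hc2 | hc2
  · exfalso
    have hc1 : c = 1 := by omega
    obtain ⟨A, hA, -⟩ := hint P0 hP0 P0 hP0
    obtain ⟨Q, hQ, hAQ⟩ := hnt A
    have hAc := (hF P0 hP0).crd A hA
    obtain ⟨x, hx⟩ := Finset.card_eq_one.1 (hAc.trans hc1)
    have hxA : x ∈ A := by simp [hx]
    obtain ⟨B, hB, hxB⟩ := (hF Q hQ).cov x ((hF P0 hP0).sub A hA hxA)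
    have hsub : A ⊆ B := by rw [hx]; simpa using hxB
    have := Finset.eq_of_subset_of_card_le hsub (by rw [(hF Q hQ).crd B hB, hAc])
    exact hAQ (this ▸ hB)
  -- minimal covers
  have hex : ∃ t, ∃ T : Finset (Finset α), T.card = t ∧ ∀ P ∈ F, ¬ Disjoint T P := by
    refine ⟨_, P0, rfl, fun P hP hd => ?_⟩
    obtain ⟨A, hA, hA'⟩ := hint P0 hP0 P hP
    exact Finset.disjoint_left.1 hd hA hA'
  obtain ⟨T, hT, hTcov⟩ := Nat.find_spec hex
  have hmin : ∀ S : Finset (Finset α), S.card < Nat.find hex → ∃ Q ∈ F, Disjoint S Q := by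
    intro S hS
    by_contra! hcon
    exact Nat.find_min hex hS ⟨S, rfl, hcon⟩
  have htk : Nat.find hex ≤ k := by
    refine Nat.find_min' hex ⟨P0, hcardF P0 hP0, fun P hP hd => ?_⟩
    obtain ⟨A, hA, hA'⟩ := hint P0 hP0 P hP
    exact Finset.disjoint_left.1 hd hA hA'
  generalize Nat.find hex = t at *
  have ht2 : 2 ≤ t := by
    by_contra! hlt
    rcases (show t = 0 ∨ t = 1 by omega) with h | h
    · rw [h, Finset.card_eq_zero] at hT
      exact hTcov P0 hP0 (by simp [hT])
    · rw [h, Finset.card_eq_one] at hT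
      obtain ⟨A, rfl⟩ := hT
      obtain ⟨Q, hQ, hAQ⟩ := hnt A
      exact hTcov Q hQ (by simpa using hAQ)
  have hFT : ∀ M, (∀ A, (gF F {A}).card ≤ M) → F.card ≤ t * M := by
    intro M hM
    have : F ⊆ T.biUnion (fun A => gF F {A}) := by
      intro P hP
      obtain ⟨A, hA, hA'⟩ := Finset.not_disjoint_iff.1 (hTcov P hP)
      exact Finset.mem_biUnion.2 ⟨A, hA, mem_gF.2 ⟨hP, by simpa using hA'⟩⟩
    rw [← hT]
    exact (Finset.card_le_card this).trans (Finset.card_biUnion_le_card_mul _ _ _ (fun A _ => hM A))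
  have hupos := ucnt_pos hc (k - 1)
  have hone : ∀ M, (∀ S : Finset (Finset α), S.card = 2 → (gF F S).card ≤ M) → 
      F.card ≤ t * ((k - 2) * M) := by
    intro M hM
    refine hFT _ (fun A => ?_)
    obtain ⟨Q, hQ, hAQ⟩ := hnt A
    exact gF_step_one hc hs hF hint hQ hAQ (fun B hB => hM _ (Finset.card_pair hB))
  rcases Nat.lt_or_ge k 3 with hk3 | hk3
  · have := hone F.card (fun S _ => Finset.card_le_card (Finset.filter_subset _ _))
    rw [show k - 2 = 0 by omega] at this
    simp at this
    simpa [this] using hupos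
  by_cases h33 : k = 3 ∧ t = 3
  · exfalso
    obtain ⟨A, hA, -⟩ := hint P0 hP0 P0 hP0
    obtain ⟨P1, hP1, hAP1⟩ := hnt A
    obtain ⟨B, hB0, hB1⟩ := hint P0 hP0 P1 hP1
    obtain ⟨Q, hQ, hd⟩ := hmin {B} (by simp; omega)
    have := gF_end hc (by omega) hs hF hint hQ hd (by simp; omega)
    rw [Finset.card_le_one] at this
    have := this P0 (mem_gF.2 ⟨hP0, by simpa using hB0⟩) P1 (mem_gF.2 ⟨hP1, by simpa using hB1⟩)
    exact hAP1 (this ▸ hA)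
  -- descending induction
  have hstep : ∀ j, 2 ≤ j → j + 2 ≤ k → j < t → 
      (∀ S : Finset (Finset α), S.card = j + 1 → t * (gF F S).card ≤ (j + 1) * ucnt c (k - (j + 1))) →
      ∀ S : Finset (Finset α), S.card = j → t * (gF F S).card ≤ j * ucnt c (k - j) := by
    intro j hj hjk hjt ih S hS
    obtain ⟨Q, hQ, hd⟩ := hmin S (by omega)
    have h1 := gF_step hc hs hF hint hQ hd (M := (j + 1) * ucnt c (k - (j + 1)) / t) (by
      intro B hB
      rw [Nat.le_div_iff_mul_le (by omega), mul_comm]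
      exact ih _ (by rw [Finset.card_insert_of_notMem hB, hS]))
    obtain ⟨m, hm⟩ : ∃ m, k = j + (m + 2) := ⟨k - j - 2, by omega⟩
    have h2 := Nat.mul_div_le ((j + 1) * ucnt c (k - (j + 1))) t
    rw [hS] at h1
    have h3 := ucnt_succ hc2 (m + 1)
    rw [show k - (j + 1) = m + 1 by omega] at h1 h2
    rw [show k - j = m + 1 + 1 by omega] at h1 ⊢
    generalize (j + 1) * ucnt c (m + 1) / t = M at *
    obtain ⟨i, rfl⟩ : ∃ i, j = i + 2 := ⟨j - 2, by omega⟩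
    calc t * (gF F S).card ≤ t * ((m + 1 + 1) * M) := Nat.mul_le_mul_left _ h1
      _ = (m + 2) * (t * M) := by ring
      _ ≤ (m + 2) * ((i + 2 + 1) * ucnt c (m + 1)) := Nat.mul_le_mul_left _ h2
      _ = ((m + 2) * (i + 3)) * ucnt c (m + 1) := by ring
      _ ≤ ((i + 2) * (2 * (m + 1) + 1)) * ucnt c (m + 1) := 
          Nat.mul_le_mul_right _ (by nlinarith)
      _ = (i + 2) * ((2 * (m + 1) + 1) * ucnt c (m + 1)) := by ring
      _ ≤ _ := Nat.mul_le_mul_left _ h3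
  have hdesc : ∀ b, 2 ≤ b → b ≤ t → b + 1 ≤ k → 
      (∀ S : Finset (Finset α), S.card = b → t * (gF F S).card ≤ b * ucnt c (k - b)) →
      ∀ S : Finset (Finset α), S.card = 2 → t * (gF F S).card ≤ 2 * ucnt c (k - 2) := by
    intro b hb
    induction b, hb using Nat.le_induction with
    | base => intro _ _ h; exact h
    | succ b hb ih =>
      intro hbt hbk h
      exact ih (by omega) (by omega) (hstep b hb (by omega) (by omega) h)
  have hG2 : ∀ S : Finset (Finset α), S.card = 2 → t * (gF F S).card ≤ 2 * ucnt c (k - 2) := by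
    rcases Nat.lt_or_ge t k with htk' | htk'
    · refine hdesc t ht2 le_rfl (by omega) (fun S hS => Nat.mul_le_mul_left _ ?_)
      rw [← hS]
      exact gF_le hc hs hF S
    · refine hdesc (k - 2) (by omega) (by omega) (by omega) (fun S hS => ?_)
      obtain ⟨Q, hQ, hd⟩ := hmin S (by omega)
      have h1 := gF_end hc (by omega) hs hF hint hQ hd hS
      have h2 := ucnt_succ hc2 1
      have h3 : ucnt c 1 = 1 := by simp [ucnt]
      rw [h3] at h2
      rw [show k - (k - 2) = 1 + 1 by omega]
      calc t * (gF F S).card ≤ t * 1 := Nat.mul_le_mul_left _ h1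
        _ ≤ (k - 2) * 3 := by omega
        _ ≤ _ := Nat.mul_le_mul_left _ (by omega)
  have hfin := hone (2 * ucnt c (k - 2) / t) (by
    intro S hS
    rw [Nat.le_div_iff_mul_le (by omega), mul_comm]
    exact hG2 S hS)
  have h2 := Nat.mul_div_le (2 * ucnt c (k - 2)) t
  have h3 := ucnt_succ hc2 (k - 2)
  have h4 := ucnt_pos hc (k - 2)
  rw [show k - 2 + 1 = k - 1 by omega] at h3
  generalize 2 * ucnt c (k - 2) / t = M at *
  calc F.card ≤ (k - 2) * (t * M) := by rw [mul_left_comm]; exact hfin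
    _ ≤ (k - 2) * (2 * ucnt c (k - 2)) := Nat.mul_le_mul_left _ h2
    _ < (2 * (k - 2) + 1) * ucnt c (k - 2) := by nlinarith
    _ ≤ _ := h3

end main

theorem isUP_parts {n c : ℕ} (P : Finpartition (Finset.univ : Finset (Fin n)))
    (h : ∀ A ∈ P.parts, A.card = c) : IsUP c Finset.univ P.parts :=
  ⟨h, fun _ _ => Finset.subset_univ _, fun A hA B hB x hx hx' => P.eq_of_mem_parts hA hB hx hx',
    fun x hx => P.exists_mem hx⟩

theorem exists_fp {n c : ℕ} (hc : 0 < c) {R : Finset (Finset (Fin n))} 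
    (h : IsUP c Finset.univ R) : ∃ P : Finpartition (Finset.univ : Finset (Fin n)), P.parts = R := by
  refine ⟨Finpartition.ofExistsUnique R h.sub ?_ ?_, rfl⟩
  · intro x hx
    obtain ⟨A, hA, hxA⟩ := h.cov x hx
    exact ⟨A, ⟨hA, hxA⟩, fun B hB => h.uniq B hB.1 A hA x hB.2 hxA⟩
  · intro h0
    have := h.crd ∅ h0
    simp at this
    omega

theorem uniformCount_eq {m c j : ℕ} (hc : 0 < c) (hm : m = c * j) :
    uniformCount m c = ucnt c j := by
  rw [← card_upW hc j (Finset.univ : Finset (Fin m)) (by simp [hm]), uniformCount,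
    ← Fintype.card_coe, ← Nat.card_eq_fintype_card]
  refine Nat.card_congr (Equiv.ofBijective
    (fun P => ⟨P.1.parts, mem_upW.2 (isUP_parts P.1 P.2)⟩) ⟨?_, ?_⟩)
  · intro P Q h
    exact Subtype.ext (Finpartition.ext (congrArg Subtype.val h))
  · rintro ⟨R, hR⟩
    have hR' := mem_upW.1 hR
    obtain ⟨P, rfl⟩ := exists_fp hc hR'
    exact ⟨⟨P, hR'.crd⟩, rfl⟩

/-- Erdős–Ko–Rado for uniform partition systems, `t = 1`: if `n = ck` and `Ps`
is a family of uniform `k`-partitions of an `n`-set (each class of size `c`)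
any two of which share a common class, then `|Ps| ≤ U(n−c, k−1)`, with equality
iff all partitions of the family contain one fixed common `c`-class and `Ps`
consists of all uniform partitions containing it. -/
theorem EKR_uniform_partitions (n c k : ℕ) (hc : 0 < c) (hk : 0 < k)
    (hn : n = c * k)
    (Ps : Finset (Finpartition (Finset.univ : Finset (Fin n))))
    (huniform : ∀ P ∈ Ps, ∀ A ∈ P.parts, A.card = c)
    (hint : ∀ P ∈ Ps, ∀ Q ∈ Ps, ∃ A, A ∈ P.parts ∧ A ∈ Q.parts) :
    Ps.card ≤ uniformCount (n - c) c ∧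
      (Ps.card = uniformCount (n - c) c ↔
        ∃ A : Finset (Fin n), A.card = c ∧
          ∀ P : Finpartition (Finset.univ : Finset (Fin n)),
            (∀ B ∈ P.parts, B.card = c) → (P ∈ Ps ↔ A ∈ P.parts)) := by
  classical
  have hcnt : uniformCount (n - c) c = ucnt c (k - 1) :=
    uniformCount_eq hc (by rw [hn, Nat.mul_sub, mul_one])
  rw [hcnt]
  have hs : (Finset.univ : Finset (Fin n)).card = c * k := by simp [hn]
  have hcn : c ≤ n := by rw [hn]; exact Nat.le_mul_of_pos_right _ hk
  have hstar : ∀ A : Finset (Fin n), A.card = c →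
      ((upW c (Finset.univ : Finset (Fin n))).filter (fun P => A ∈ P)).card = ucnt c (k - 1) := by
    intro A hA
    rw [card_filter_mem hc hA (Finset.subset_univ _)]
    apply card_upW hc
    rw [Finset.card_sdiff_of_subset (Finset.subset_univ _), hs, hA, Nat.mul_sub, mul_one]
  have hinj : Function.Injective
      (fun P : Finpartition (Finset.univ : Finset (Fin n)) => P.parts) :=
    fun P Q h => Finpartition.ext h
  set F := Ps.image (fun P => P.parts) with hFdef
  have hFcard : F.card = Ps.card := Finset.card_image_of_injective _ hinj
  have hmemF : ∀ P, P.parts ∈ F ↔ P ∈ Ps := fun P => by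
    rw [hFdef, Finset.mem_image]
    exact ⟨fun ⟨Q, hQ, h⟩ => hinj h ▸ hQ, fun h => ⟨P, h, rfl⟩⟩
  have hF : ∀ R ∈ F, IsUP c Finset.univ R := by
    intro R hR
    obtain ⟨P, hP, rfl⟩ := Finset.mem_image.1 hR
    exact isUP_parts P (huniform P hP)
  have hint' : ∀ P ∈ F, ∀ Q ∈ F, ∃ A, A ∈ P ∧ A ∈ Q := by
    intro R hR R' hR'
    obtain ⟨P, hP, rfl⟩ := Finset.mem_image.1 hR
    obtain ⟨Q, hQ, rfl⟩ := Finset.mem_image.1 hR'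
    exact hint P hP Q hQ
  rw [← hFcard]
  -- translation of the extremal condition
  have hiff : ∀ A : Finset (Fin n), (∀ P : Finpartition (Finset.univ : Finset (Fin n)),
      (∀ B ∈ P.parts, B.card = c) → (P ∈ Ps ↔ A ∈ P.parts)) ↔
      F = (upW c (Finset.univ : Finset (Fin n))).filter (fun P => A ∈ P) := by
    intro A
    constructor
    · intro h
      ext R
      rw [Finset.mem_filter, mem_upW]
      constructor
      · intro hR
        have hU := hF R hR
        obtain ⟨P, rfl⟩ := exists_fp hc hU
        exact ⟨hU, (h P hU.crd).1 ((hmemF P).1 hR)⟩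
      · rintro ⟨hU, hA⟩
        obtain ⟨P, rfl⟩ := exists_fp hc hU
        exact (hmemF P).2 ((h P hU.crd).2 hA)
    · intro h P hP
      rw [← hmemF, h, Finset.mem_filter, mem_upW]
      exact ⟨fun h => h.2, fun h => ⟨isUP_parts P hP, h⟩⟩
  simp only [hiff]
  have hback : (∃ A : Finset (Fin n), A.card = c ∧
      F = (upW c (Finset.univ : Finset (Fin n))).filter (fun P => A ∈ P)) →
      F.card = ucnt c (k - 1) := by
    rintro ⟨A, hA, h⟩
    rw [h, hstar A hA]
  by_cases htriv : ∃ A : Finset (Fin n), A.card = c ∧ ∀ P ∈ F, A ∈ P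
  · obtain ⟨A, hA, hAF⟩ := htriv
    have hsub : F ⊆ (upW c (Finset.univ : Finset (Fin n))).filter (fun P => A ∈ P) :=
      fun P hP => Finset.mem_filter.2 ⟨mem_upW.2 (hF P hP), hAF P hP⟩
    refine ⟨(Finset.card_le_card hsub).trans (hstar A hA).le, fun h => ⟨A, hA, ?_⟩, hback⟩
    exact Finset.eq_of_subset_of_card_le hsub (by rw [h, hstar A hA])
  · have hlt : F.card < ucnt c (k - 1) := by
      refine nontrivial_lt hc hk hs hF hint' ?_
      by_contra! hcon
      obtain ⟨A, hA⟩ := hcon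
      apply htriv
      rcases F.eq_empty_or_nonempty with h | ⟨P, hP⟩
      · obtain ⟨B, -, hB⟩ := Finset.exists_subset_card_eq
          (s := (Finset.univ : Finset (Fin n))) (n := c) (by simpa using hcn)
        exact ⟨B, hB, by simp [h]⟩
      · exact ⟨A, (hF P hP).crd A (hA P hP), hA⟩
    exact ⟨hlt.le, fun h => absurd h hlt.ne, hback⟩
end
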